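/- arXiv:2208.06629 — 3 statements merged into one kernel-verified Lean document; each statement's English description precedes it below -/
import Mathlib

section
/- For every integer n ≥ 3, U_3(n) ≤ 2n + 5·log₂ n + 3, and for every integer n ≥ 4, U_4(n) ≤ 3n + 8·log₂ n + 6. -/
open scoped BigOperators

/-- A lazy transposition on `n` positions, encoded as a triple `(a, b, p)`. -/
abbrev LazyT (n : ℕ) := Fin n × Fin n × ℝ

/-- The triple `(a, b, p)` is a valid lazy transposition: `a ≠ b` and `p ∈ [0,1]`. -/
def LazyT.Valid {n : ℕ} (e : LazyT n) : Prop :=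
  e.1 ≠ e.2.1 ∧ 0 ≤ e.2.2 ∧ e.2.2 ≤ 1

/-- A star transposition: its first coordinate is position `1` (index `0` in `Fin n`). -/
def LazyT.IsStar {n : ℕ} (e : LazyT n) : Prop := (e.1 : ℕ) = 0

/-- `permDist L σ` is the probability that the composition of the independent lazy
transpositions in `L` (applied in order) equals the permutation `σ`. -/
noncomputable def permDist {n : ℕ} : List (LazyT n) → Equiv.Perm (Fin n) → ℝ
  | [], σ => if σ = 1 then 1 else 0
  | e :: L, σ =>
      e.2.2 * permDist L (σ * Equiv.swap e.1 e.2.1) + (1 - e.2.2) * permDist L σ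

/-- `L` is a transposition shuffle on `n` points: all entries are valid lazy
transpositions and the composition is uniformly distributed on `Perm (Fin n)`. -/
def IsShuffle {n : ℕ} (L : List (LazyT n)) : Prop :=
  (∀ e ∈ L, e.Valid) ∧
  ∀ σ : Equiv.Perm (Fin n), permDist L σ = 1 / (n.factorial : ℝ)

/-- `U n` is the minimum length of a transposition shuffle on `n` points. -/
noncomputable def U (n : ℕ) : ℕ :=
  sInf { ℓ : ℕ | ∃ L : List (LazyT n), L.length = ℓ ∧ IsShuffle L }

/-- The probability that, after applying the lazy transpositions in `L`, the `t`
labelled counters starting in positions `1, …, t` end up placed according to the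
map `f` (counter `i` in position `f i`). -/
noncomputable def placeProb {n t : ℕ} (ht : t ≤ n) (L : List (LazyT n))
    (f : Fin t → Fin n) : ℝ :=
  ∑ σ : Equiv.Perm (Fin n),
    if ∀ i : Fin t, σ (Fin.castLE ht i) = f i then permDist L σ else 0

/-- `L` is a `(t,n)`-shuffle: all entries are valid and the final placement of the
`t` counters is uniform over all `n!/(n-t)!` injections. -/
def IsTShuffle {n t : ℕ} (ht : t ≤ n) (L : List (LazyT n)) : Prop :=
  (∀ e ∈ L, e.Valid) ∧
  ∀ f : Fin t → Fin n, Function.Injective f →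
    placeProb ht L f = ((n - t).factorial : ℝ) / (n.factorial : ℝ)

/-- `Ut t n` is the minimum length of a `(t,n)`-shuffle. -/
noncomputable def Ut (t n : ℕ) : ℕ :=
  sInf { ℓ : ℕ | ∃ (ht : t ≤ n) (L : List (LazyT n)), L.length = ℓ ∧ IsTShuffle ht L }

/-- The probability that after applying `L` the set of positions occupied by the
`t` (indistinguishable) counters starting in positions `1, …, t` is exactly `S`. -/
noncomputable def occProb {n t : ℕ} (ht : t ≤ n) (L : List (LazyT n))
    (S : Finset (Fin n)) : ℝ :=
  ∑ σ : Equiv.Perm (Fin n),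
    if Finset.image (fun i : Fin t => σ (Fin.castLE ht i)) Finset.univ = S
    then permDist L σ else 0

/-- `L` shuffles `t` indistinguishable counters over `n` positions: all entries are
valid and the occupied set is uniform over all `n.choose t` subsets of size `t`. -/
def IsIndShuffle {n t : ℕ} (ht : t ≤ n) (L : List (LazyT n)) : Prop :=
  (∀ e ∈ L, e.Valid) ∧
  ∀ S : Finset (Fin n), S.card = t → occProb ht L S = 1 / (n.choose t : ℝ)

/-- `Uhat t n` is the minimum length of a sequence of lazy transpositions shuffling
`t` indistinguishable counters uniformly over `n` positions. -/
noncomputable def Uhat (t n : ℕ) : ℕ :=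
  sInf { ℓ : ℕ | ∃ (ht : t ≤ n) (L : List (LazyT n)), L.length = ℓ ∧ IsIndShuffle ht L }

/-- `Ustar n` is the minimum length of a transposition shuffle on `n` points all of
whose lazy transpositions are star transpositions. -/
noncomputable def Ustar (n : ℕ) : ℕ :=
  sInf { ℓ : ℕ | ∃ L : List (LazyT n), L.length = ℓ ∧ IsShuffle L ∧ ∀ e ∈ L, e.IsStar }

/-- `Utstar t n` is the minimum length of a `(t,n)`-shuffle all of whose lazy
transpositions are star transpositions. -/
noncomputable def Utstar (t n : ℕ) : ℕ :=
  sInf { ℓ : ℕ | ∃ (ht : t ≤ n) (L : List (LazyT n)),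
    L.length = ℓ ∧ IsTShuffle ht L ∧ ∀ e ∈ L, e.IsStar }


namespace LazyShuffle

open Equiv

section basics

set_option linter.unusedSectionVars false

variable {α : Type} [DecidableEq α]

/-- Expectation of `f (σ * x)` where `σ` is the random product of the lazy transpositions. -/
def EE : List (α × α × ℝ) → (Perm α → ℝ) → Perm α → ℝ
  | [], f, x => f x
  | e :: L, f, x => e.2.2 * EE L f (swap e.1 e.2.1 * x) + (1 - e.2.2) * EE L f x

/-- valid lists -/
def VL (L : List (α × α × ℝ)) : Prop := ∀ e ∈ L, e.1 ≠ e.2.1 ∧ 0 ≤ e.2.2 ∧ e.2.2 ≤ 1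

/-- `h` depends only on the restriction to `T`. -/
def DepOn (T : Finset α) (h : Perm α → ℝ) : Prop :=
  ∀ x y : Perm α, (∀ i ∈ T, x i = y i) → h x = h y

/-- Average over the symmetric group. -/
noncomputable def avg [Fintype α] (h : Perm α → ℝ) : ℝ :=
  (∑ x : Perm α, h x) / (Fintype.card (Perm α) : ℝ)

/-- existence of a good list of length at most `ℓ` -/
def Good (α : Type) [Fintype α] [DecidableEq α] (T : Finset α) (ℓ : ℕ) : Prop :=
  ∃ L : List (α × α × ℝ), L.length ≤ ℓ ∧ VL L ∧ ∀ h, DepOn T h → EE L h 1 = avg h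

theorem EE_append (L₁ L₂ : List (α × α × ℝ)) (f : Perm α → ℝ) (x : Perm α) :
    EE (L₁ ++ L₂) f x = EE L₁ (EE L₂ f) x := by
  induction L₁ generalizing x with
  | nil => rfl
  | cons e L ih => simp only [List.cons_append, EE, ih]

theorem EE_shift (L : List (α × α × ℝ)) (f : Perm α → ℝ) (x y : Perm α) :
    EE L f (x * y) = EE L (fun z => f (z * y)) x := by
  induction L generalizing x with
  | nil => rfl
  | cons e L ih => simp only [EE, ← mul_assoc, ih]

theorem EE_shift_one (L : List (α × α × ℝ)) (f : Perm α → ℝ) (y : Perm α) :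
    EE L f y = EE L (fun z => f (z * y)) 1 := by
  rw [← EE_shift, one_mul]

theorem EE_dep (T : Finset α) (L : List (α × α × ℝ)) (f : Perm α → ℝ) (hf : DepOn T f) :
    DepOn T (EE L f) := by
  induction L with
  | nil => exact hf
  | cons e L ih =>
    intro x y hxy
    simp only [EE]
    rw [ih x y hxy, ih (swap e.1 e.2.1 * x) (swap e.1 e.2.1 * y)]
    intro i hi
    simp [hxy i hi]

theorem EE_congr (P : Perm α → Prop) (L : List (α × α × ℝ))
    (hP : ∀ e ∈ L, ∀ x, P x → P (swap e.1 e.2.1 * x)) (f g : Perm α → ℝ)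
    (hfg : ∀ x, P x → f x = g x) (x : Perm α) (hx : P x) : EE L f x = EE L g x := by
  induction L generalizing x with
  | nil => exact hfg x hx
  | cons e L ih =>
    have ih' := ih (fun e he => hP e (List.mem_cons_of_mem _ he))
    simp only [EE]
    rw [ih' x hx, ih' _ (hP e List.mem_cons_self x hx)]

theorem EE_sum {ι : Type} (s : Finset ι) (L : List (α × α × ℝ)) (f : ι → Perm α → ℝ) (c : ℝ)
    (x : Perm α) : EE L (fun z => (∑ i ∈ s, f i z) / c) x = (∑ i ∈ s, EE L (f i) x) / c := by
  induction L generalizing x with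
  | nil => rfl
  | cons e L ih =>
    simp only [EE, ih]
    simp only [Finset.sum_add_distrib, ← Finset.mul_sum]
    ring

theorem avg_add [Fintype α] (f g : Perm α → ℝ) : avg (fun x => f x + g x) = avg f + avg g := by
  simp [avg, Finset.sum_add_distrib, add_div]

theorem avg_smul [Fintype α] (c : ℝ) (f : Perm α → ℝ) : avg (fun x => c * f x) = c * avg f := by
  simp [avg, ← Finset.mul_sum, mul_div_assoc]

theorem avg_left [Fintype α] (f : Perm α → ℝ) (y : Perm α) : avg (fun x => f (y * x)) = avg f := by
  unfold avg
  congr 1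
  exact Equiv.sum_comp (Equiv.mulLeft y) f

theorem avg_right [Fintype α] (f : Perm α → ℝ) (y : Perm α) : avg (fun x => f (x * y)) = avg f := by
  unfold avg
  congr 1
  exact Equiv.sum_comp (Equiv.mulRight y) f

theorem avg_const [Fintype α] (c : ℝ) : avg (fun _ : Perm α => c) = c := by
  unfold avg
  rw [Finset.sum_const, Finset.card_univ, nsmul_eq_mul]
  have : (Fintype.card (Perm α) : ℝ) ≠ 0 := by exact_mod_cast Fintype.card_ne_zero
  field_simp

theorem avg_comm {β : Type} [DecidableEq β] [Fintype α] [Fintype β] (f : Perm α → Perm β → ℝ) :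
    avg (fun x => avg (fun y => f x y)) = avg (fun y => avg (fun x => f x y)) := by
  unfold avg
  simp only [← Finset.sum_div]
  rw [Finset.sum_comm, div_right_comm]

theorem avg_EE [Fintype α] (L : List (α × α × ℝ)) (f : Perm α → ℝ) : avg (EE L f) = avg f := by
  induction L with
  | nil => rfl
  | cons e L ih =>
    have : EE (e :: L) f = fun x => e.2.2 * EE L f (swap e.1 e.2.1 * x) + (1 - e.2.2) * EE L f x := by
      funext x; rfl
    rw [this, avg_add, avg_smul, avg_smul, avg_left (EE L f), ih]
    ring

/-- lifting a list along a map -/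
def lift {β : Type} (e : β → α) (L : List (β × β × ℝ)) : List (α × α × ℝ) :=
  L.map (fun d => (e d.1, e d.2.1, d.2.2))

theorem EE_lift {β : Type} [DecidableEq β] (θ : Perm β →* Perm α) (e : β → α)
    (hθ : ∀ a b, θ (swap a b) = swap (e a) (e b)) (L : List (β × β × ℝ)) (f : Perm α → ℝ)
    (x : Perm α) : EE (lift e L) f x = EE L (fun σ => f (θ σ * x)) 1 := by
  have key : ∀ σ : Perm β, EE (lift e L) f (θ σ * x) = EE L (fun σ => f (θ σ * x)) σ := by
    induction L with
    | nil => intro σ; rfl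
    | cons d L ih =>
      intro σ
      simp only [lift, List.map_cons, EE]
      rw [← hθ, ← mul_assoc, ← map_mul]
      rw [← lift, ih, ih]
  simpa using key 1

theorem VL_lift {β : Type} (e : β → α) (he : Function.Injective e) (L : List (β × β × ℝ))
    (h : ∀ e ∈ L, e.1 ≠ e.2.1 ∧ 0 ≤ e.2.2 ∧ e.2.2 ≤ 1) : VL (lift e L) := by
  intro d hd
  simp only [lift, List.mem_map] at hd
  obtain ⟨d', hd', rfl⟩ := hd
  have := h d' hd'
  exact ⟨fun h => this.1 (he h), this.2⟩

theorem VL_append {L₁ L₂ : List (α × α × ℝ)} (h₁ : VL L₁) (h₂ : VL L₂) : VL (L₁ ++ L₂) := by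
  intro e he
  rcases List.mem_append.1 he with h | h
  · exact h₁ e h
  · exact h₂ e h

theorem lift_length {β : Type} (e : β → α) (L : List (β × β × ℝ)) :
    (lift e L).length = L.length := by simp [lift]

theorem Good_mono [Fintype α] {T : Finset α} {a b : ℕ} (h : Good α T a) (hab : a ≤ b) :
    Good α T b := by
  obtain ⟨L, h1, h2, h3⟩ := h
  exact ⟨L, h1.trans hab, h2, h3⟩

theorem permCongr_swap {β : Type} [DecidableEq β] (e : β ≃ α) (a b : β) :
    e.permCongr (swap a b) = swap (e a) (e b) := by
  ext i
  simp only [Equiv.permCongr_apply]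
  rw [Equiv.swap_apply_def, Equiv.swap_apply_def]
  simp only [Equiv.symm_apply_eq]
  split_ifs <;> simp

theorem Good_transport {β : Type} [DecidableEq β] [Fintype β] [Fintype α] (e : β ≃ α)
    (S : Finset β) (T : Finset α) (hST : ∀ i, i ∈ S ↔ e i ∈ T) (ℓ : ℕ) (h : Good β S ℓ) :
    Good α T ℓ := by
  obtain ⟨L, h1, h2, h3⟩ := h
  refine ⟨lift e L, by rwa [lift_length], VL_lift e e.injective L h2, ?_⟩
  intro f hf
  rw [EE_lift (e.permCongrHom.toMonoidHom) e (fun a b => permCongr_swap e a b), h3]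
  · unfold avg
    have hc : Fintype.card (Perm β) = Fintype.card (Perm α) := Fintype.card_congr e.permCongr
    rw [hc]
    congr 1
    simp only [mul_one]
    exact Equiv.sum_comp e.permCongr f
  · intro x y hxy
    apply hf
    intro i hi
    have := hxy (e.symm i) ((hST _).2 (by simpa using hi))
    simp [Equiv.permCongrHom, Equiv.permCongr_apply, this]

theorem exists_equiv_cells {β γ : Type} [DecidableEq γ] [Fintype β] [Fintype α]
    (c : α → γ) (d : β → γ)
    (h : ∀ k, (Finset.univ.filter (fun i => c i = k)).card = (Finset.univ.filter (fun i => d i = k)).card) :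
    ∃ e : α ≃ β, ∀ i, d (e i) = c i := by
  have : ∀ k, Nonempty ({a // c a = k} ≃ {b // d b = k}) := by
    intro k
    refine ⟨Fintype.equivOfCardEq ?_⟩
    rw [Fintype.card_subtype, Fintype.card_subtype, h]
  refine ⟨Equiv.ofFiberEquiv (fun k => (this k).some), fun i => ?_⟩
  exact Equiv.ofFiberEquiv_map _ i

theorem Good_of_card {β : Type} [DecidableEq β] [Fintype β] [Fintype α]
    (S : Finset β) (T : Finset α) (h1 : Fintype.card β = Fintype.card α) (h2 : S.card = T.card)
    (ℓ : ℕ) (h : Good β S ℓ) : Good α T ℓ := by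
  have : ∃ e : β ≃ α, ∀ i, decide (e i ∈ T) = decide (i ∈ S) := by
    apply exists_equiv_cells (fun i => decide (i ∈ S)) (fun i => decide (i ∈ T))
    intro k
    have a1 := Finset.card_compl S
    have a2 := Finset.card_compl T
    cases k
    · have e1 : Finset.univ.filter (fun i => decide (i ∈ S) = false) = Sᶜ := by ext; simp
      have e2 : Finset.univ.filter (fun i => decide (i ∈ T) = false) = Tᶜ := by ext; simp
      rw [e1, e2, a1, a2, h1, h2]
    · have e1 : Finset.univ.filter (fun i => decide (i ∈ S) = true) = S := by ext; simp
      have e2 : Finset.univ.filter (fun i => decide (i ∈ T) = true) = T := by ext; simp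
      rw [e1, e2, h2]
  obtain ⟨e, he⟩ := this
  refine Good_transport e S T (fun i => ?_) ℓ h
  have := he i
  simpa [eq_comm] using this

end basics

/-- Good lists exist for all ground types of size `n` and slot sets of size `min t n`. -/
def GG (t n ℓ : ℕ) : Prop :=
  ∀ (α : Type) [Fintype α] [DecidableEq α] (T : Finset α),
    Fintype.card α = n → T.card = min t n → Good α T ℓ

theorem GG_of_model {t n ℓ : ℕ} (β : Type) [Fintype β] [DecidableEq β] (S : Finset β)
    (h1 : Fintype.card β = n) (h2 : S.card = min t n) (h : Good β S ℓ) : GG t n ℓ := by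
  intro α _ _ T h3 h4
  exact Good_of_card S T (h1.trans h3.symm) (h2.trans h4.symm) ℓ h


/-! ### Link with the frozen definitions -/

theorem permDist_EE {n : ℕ} (L : List (LazyT n)) (f : Perm (Fin n) → ℝ) (x : Perm (Fin n)) :
    ∑ σ : Perm (Fin n), permDist L σ * f (σ * x) = EE L f x := by
  induction L generalizing x with
  | nil => simp [permDist, EE]
  | cons e L ih =>
    simp only [permDist, EE, add_mul, Finset.sum_add_distrib, ← ih, Finset.mul_sum]
    congr 1
    · rw [← Equiv.sum_comp (Equiv.mulRight (swap e.1 e.2.1))]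
      refine Finset.sum_congr rfl fun σ _ => ?_
      simp [mul_assoc]
    · refine Finset.sum_congr rfl fun σ _ => ?_
      ring

theorem card_extend {n t : ℕ} (ht : t ≤ n) (f : Fin t → Fin n) (hf : Function.Injective f) :
    (Finset.univ.filter (fun σ : Perm (Fin n) => ∀ i : Fin t, σ (Fin.castLE ht i) = f i)).card
      = (n - t).factorial := by
  classical
  have hτ : ∃ τ : Perm (Fin n), ∀ i : Fin t, τ (Fin.castLE ht i) = f i := by
    let e1 := Equiv.ofInjective (Fin.castLE ht) (Fin.castLE_injective ht)
    let e2 := Equiv.ofInjective f hf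
    let e : {x // x ∈ Set.range (Fin.castLE ht)} ≃ {x // x ∈ Set.range f} := e1.symm.trans e2
    refine ⟨e.extendSubtype, fun i => ?_⟩
    rw [Equiv.extendSubtype_apply_of_mem e _ ⟨i, rfl⟩]
    have : e1.symm ⟨Fin.castLE ht i, ⟨i, rfl⟩⟩ = i := by
      rw [Equiv.symm_apply_eq]; rfl
    simp [e, this, e2]
  obtain ⟨τ, hτ⟩ := hτ
  let p : Fin n → Prop := fun i => ¬ (i : ℕ) < t
  have hc : Fintype.card {i // p i} = n - t := by
    have h1 := Fintype.card_subtype_compl (fun i : Fin n => (i : ℕ) < t)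
    have h2 : Fintype.card {i : Fin n // (i : ℕ) < t} = t := by
      have : Fintype.card {i : Fin n // (i : ℕ) < t} = Fintype.card (Fin t) := by
        refine Fintype.card_congr ⟨fun i => ⟨i.1, i.2⟩, fun i => ⟨Fin.castLE ht i, i.2⟩, ?_, ?_⟩
        · intro i; rfl
        · intro i; rfl
      simpa using this
    rw [h2, Fintype.card_fin] at h1
    exact h1
  rw [← Fintype.card_subtype, ← hc, ← Fintype.card_perm]
  refine Fintype.card_congr (Equiv.trans ?_ (Equiv.Perm.subtypeEquivSubtypePerm p).symm)
  refine Equiv.subtypeEquiv (Equiv.mulLeft τ⁻¹) ?_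
  intro σ
  constructor
  · intro h a ha
    have ha' : (a : ℕ) < t := by simpa [p] using ha
    have := h ⟨a, ha'⟩
    rw [← hτ] at this
    have e : Fin.castLE ht ⟨a, ha'⟩ = a := rfl
    rw [e] at this
    simp [this]
  · intro h i
    have := h (Fin.castLE ht i) (by simp [p])
    rw [← hτ]
    simpa [Equiv.symm_apply_eq] using this

theorem Ut_le_of_GG {t n ℓ : ℕ} (ht : t ≤ n) (h : GG t n ℓ) : Ut t n ≤ ℓ := by
  classical
  have hT : (Finset.univ.image (Fin.castLE ht)).card = min t n := by
    rw [Finset.card_image_of_injective _ (Fin.castLE_injective ht)]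
    simp [ht]
  obtain ⟨L, h1, h2, h3⟩ := h (Fin n) (Finset.univ.image (Fin.castLE ht)) (by simp) hT
  refine le_trans (Nat.sInf_le ⟨ht, L, rfl, h2, ?_⟩) h1
  intro f hf
  have hd := h3 (fun σ => if ∀ i : Fin t, σ (Fin.castLE ht i) = f i then 1 else 0) (by
    intro x y hxy
    have : ∀ i : Fin t, x (Fin.castLE ht i) = y (Fin.castLE ht i) := fun i =>
      hxy _ (Finset.mem_image_of_mem _ (Finset.mem_univ i))
    simp only [this])
  rw [← permDist_EE] at hd
  unfold placeProb
  have e : ∀ σ : Perm (Fin n), (if ∀ i : Fin t, σ (Fin.castLE ht i) = f i then permDist L σ else 0)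
    = permDist L σ * (if ∀ i : Fin t, (σ * 1) (Fin.castLE ht i) = f i then 1 else 0) := by
    intro σ; simp
  rw [Finset.sum_congr rfl (fun σ _ => e σ), hd]
  unfold avg
  rw [Finset.sum_boole, card_extend ht f hf, Fintype.card_perm, Fintype.card_fin]


/-! ### Adding one position -/

section step

set_option linter.unusedSectionVars false

variable {β : Type} [DecidableEq β]

/-- swap list towards `none` -/
noncomputable def M (N : ℕ) : List β → List (Option β × Option β × ℝ)
  | [] => []
  | j :: l => (some j, none, 1 / ((N : ℝ) - l.length)) :: M N l

theorem M_length (N : ℕ) (l : List β) : (M N l).length = l.length := by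
  induction l with
  | nil => rfl
  | cons j l ih => simp [M, ih]

theorem M_VL (N : ℕ) (l : List β) (h : l.length ≤ N) : VL (M N l) := by
  induction l with
  | nil => intro e he; simp [M] at he
  | cons j l ih =>
    intro e he
    simp only [List.length_cons] at h
    have h' : (l.length : ℝ) + 1 ≤ N := by exact_mod_cast h
    simp only [M, List.mem_cons] at he
    rcases he with rfl | he
    · refine ⟨by simp, ?_, ?_⟩
      · apply div_nonneg <;> linarith
      · show 1 / ((N : ℝ) - l.length) ≤ 1
        rw [div_le_one] <;> linarith
    · exact ih (by omega) e he

theorem M_mem (N : ℕ) (l : List β) : ∀ e ∈ M N l, ∃ j ∈ l, e.1 = some j ∧ e.2.1 = none := by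
  induction l with
  | nil => intro e he; simp [M] at he
  | cons j l ih =>
    intro e he
    simp only [M, List.mem_cons] at he
    rcases he with rfl | he
    · exact ⟨j, by simp, rfl, rfl⟩
    · obtain ⟨k, hk, h⟩ := ih e he
      exact ⟨k, by simp [hk], h⟩

theorem EE_M (φ : Option β → ℝ) (Φ : Perm (Option β) → ℝ) (hΦ : ∀ τ, Φ τ = φ (τ⁻¹ none)) (N : ℕ)
    (l : List β) (hl : l.Nodup) (hN : l.length ≤ N) (x : Perm (Option β)) :
    EE (M N l) Φ x = (1 / (N : ℝ)) * (l.map (fun i => φ (x⁻¹ (some i)))).sum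
      + (1 - l.length / (N : ℝ)) * φ (x⁻¹ none) := by
  induction l generalizing x with
  | nil => simp [M, EE, hΦ]
  | cons j l ih =>
    simp only [List.length_cons] at hN
    rw [List.nodup_cons] at hl
    simp only [M, EE]
    rw [ih hl.2 (by omega), ih hl.2 (by omega)]
    have e1 : l.map (fun i => φ ((swap (some j) none * x)⁻¹ (some i)))
        = l.map (fun i => φ (x⁻¹ (some i))) := by
      apply List.map_congr_left
      intro i hi
      have hij : i ≠ j := fun h => hl.1 (h ▸ hi)
      rw [mul_inv_rev, Perm.mul_apply, swap_inv, swap_apply_of_ne_of_ne (by simpa using hij) (by simp)]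
    rw [e1, mul_inv_rev, Perm.mul_apply, swap_inv, swap_apply_right]
    simp only [List.map_cons, List.sum_cons, List.length_cons]
    have h' : (l.length : ℝ) + 1 ≤ N := by exact_mod_cast hN
    have h0 : (0 : ℝ) ≤ l.length := by positivity
    have hN0 : (N : ℝ) ≠ 0 := by linarith
    have h2 : (N : ℝ) - l.length ≠ 0 := by linarith
    push_cast
    field_simp
    ring

/-- `optionCongr` as a hom -/
def optHom (β : Type) : Perm β →* Perm (Option β) where
  toFun σ := optionCongr σ
  map_one' := Equiv.optionCongr_one
  map_mul' a b := by
    ext i : 1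
    cases i <;> simp

theorem optHom_none (σ : Perm β) : optHom β σ none = none := rfl
theorem optHom_some (σ : Perm β) (i : β) : optHom β σ (some i) = some (σ i) := rfl

theorem avg_option [Fintype β] (h : Perm (Option β) → ℝ) :
    avg h = (1 / ((Fintype.card β + 1 : ℕ) : ℝ)) *
      ∑ i : Option β, avg (fun σ : Perm β => h (optHom β σ * swap i none)) := by
  unfold avg
  have hc : Fintype.card (Perm (Option β)) = (Fintype.card β + 1) * Fintype.card (Perm β) := by
    rw [Fintype.card_perm, Fintype.card_perm, Fintype.card_option, Nat.factorial_succ]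
  have h1 : ∑ x : Perm (Option β), h x
      = ∑ i : Option β, ∑ σ : Perm β, h (optHom β σ * swap i none) := by
    rw [← Finset.sum_product', Finset.univ_product_univ]
    rw [← Equiv.sum_comp (Equiv.inv (Perm (Option β))) h,
      ← Equiv.sum_comp (Equiv.Perm.decomposeOption (α := β)).symm,
      ← Equiv.sum_comp (Equiv.prodCongr (Equiv.refl (Option β)) (Equiv.inv (Perm β)))]
    refine Finset.sum_congr rfl fun p _ => ?_
    congr 1
    show (swap none p.1 * optHom β (p.2⁻¹))⁻¹ = _
    rw [map_inv, mul_inv_rev, inv_inv, swap_inv, swap_comm]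
  rw [h1, hc, ← Finset.sum_div]
  push_cast
  rw [div_mul_div_comm, one_mul]

theorem opt_decomp (τ : Perm (Option β)) : ∃ σ : Perm β, τ = optHom β σ * swap (τ⁻¹ none) none := by
  obtain ⟨⟨i, σ⟩, h⟩ := (Equiv.Perm.decomposeOption (α := β)).symm.surjective τ⁻¹
  have h' : swap none i * optHom β σ = τ⁻¹ := h
  have : τ⁻¹ none = i := by
    rw [← h', Perm.mul_apply, optHom_none, swap_apply_left]
  refine ⟨σ⁻¹, ?_⟩
  rw [this, map_inv, ← inv_inv τ, ← h', mul_inv_rev, swap_inv, swap_comm]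

theorem Good_step [Fintype β] (S : Finset β) (T : Finset (Option β))
    (h1 : ∀ j, some j ∈ T → j ∈ S) (h2 : none ∈ T → S = Finset.univ) (ℓ : ℕ) (hG : Good β S ℓ) :
    Good (Option β) T (ℓ + S.card) := by
  obtain ⟨L, hL1, hL2, hL3⟩ := hG
  set N := Fintype.card β + 1 with hN
  have hcard : S.toList.length ≤ N := by
    rw [Finset.length_toList]
    have := Finset.card_le_univ S
    omega
  refine ⟨M N S.toList ++ lift some L, ?_, ?_, ?_⟩
  · rw [List.length_append, M_length, lift_length, Finset.length_toList]
    omega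
  · exact VL_append (M_VL _ _ hcard) (VL_lift _ (Option.some_injective _) _ hL2)
  intro h hh
  rw [EE_append]
  let φ : Option β → ℝ := fun i => avg (fun σ : Perm β => h (optHom β σ * swap i none))
  let Φ : Perm (Option β) → ℝ := fun τ => avg (fun σ : Perm β => h (optHom β σ * τ))
  have hΦ : ∀ τ, Φ τ = φ (τ⁻¹ none) := by
    intro τ
    obtain ⟨ρ, hρ⟩ := opt_decomp τ
    have : Φ τ = avg (fun σ : Perm β => (fun σ' => h (optHom β σ' * swap (τ⁻¹ none) none)) (σ * ρ)) := by
      show avg _ = _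
      congr 1
      funext σ
      show _ = h (optHom β (σ * ρ) * swap (τ⁻¹ none) none)
      rw [map_mul, mul_assoc, ← hρ]
    exact this.trans (avg_right (fun σ' => h (optHom β σ' * swap (τ⁻¹ none) none)) ρ)
  have e1 : EE (M N S.toList) (EE (lift some L) h) 1 = EE (M N S.toList) Φ 1 := by
    apply EE_congr (fun x => ∀ i ∈ T, ∀ j, x i = some j → j ∈ S)
    · intro e he x hx i hi j hj
      obtain ⟨k, hk, hk1, hk2⟩ := M_mem _ _ e he
      rw [Finset.mem_toList] at hk
      rw [hk1, hk2, Perm.mul_apply, swap_apply_def] at hj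
      split_ifs at hj with c1 c2
      · simp at hj; exact hj ▸ hk
      · exact hx i hi j hj
    · intro x hx
      rw [EE_lift (optHom β) some (fun a b => Equiv.optionCongr_swap a b), hL3]
      intro a b hab
      apply hh
      intro i hi
      rw [Perm.mul_apply, Perm.mul_apply]
      cases hxi : x i with
      | none => rfl
      | some j => rw [optHom_some, optHom_some, hab j (hx i hi j hxi)]
    · intro i hi j hj
      rw [Perm.one_apply] at hj
      exact h1 j (hj ▸ hi)
  rw [e1, EE_M φ Φ hΦ N _ S.nodup_toList hcard, avg_option h, ← hN]
  have e2 : (S.toList.map (fun i => φ ((1 : Perm (Option β))⁻¹ (some i)))).sum = ∑ i ∈ S, φ (some i) := by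
    simp [Finset.sum_map_toList]
  rw [e2, Finset.length_toList, Fintype.sum_option]
  have e3 : ∀ i, i ∉ S → φ (some i) = φ none := by
    intro i hi
    show avg _ = avg _
    congr 1
    funext σ
    apply hh
    intro k hk
    have k1 : k ≠ some i := by
      rintro rfl; exact hi (h1 i hk)
    have k2 : k ≠ none := by
      rintro rfl; rw [h2 hk] at hi; simp at hi
    rw [Perm.mul_apply, Perm.mul_apply, swap_apply_of_ne_of_ne k1 k2, swap_self, Equiv.refl_apply]
  have e4 : ∑ i : β, φ (some i) = ∑ i ∈ S, φ (some i) + ((Fintype.card β : ℝ) - S.card) * φ none := by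
    rw [← Finset.sum_add_sum_compl S]
    congr 1
    rw [Finset.sum_congr rfl (fun i hi => e3 i (by simpa using hi)), Finset.sum_const,
      Finset.card_compl, nsmul_eq_mul, Nat.cast_sub (Finset.card_le_univ S)]
  show _ = (1 / (N : ℝ)) * (φ none + ∑ i : β, φ (some i))
  rw [e4]
  have hN' : (N : ℝ) = Fintype.card β + 1 := by rw [hN]; push_cast; rfl
  have hN0 : (N : ℝ) ≠ 0 := by rw [hN']; positivity
  have e5 : (Fintype.card β : ℝ) = N - 1 := by rw [hN']; ring
  rw [e5]
  simp only [inv_one, Perm.one_apply]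
  field_simp
  ring

end step

theorem GG_zero (t : ℕ) : GG t 0 0 := by
  intro α _ _ T h1 h2
  refine ⟨[], le_rfl, by intro e he; simp at he, ?_⟩
  intro h _
  have : IsEmpty α := Fintype.card_eq_zero_iff.1 h1
  have e : h = fun _ => h 1 := by funext x; rw [Subsingleton.elim x 1]
  rw [e, avg_const]; rfl

theorem GG_step {t n ℓ : ℕ} (h : GG t n ℓ) : GG t (n + 1) (ℓ + min t n) := by
  obtain ⟨S, -, hS⟩ := Finset.exists_subset_card_eq (s := (Finset.univ : Finset (Fin n)))
    (n := min t n) (by simp)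
  have hG := h (Fin n) S (by simp) hS
  by_cases htn : t ≤ n
  · refine GG_of_model (Option (Fin n)) (S.map Function.Embedding.some) (by simp) ?_ ?_
    · rw [Finset.card_map, hS]; omega
    · rw [← hS]
      apply Good_step S _ _ _ _ hG
      · intro j hj; simpa using hj
      · intro hj; simp at hj
  · have hSu : S = Finset.univ := by
      apply Finset.eq_univ_of_card
      rw [hS, Fintype.card_fin]; omega
    refine GG_of_model (Option (Fin n)) Finset.univ (by simp) ?_ ?_
    · rw [Finset.card_univ, Fintype.card_option, Fintype.card_fin]; omega
    · rw [← hS]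
      apply Good_step S _ _ _ _ hG
      · intro j hj; simp [hSu]
      · intro hj; exact hSu

theorem GG_mono {t n a b : ℕ} (h : GG t n a) (hab : a ≤ b) : GG t n b := by
  intro α _ _ T h1 h2
  exact Good_mono (h α T h1 h2) hab

theorem GG_one (m : ℕ) : GG 1 (m + 1) m := by
  induction m with
  | zero => exact GG_step (GG_zero 1)
  | succ m ih => exact GG_mono (GG_step ih) (by omega)

theorem GG_two (m : ℕ) : GG 2 (m + 2) (2 * m + 1) := by
  induction m with
  | zero => exact GG_mono (GG_step (GG_step (GG_zero 2))) (by omega)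
  | succ m ih => exact GG_mono (GG_step ih) (by omega)

theorem GG_three (m : ℕ) : GG 3 (m + 3) (3 * m + 3) := by
  induction m with
  | zero => exact GG_mono (GG_step (GG_step (GG_step (GG_zero 3)))) (by omega)
  | succ m ih => exact GG_mono (GG_step ih) (by omega)

theorem GG_four (m : ℕ) : GG 4 (m + 4) (4 * m + 6) := by
  induction m with
  | zero => exact GG_mono (GG_step (GG_step (GG_step (GG_step (GG_zero 4))))) (by omega)
  | succ m ih => exact GG_mono (GG_step ih) (by omega)


/-! ### Doubling -/

section double

set_option linter.unusedSectionVars false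

variable {β : Type} [DecidableEq β]

/-- column swap -/
def csw (i : β) : Perm (β ⊕ β) := swap (Sum.inl i) (Sum.inr i)

theorem csw_comm (i j : β) : csw i * csw j = csw j * csw i := by
  by_cases h : i = j
  · rw [h]
  · unfold csw
    rw [mul_swap_eq_swap_mul, swap_apply_of_ne_of_ne, swap_apply_of_ne_of_ne] <;>
      simp [Ne.symm h]

/-- list of column half-swaps -/
noncomputable def cols (l : List β) : List ((β ⊕ β) × (β ⊕ β) × ℝ) :=
  l.map (fun i => (Sum.inl i, Sum.inr i, 1 / 2))

theorem cols_VL (l : List β) : VL (cols l) := by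
  intro e he
  simp only [cols, List.mem_map] at he
  obtain ⟨i, _, rfl⟩ := he
  refine ⟨by simp, ?_, ?_⟩ <;> norm_num

theorem cols_inv (l : List β) (f : Perm (β ⊕ β) → ℝ) (i : β) (hi : i ∈ l) (x : Perm (β ⊕ β)) :
    EE (cols l) f (csw i * x) = EE (cols l) f x := by
  induction l generalizing x with
  | nil => simp at hi
  | cons j l ih =>
    show (1 / 2 : ℝ) * EE (cols l) f (csw j * (csw i * x)) + (1 - 1 / 2) * EE (cols l) f (csw i * x)
      = (1 / 2 : ℝ) * EE (cols l) f (csw j * x) + (1 - 1 / 2) * EE (cols l) f x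
    by_cases h : i = j
    · subst h
      have : csw i * (csw i * x) = x := swap_mul_self_mul _ _ _
      rw [this]; ring
    · have hil : i ∈ l := by simpa [h] using hi
      rw [← mul_assoc, csw_comm, mul_assoc, ih hil, ih hil]

/-- product of column swaps -/
def flipL : List β → Perm (β ⊕ β)
  | [] => 1
  | i :: l => csw i * flipL l

theorem flipL_apply (l : List β) (hl : l.Nodup) (i : β) :
    flipL l (Sum.inl i) = (if i ∈ l then Sum.inr i else Sum.inl i) ∧
    flipL l (Sum.inr i) = (if i ∈ l then Sum.inl i else Sum.inr i) := by
  induction l with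
  | nil => simp [flipL]
  | cons j l ih =>
    rw [List.nodup_cons] at hl
    have ih := ih hl.2
    simp only [flipL, Perm.mul_apply, ih.1, ih.2, csw]
    by_cases h : i = j
    · subst h; simp [hl.1]
    · by_cases h2 : i ∈ l
      · simp [h, h2, swap_apply_def]
      · simp [h, h2, swap_apply_def]

theorem flip_inv [Fintype β] (g : Perm (β ⊕ β) → ℝ) (hg : ∀ i x, g (csw i * x) = g x)
    (x : Perm (β ⊕ β)) : g ((Equiv.sumComm β β : Perm (β ⊕ β)) * x) = g x := by
  have h1 : ∀ (l : List β) x, g (flipL l * x) = g x := by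
    intro l
    induction l with
    | nil => intro x; simp [flipL]
    | cons j l ih => intro x; rw [flipL, mul_assoc, hg, ih]
  have h2 : (Equiv.sumComm β β : Perm (β ⊕ β)) = flipL (Finset.univ : Finset β).toList := by
    ext i : 1
    have := flipL_apply (Finset.univ : Finset β).toList (Finset.nodup_toList _)
    cases i with
    | inl i => rw [(this i).1]; simp
    | inr i => rw [(this i).2]; simp
  rw [h2, h1]

/-- block permutations -/
def sc (a b : Perm β) : Perm (β ⊕ β) := Perm.sumCongrHom β β (a, b)

theorem sc_inl (a b : Perm β) (i : β) : sc a b (Sum.inl i) = Sum.inl (a i) := rfl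
theorem sc_inr (a b : Perm β) (i : β) : sc a b (Sum.inr i) = Sum.inr (b i) := rfl
theorem sc_mul (a b c d : Perm β) : sc a b * sc c d = sc (a * c) (b * d) := by
  unfold sc; rw [← map_mul]; rfl

theorem sc_comm (a b : Perm β) :
    sc a b * (Equiv.sumComm β β : Perm (β ⊕ β)) = (Equiv.sumComm β β : Perm (β ⊕ β)) * sc b a := by
  ext i : 1
  cases i <;> rfl

/-- number of counters in the right half -/
def kk (T : Finset (β ⊕ β)) (x : Perm (β ⊕ β)) : ℕ := (T.filter (fun i => (x i).isRight = true)).card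

theorem card_right [Fintype β] (x : Perm (β ⊕ β)) :
    (Finset.univ.filter (fun i => (x i).isRight = true)).card = Fintype.card β := by
  rw [← Fintype.card_subtype]
  refine Fintype.card_congr ?_
  refine Equiv.symm (Equiv.ofBijective (fun b => ⟨x⁻¹ (Sum.inr b), by simp⟩) ⟨?_, ?_⟩)
  · intro a b h
    simpa using h
  · rintro ⟨i, hi⟩
    obtain ⟨b, hb⟩ := Sum.isRight_iff.1 hi
    refine ⟨b, ?_⟩
    simp [← hb]

theorem cell_cards [Fintype β] (T : Finset (β ⊕ β)) (x : Perm (β ⊕ β)) :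
    kk T x + (T.filter (fun i => (x i).isRight = false)).card = T.card ∧
    kk T x + (Tᶜ.filter (fun i => (x i).isRight = true)).card = Fintype.card β ∧
    (Tᶜ.filter (fun i => (x i).isRight = true)).card
      + (Tᶜ.filter (fun i => (x i).isRight = false)).card = Tᶜ.card := by
  refine ⟨?_, ?_, ?_⟩
  · have := Finset.card_filter_add_card_filter_not (s := T) (fun i => (x i).isRight = true)
    simpa [kk] using this
  · rw [← card_right x, kk, ← Finset.card_union_of_disjoint, ← Finset.filter_union,
      Finset.union_compl]
    exact Finset.disjoint_filter_filter disjoint_compl_right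
  · have := Finset.card_filter_add_card_filter_not (s := Tᶜ) (fun i => (x i).isRight = true)
    simpa using this

theorem kk_flip [Fintype β] (T : Finset (β ⊕ β)) (x : Perm (β ⊕ β)) :
    kk T ((Equiv.sumComm β β : Perm (β ⊕ β)) * x) + kk T x = T.card := by
  rw [add_comm, ← (cell_cards T x).1]
  congr 1
  unfold kk
  congr 1
  ext i
  simp only [Finset.mem_filter, Perm.mul_apply]
  cases hxi : x i <;> simp [hxi]

theorem kk_double_coset [Fintype β] (T : Finset (β ⊕ β)) (x y : Perm (β ⊕ β))
    (h : kk T x = kk T y) :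
    ∃ a b : Perm β, ∃ ρ : Perm (β ⊕ β), (∀ i, ρ i ∈ T ↔ i ∈ T) ∧ y = sc a b * (x * ρ) := by
  have hx := cell_cards T x
  have hy := cell_cards T y
  obtain ⟨ρ, hρ⟩ := exists_equiv_cells (fun i => (decide (i ∈ T), (y i).isRight))
    (fun i => (decide (i ∈ T), (x i).isRight)) (by
      have key : ∀ (z : Perm (β ⊕ β)) (q : Bool),
          (Finset.univ.filter (fun i => (decide (i ∈ T), (z i).isRight) = (true, q)))
            = T.filter (fun i => (z i).isRight = q) ∧
          (Finset.univ.filter (fun i => (decide (i ∈ T), (z i).isRight) = (false, q)))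
            = Tᶜ.filter (fun i => (z i).isRight = q) := by
        intro z q
        constructor <;> ext i <;> simp
      rintro ⟨p, q⟩
      cases p
      · rw [(key y q).2, (key x q).2]
        cases q <;> omega
      · rw [(key y q).1, (key x q).1]
        cases q
        · omega
        · exact h.symm)
  have h1 : ∀ i, (ρ i ∈ T ↔ i ∈ T) ∧ (x (ρ i)).isRight = (y i).isRight := by
    intro i
    have := hρ i
    simpa using this
  have hr := Perm.mem_sumCongrHom_range_of_perm_mapsTo_inl (σ := y * (x * ρ)⁻¹) (by
    rintro _ ⟨a, rfl⟩
    have h2 := (h1 ((x * ρ)⁻¹ (Sum.inl a))).2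
    have h3 : x (ρ ((x * ρ)⁻¹ (Sum.inl a))) = Sum.inl a := by
      rw [← Perm.mul_apply]; simp
    rw [h3] at h2
    rw [Perm.mul_apply]
    cases h4 : y ((x * ρ)⁻¹ (Sum.inl a)) with
    | inl c => exact ⟨c, rfl⟩
    | inr c => rw [h4] at h2; simp at h2)
  obtain ⟨⟨a, b⟩, hab⟩ := hr
  refine ⟨a, b, ρ, fun i => (h1 i).1, ?_⟩
  show y = Perm.sumCongrHom β β (a, b) * (x * ρ)
  rw [hab, inv_mul_cancel_right]

/-- the five-phase list -/
noncomputable def total [Fintype β] (T : Finset (β ⊕ β))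
    (L0 : List (T × T × ℝ)) (MID : List ((β ⊕ β) × (β ⊕ β) × ℝ)) (LA LB : List (β × β × ℝ)) :
    List ((β ⊕ β) × (β ⊕ β) × ℝ) :=
  lift Subtype.val L0 ++ (MID ++ (lift Sum.inl LA ++ (lift Sum.inr LB ++ cols Finset.univ.toList)))

theorem double_main [Fintype β] (TA S : Finset β) (T : Finset (β ⊕ β))
    (hT : T = TA.map Function.Embedding.inl)
    (L0 : List (T × T × ℝ)) (MID : List ((β ⊕ β) × (β ⊕ β) × ℝ)) (LA LB : List (β × β × ℝ))
    (h0 : ∀ h, DepOn Finset.univ h → EE L0 h 1 = avg h)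
    (hA : ∀ h, DepOn TA h → EE LA h 1 = avg h)
    (hB : ∀ h, DepOn S h → EE LB h 1 = avg h)
    (hM : ∀ e ∈ MID, ∃ i ∈ TA, ∃ j ∈ S, e.1 = Sum.inl i ∧ e.2.1 = Sum.inr j)
    (f : Perm (β ⊕ β) → ℝ) (hf : DepOn T f) :
    ∃ Ψ : ℕ → ℝ, (∀ k ≤ T.card, Ψ k = Ψ (T.card - k)) ∧
      EE (total T L0 MID LA LB) f 1 = EE MID (fun x => Ψ (kk T x)) 1 ∧
      avg f = avg (fun x => Ψ (kk T x)) := by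
  set g := EE (cols (Finset.univ : Finset β).toList) f with hg
  have gdep : DepOn T g := EE_dep T _ f hf
  have gavg : avg g = avg f := avg_EE _ _
  have gflip : ∀ x, g ((Equiv.sumComm β β : Perm (β ⊕ β)) * x) = g x :=
    flip_inv g (fun i x => cols_inv _ f i (by simp) x)
  let F : Perm (β ⊕ β) → ℝ := fun x => avg (fun a : Perm β => avg (fun b : Perm β => g (sc a b * x)))
  let Fb : Perm (β ⊕ β) → ℝ := fun x => avg (fun π : Perm T => F (x * Perm.ofSubtype π))
  have Fdep : DepOn T F := by
    intro x y hxy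
    show avg _ = avg _
    congr 1; funext a
    congr 1; funext b
    apply gdep
    intro i hi
    rw [Perm.mul_apply, Perm.mul_apply, hxy i hi]
  have Fsc : ∀ a b x, F (sc a b * x) = F x := by
    intro a0 b0 x
    show avg (fun a : Perm β => avg (fun b : Perm β => g (sc a b * (sc a0 b0 * x)))) = _
    have e1 : ∀ a : Perm β, avg (fun b : Perm β => g (sc a b * (sc a0 b0 * x)))
        = avg (fun b : Perm β => g (sc (a * a0) b * x)) := by
      intro a
      rw [← avg_right (fun b : Perm β => g (sc (a * a0) b * x)) b0]
      congr 1; funext b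
      rw [← mul_assoc, sc_mul]
    simp only [e1]
    exact avg_right (fun a : Perm β => avg (fun b : Perm β => g (sc a b * x))) a0
  have Fflip : ∀ x, F ((Equiv.sumComm β β : Perm (β ⊕ β)) * x) = F x := by
    intro x
    show avg (fun a : Perm β => avg (fun b : Perm β =>
      g (sc a b * ((Equiv.sumComm β β : Perm (β ⊕ β)) * x)))) = _
    simp only [← mul_assoc, sc_comm]
    simp only [mul_assoc, gflip]
    exact avg_comm _
  have Favg : avg F = avg f := by
    rw [← gavg]
    show avg (fun x => avg (fun a : Perm β => avg (fun b : Perm β => g (sc a b * x)))) = _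
    rw [avg_comm]
    have : ∀ a : Perm β, avg (fun x => avg (fun b : Perm β => g (sc a b * x))) = avg g := by
      intro a
      rw [avg_comm]
      simp only [avg_left g]
      exact avg_const _
    simp only [this]
    exact avg_const _
  have subT : ∀ (π : Perm T) (i : β ⊕ β), i ∈ T → Perm.ofSubtype π i ∈ T := by
    intro π i hi
    rw [Perm.ofSubtype_apply_of_mem π hi]
    exact (π ⟨i, hi⟩).2
  have Fbdep : DepOn T Fb := by
    intro x y hxy
    show avg _ = avg _
    congr 1; funext π
    apply Fdep
    intro i hi
    rw [Perm.mul_apply, Perm.mul_apply, hxy _ (subT π i hi)]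
  have Fbsc : ∀ a b x, Fb (sc a b * x) = Fb x := by
    intro a b x
    show avg _ = avg _
    congr 1; funext π
    rw [mul_assoc, Fsc]
  have Fbflip : ∀ x, Fb ((Equiv.sumComm β β : Perm (β ⊕ β)) * x) = Fb x := by
    intro x
    show avg _ = avg _
    congr 1; funext π
    rw [mul_assoc, Fflip]
  have Fbavg : avg Fb = avg f := by
    rw [← Favg]
    show avg (fun x => avg (fun π : Perm T => F (x * Perm.ofSubtype π))) = _
    rw [avg_comm]
    simp only [avg_right F]
    exact avg_const _
  have Fbright : ∀ x ρ, (∀ i, ρ i ∈ T ↔ i ∈ T) → Fb (x * ρ) = Fb x := by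
    intro x ρ hρ
    have e1 : Fb (x * ρ) = Fb (x * Perm.ofSubtype (ρ.subtypePerm (p := fun i => i ∈ T) hρ)) := by
      apply Fbdep
      intro i hi
      rw [Perm.mul_apply, Perm.mul_apply,
        Perm.ofSubtype_apply_of_mem (ρ.subtypePerm (p := fun i => i ∈ T) hρ) hi]
      rfl
    rw [e1]
    show avg (fun π : Perm T => F (x * Perm.ofSubtype (ρ.subtypePerm (p := fun i => i ∈ T) hρ)
      * Perm.ofSubtype π)) = _
    simp only [mul_assoc, ← map_mul]
    exact avg_left (fun π : Perm T => F (x * Perm.ofSubtype π)) _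
  have fac : Function.FactorsThrough Fb (kk T) := by
    intro x y hxy
    obtain ⟨a, b, ρ, h1, h2⟩ := kk_double_coset T x y hxy
    rw [h2, Fbsc, Fbright x ρ h1]
  have hΨ : ∀ x, Function.extend (kk T) Fb 0 (kk T x) = Fb x := fun x => fac.extend_apply 0 x
  refine ⟨Function.extend (kk T) Fb 0, ?_, ?_, ?_⟩
  · intro k hk
    by_cases hx : ∃ x, kk T x = k
    · obtain ⟨x, rfl⟩ := hx
      have := kk_flip T x
      rw [show T.card - kk T x = kk T ((Equiv.sumComm β β : Perm (β ⊕ β)) * x) by omega,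
        hΨ, hΨ, Fbflip]
    · rw [Function.extend_apply' _ _ _ hx, Function.extend_apply']
      · rfl
      · rintro ⟨y, hy⟩
        apply hx
        refine ⟨(Equiv.sumComm β β : Perm (β ⊕ β)) * y, ?_⟩
        have := kk_flip T y
        omega
  · simp only [hΨ]
    let P : Perm (β ⊕ β) → Prop := fun x => ∀ i ∈ T,
      (∀ j, x i = Sum.inl j → j ∈ TA) ∧ (∀ j, x i = Sum.inr j → j ∈ S)
    have hR : ∀ x, P x → EE (lift Sum.inl LA) (EE (lift Sum.inr LB) g) x = F x := by
      intro x hx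
      rw [EE_lift ((Perm.sumCongrHom β β).comp (MonoidHom.inl _ _)) Sum.inl
        (fun a b => Perm.sumCongr_swap_one a b)]
      have e1 : ∀ a : Perm β, EE (lift Sum.inr LB) g
          (((Perm.sumCongrHom β β).comp (MonoidHom.inl _ _)) a * x)
          = avg (fun b : Perm β => g (sc a b * x)) := by
        intro a
        rw [EE_lift ((Perm.sumCongrHom β β).comp (MonoidHom.inr _ _)) Sum.inr
          (fun a b => Perm.sumCongr_one_swap a b)]
        have e2 : ∀ b : Perm β, ((Perm.sumCongrHom β β).comp (MonoidHom.inr _ _)) b *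
          (((Perm.sumCongrHom β β).comp (MonoidHom.inl _ _)) a * x) = sc a b * x := by
          intro b
          rw [← mul_assoc]
          show (sc 1 b * sc a 1) * x = _
          rw [sc_mul, one_mul, mul_one]
        simp only [e2]
        apply hB
        intro b c hbc
        apply gdep
        intro i hi
        rw [Perm.mul_apply, Perm.mul_apply]
        cases hxi : x i with
        | inl j => rw [sc_inl, sc_inl]
        | inr j => rw [sc_inr, sc_inr, hbc j ((hx i hi).2 j hxi)]
      simp only [e1]
      apply hA
      intro a c hac
      show avg _ = avg _
      congr 1; funext b
      apply gdep
      intro i hi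
      rw [Perm.mul_apply, Perm.mul_apply]
      cases hxi : x i with
      | inl j => rw [sc_inl, sc_inl, hac j ((hx i hi).1 j hxi)]
      | inr j => rw [sc_inr, sc_inr]
    have hRfun : EE (lift Sum.inl LA ++ (lift Sum.inr LB ++ cols Finset.univ.toList)) f
        = EE (lift Sum.inl LA) (EE (lift Sum.inr LB) g) := by
      funext x
      rw [EE_append]
      congr 1
      funext y
      rw [EE_append]
    have hMID : ∀ x, P x → EE MID (EE (lift Sum.inl LA) (EE (lift Sum.inr LB) g)) x = EE MID F x := by
      intro x hx
      refine EE_congr P MID ?_ _ _ hR x hx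
      intro e he x hx i hi
      obtain ⟨a, ha, b, hb, h1, h2⟩ := hM e he
      rw [h1, h2, Perm.mul_apply, swap_apply_def]
      split_ifs
      · refine ⟨by simp, ?_⟩
        intro j hj; simp at hj; exact hj ▸ hb
      · refine ⟨?_, by simp⟩
        intro j hj; simp at hj; exact hj ▸ ha
      · exact hx i hi
    have hPπ : ∀ π : Perm T, P (Perm.ofSubtype π) := by
      intro π i hi
      have hmem : ∀ z ∈ T, ∃ a ∈ TA, Sum.inl a = z := by
        intro z hz
        rw [hT, Finset.mem_map] at hz
        exact hz
      obtain ⟨a, ha, h⟩ := hmem _ (subT π i hi)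
      rw [← h]
      refine ⟨?_, by simp⟩
      intro j hj; simp at hj; exact hj ▸ ha
    unfold total
    rw [EE_append, EE_lift (Perm.ofSubtype (p := fun i => i ∈ T)) Subtype.val
      (fun a b => Perm.ofSubtype_swap_eq a b), h0 _ (by
        intro x y hxy
        have : x = y := by ext i : 1; exact hxy i (Finset.mem_univ i)
        rw [this])]
    have e3 : ∀ π : Perm T, EE (MID ++ (lift Sum.inl LA ++ (lift Sum.inr LB ++ cols Finset.univ.toList))) f
        (Perm.ofSubtype (p := fun i => i ∈ T) π * 1) = EE MID (fun z => F (z * Perm.ofSubtype π)) 1 := by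
      intro π
      rw [mul_one, EE_append, hRfun, hMID _ (hPπ π), EE_shift_one]
    simp only [e3]
    show avg _ = EE MID (fun x => avg (fun π : Perm T => F (x * Perm.ofSubtype π))) 1
    unfold avg
    rw [EE_sum]
  · simp only [hΨ]
    exact Fbavg.symm

end double


/-! ### Weights -/

section weights

set_option linter.unusedSectionVars false

variable {β : Type} [DecidableEq β] [Fintype β]

theorem avg_sum {α ι : Type} [DecidableEq α] [Fintype α] (s : Finset ι) (f : ι → Perm α → ℝ) :
    avg (fun x => ∑ i ∈ s, f i x) = ∑ i ∈ s, avg (f i) := by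
  unfold avg
  rw [Finset.sum_comm, Finset.sum_div]

/-- probability that exactly `k` counters are in the right half -/
noncomputable def w (T : Finset (β ⊕ β)) (k : ℕ) : ℝ := avg (fun x => if kk T x = k then 1 else 0)

theorem w_nonneg (T : Finset (β ⊕ β)) (k : ℕ) : 0 ≤ w T k := by
  unfold w avg
  apply div_nonneg
  · apply Finset.sum_nonneg
    intro x _
    split_ifs <;> norm_num
  · positivity

theorem kk_le (T : Finset (β ⊕ β)) (x : Perm (β ⊕ β)) : kk T x ≤ T.card := Finset.card_filter_le _ _

theorem avg_kk (T : Finset (β ⊕ β)) (Ψ : ℕ → ℝ) :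
    avg (fun x => Ψ (kk T x)) = ∑ k ∈ Finset.range (T.card + 1), Ψ k * w T k := by
  unfold w
  simp only [← avg_smul]
  rw [← avg_sum]
  congr 1
  funext x
  simp only [mul_ite, mul_one, mul_zero]
  rw [Finset.sum_ite_eq, if_pos]
  rw [Finset.mem_range]
  have := kk_le T x
  omega

theorem w_sum (T : Finset (β ⊕ β)) : ∑ k ∈ Finset.range (T.card + 1), w T k = 1 := by
  have := avg_kk T (fun _ => 1)
  rw [avg_const] at this
  simpa using this.symm

theorem kk_swap (T : Finset (β ⊕ β)) (x : Perm (β ⊕ β)) (i j : β ⊕ β) (hi : i ∈ T) (hj : j ∉ T)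
    (h1 : (x i).isRight = false) (h2 : (x j).isRight = true) :
    kk T (x * swap i j) = kk T x + 1 := by
  unfold kk
  have : T.filter (fun l => ((x * swap i j) l).isRight = true)
      = insert i (T.filter (fun l => (x l).isRight = true)) := by
    ext l
    rw [Finset.mem_filter, Finset.mem_insert, Finset.mem_filter, Perm.mul_apply]
    by_cases hl : l = i
    · subst hl; simp [hi, h2]
    · by_cases hlT : l ∈ T
      · have hlj : l ≠ j := fun h => hj (h ▸ hlT)
        rw [swap_apply_of_ne_of_ne hl hlj]; simp [hl]
      · simp [hlT, hl]
  rw [this, Finset.card_insert_of_notMem]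
  simp [h1]

theorem w_pair (T : Finset (β ⊕ β)) (k : ℕ) (p q : Bool) (c d : ℝ)
    (hc : ∀ x, kk T x = k → ((T.filter (fun i => (x i).isRight = p)).card : ℝ) = c)
    (hd : ∀ x, kk T x = k → ((Tᶜ.filter (fun i => (x i).isRight = q)).card : ℝ) = d) :
    w T k * (c * d) = ∑ i ∈ T, ∑ j ∈ Tᶜ, avg (fun x : Perm (β ⊕ β) =>
      if kk T x = k ∧ (x i).isRight = p ∧ (x j).isRight = q then (1 : ℝ) else 0) := by
  simp only [← avg_sum]
  rw [mul_comm, w, ← avg_smul]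
  congr 1
  funext x
  by_cases hk : kk T x = k
  · simp only [hk, if_true, true_and, mul_one]
    rw [← hc x hk, ← hd x hk, ← Finset.sum_boole, ← Finset.sum_boole, Finset.sum_mul_sum]
    refine Finset.sum_congr rfl fun i _ => Finset.sum_congr rfl fun j _ => ?_
    by_cases h1 : (x i).isRight = p <;> by_cases h2 : (x j).isRight = q <;> simp [h1, h2]
  · simp [hk]

theorem w_balance (T : Finset (β ⊕ β)) (k : ℕ) :
    w T k * (((T.card : ℝ) - k) * ((Fintype.card β : ℝ) - k))
      = w T (k + 1) * (((k : ℝ) + 1) * ((Fintype.card β : ℝ) - T.card + k + 1)) := by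
  rw [w_pair T k false true, w_pair T (k + 1) true false]
  · refine Finset.sum_congr rfl fun i hi => Finset.sum_congr rfl fun j hj => ?_
    rw [Finset.mem_compl] at hj
    rw [← avg_right (fun x : Perm (β ⊕ β) =>
      if kk T x = k + 1 ∧ (x i).isRight = true ∧ (x j).isRight = false then (1 : ℝ) else 0) (swap i j)]
    congr 1
    funext x
    simp only [Perm.mul_apply, swap_apply_left, swap_apply_right]
    by_cases h1 : (x i).isRight = false
    · by_cases h2 : (x j).isRight = true
      · rw [kk_swap T x i j hi hj h1 h2]
        simp [h1, h2]
      · simp [h2]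
    · simp [h1]
  · intro x hk
    show (kk T x : ℝ) = _
    rw [hk]; push_cast; rfl
  · intro x hk
    obtain ⟨h1, h2, h3⟩ := cell_cards T x
    rw [Finset.card_compl, Fintype.card_sum] at h3
    have h4 : T.card ≤ Fintype.card β + Fintype.card β := by
      rw [← Fintype.card_sum]; exact Finset.card_le_univ T
    rw [hk] at h2
    have h5 : (Tᶜ.filter (fun i => (x i).isRight = false)).card + T.card
      = Fintype.card β + (k + 1) := by omega
    have h6 : ((Tᶜ.filter (fun i => (x i).isRight = false)).card : ℝ) + T.card
      = Fintype.card β + (k + 1) := by exact_mod_cast h5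
    linarith
  · intro x hk
    obtain ⟨h1, h2, h3⟩ := cell_cards T x
    rw [hk] at h1
    have h6 : (k : ℝ) + ((T.filter (fun i => (x i).isRight = false)).card : ℝ) = T.card := by
      exact_mod_cast h1
    linarith
  · intro x hk
    obtain ⟨h1, h2, h3⟩ := cell_cards T x
    rw [hk] at h2
    have h6 : (k : ℝ) + ((Tᶜ.filter (fun i => (x i).isRight = true)).card : ℝ) = Fintype.card β := by
      exact_mod_cast h2
    linarith

theorem kk_flipL (TA : Finset β) (l : List β) (hl : l.Nodup) (hlT : ∀ i ∈ l, i ∈ TA) :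
    kk (TA.map Function.Embedding.inl) (flipL l) = l.length := by
  unfold kk
  have : (TA.map Function.Embedding.inl).filter (fun i => (flipL l i).isRight = true)
      = l.toFinset.map Function.Embedding.inl := by
    ext i
    simp only [Finset.mem_filter, Finset.mem_map, List.mem_toFinset]
    constructor
    · rintro ⟨⟨a, ha, rfl⟩, h⟩
      change (flipL l (Sum.inl a)).isRight = true at h
      rw [(flipL_apply l hl a).1] at h
      refine ⟨a, ?_, rfl⟩
      by_contra hc
      simp [hc] at h
    · rintro ⟨a, ha, rfl⟩
      refine ⟨⟨a, hlT a ha, rfl⟩, ?_⟩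
      show (flipL l (Sum.inl a)).isRight = true
      rw [(flipL_apply l hl a).1]
      simp [ha]
  rw [this, Finset.card_map, List.toFinset_card_of_nodup hl]

end weights

theorem quad (q0 q1 q2 : ℝ) (h0 : 0 ≤ q0) (h1 : 0 ≤ q1) (h2 : 0 ≤ q2) (hs : q0 + q1 + q2 = 1)
    (hd : 4 * q0 * q2 ≤ q1 ^ 2) : ∃ p1 p2 : ℝ, (0 ≤ p1 ∧ p1 ≤ 1) ∧ (0 ≤ p2 ∧ p2 ≤ 1) ∧
      p1 * p2 = q2 ∧ p1 * (1 - p2) + (1 - p1) * p2 = q1 := by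
  have hq : q0 = 1 - q1 - q2 := by linarith
  set d := Real.sqrt (q1 ^ 2 - 4 * q0 * q2) with hdd
  have hd2 : d ^ 2 = q1 ^ 2 - 4 * q0 * q2 := Real.sq_sqrt (by linarith)
  have hd0 : 0 ≤ d := Real.sqrt_nonneg _
  have hd1 : d ≤ q1 := by
    apply Real.sqrt_le_iff.2
    refine ⟨h1, ?_⟩
    have := mul_nonneg h0 h2
    linarith
  have hprod : (q1 + 2 * q2 + d) / 2 * ((q1 + 2 * q2 - d) / 2) = q2 := by
    have : (q1 + 2 * q2 + d) / 2 * ((q1 + 2 * q2 - d) / 2) = ((q1 + 2 * q2) ^ 2 - d ^ 2) / 4 := by ring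
    rw [this, hd2, hq]; ring
  refine ⟨(q1 + 2 * q2 + d) / 2, (q1 + 2 * q2 - d) / 2, ⟨?_, ?_⟩, ⟨?_, ?_⟩, hprod, ?_⟩
  · linarith
  · linarith
  · linarith
  · linarith
  · linarith

theorem total_length {β : Type} [DecidableEq β] [Fintype β] (T : Finset (β ⊕ β))
    (L0 : List (T × T × ℝ)) (MID : List ((β ⊕ β) × (β ⊕ β) × ℝ)) (LA LB : List (β × β × ℝ)) :
    (total T L0 MID LA LB).length
      = L0.length + MID.length + LA.length + LB.length + Fintype.card β := by
  simp [total, lift, cols, Finset.length_toList]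
  omega

theorem total_VL {β : Type} [DecidableEq β] [Fintype β] (T : Finset (β ⊕ β))
    (L0 : List (T × T × ℝ)) (MID : List ((β ⊕ β) × (β ⊕ β) × ℝ)) (LA LB : List (β × β × ℝ))
    (h0 : VL L0) (h1 : VL MID) (h2 : VL LA) (h3 : VL LB) : VL (total T L0 MID LA LB) := by
  refine VL_append (VL_lift _ Subtype.val_injective _ h0) (VL_append h1 (VL_append
    (VL_lift _ Sum.inl_injective _ h2) (VL_append (VL_lift _ Sum.inr_injective _ h3) (cols_VL _))))

theorem double3 (m ℓ : ℕ) (hm : 3 ≤ m) (h : GG 3 m ℓ) : GG 3 (m + m) (ℓ + 2 * m + 3) := by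
  obtain ⟨TA, -, hTA⟩ := Finset.exists_subset_card_eq (s := (Finset.univ : Finset (Fin m)))
    (n := 3) (by simpa using hm)
  obtain ⟨i, hi⟩ : TA.Nonempty := by rw [← Finset.card_pos]; omega
  obtain ⟨T, hT⟩ : ∃ T : Finset (Fin m ⊕ Fin m), T = TA.map Function.Embedding.inl := ⟨_, rfl⟩
  have hTc : T.card = 3 := by rw [hT, Finset.card_map, hTA]
  have hG1 : GG 1 m (m - 1) := by
    have := GG_one (m - 1)
    rwa [show m - 1 + 1 = m by omega] at this
  obtain ⟨L0, a0, b0, c0⟩ := GG_three 0 T Finset.univ (by simp [hTc]) (by simp [hTc])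
  obtain ⟨LA, a1, b1, c1⟩ := h (Fin m) TA (by simp) (by omega)
  obtain ⟨LB, a2, b2, c2⟩ := hG1 (Fin m) {i} (by simp) (by simp; omega)
  have hw := w_sum T
  have hw0 := w_nonneg T 0
  have hw1 := w_nonneg T 1
  have hw2 := w_nonneg T 2
  have hw3 := w_nonneg T 3
  rw [hTc] at hw
  simp only [Finset.sum_range_succ, Finset.range_zero, Finset.sum_empty] at hw
  refine GG_of_model (Fin m ⊕ Fin m) T (by simp) (by omega) ?_
  refine ⟨total T L0 [(Sum.inl i, Sum.inr i, w T 1 + w T 2)] LA LB, ?_, ?_, ?_⟩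
  · rw [total_length]
    simp only [List.length_cons, List.length_nil, Fintype.card_fin]
    omega
  · refine total_VL _ _ _ _ _ b0 ?_ b1 b2
    intro e he
    rw [List.mem_singleton] at he
    subst he
    refine ⟨by simp, ?_, ?_⟩
    · show 0 ≤ w T 1 + w T 2; linarith
    · show w T 1 + w T 2 ≤ 1; linarith
  intro f hf
  obtain ⟨Ψ, hΨ1, hΨ2, hΨ3⟩ := double_main TA {i} T hT L0 [(Sum.inl i, Sum.inr i, w T 1 + w T 2)]
    LA LB c0 c1 c2 (by
      intro e he
      rw [List.mem_singleton] at he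
      subst he
      exact ⟨i, hi, i, by simp, rfl, rfl⟩) f hf
  rw [hΨ2, hΨ3, avg_kk, hTc]
  have k0 : kk T 1 = 0 := by
    rw [hT]; exact kk_flipL TA [] (by simp) (by simp)
  have k1 : kk T (swap (Sum.inl i) (Sum.inr i) * 1) = 1 := by
    rw [hT]; exact kk_flipL TA [i] (by simp) (by simpa using hi)
  simp only [EE, k0, k1]
  have s1 : Ψ 3 = Ψ 0 := by have := hΨ1 3 (by omega); rwa [hTc] at this
  have s2 : Ψ 2 = Ψ 1 := by have := hΨ1 2 (by omega); rwa [hTc] at this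
  simp only [Finset.sum_range_succ, Finset.range_zero, Finset.sum_empty, s1, s2]
  have : w T 0 = 1 - w T 1 - w T 2 - w T 3 := by linarith
  rw [this]; ring

theorem quad_disc (m w0 w1 w2 w3 w4 : ℝ) (hm : 4 ≤ m)
    (h0 : 4 * m * w0 = (m - 3) * w1) (h1 : 3 * (m - 1) * w1 = 2 * (m - 2) * w2)
    (h2 : 2 * (m - 2) * w2 = 3 * (m - 1) * w3) (h3 : (m - 3) * w3 = 4 * m * w4) :
    4 * (w0 + w4) * w2 ≤ (w1 + w3) ^ 2 := by
  have e1 : w3 = w1 := by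
    have : (3 * (m - 1)) * w3 = (3 * (m - 1)) * w1 := by linarith
    exact mul_left_cancel₀ (by nlinarith) this
  subst e1
  have e0 : w4 = w0 := by
    have : (4 * m) * w4 = (4 * m) * w0 := by linarith
    exact mul_left_cancel₀ (by nlinarith) this
  subst e0
  have hp : 0 < m * (m - 2) := mul_pos (by linarith) (by linarith)
  have key : (m * (m - 2)) * (8 * (w4 * w2)) = 3 * (m - 3) * (m - 1) * w3 ^ 2 := by
    have : (4 * m * w4) * (2 * (m - 2) * w2) = ((m - 3) * w3) * (3 * (m - 1) * w3) := by
      rw [h0, ← h1]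
    linarith
  have h5 : (m * (m - 2)) * (8 * (w4 * w2)) ≤ (m * (m - 2)) * (4 * w3 ^ 2) := by
    rw [key]
    have : 0 ≤ (m ^ 2 + 4 * m - 9) * w3 ^ 2 := mul_nonneg (by nlinarith) (sq_nonneg _)
    linarith
  have h6 := le_of_mul_le_mul_left h5 hp
  linarith

theorem double4 (m ℓ : ℕ) (hm : 4 ≤ m) (h : GG 4 m ℓ) : GG 4 (m + m) (ℓ + 3 * m + 5) := by
  obtain ⟨TA, -, hTA⟩ := Finset.exists_subset_card_eq (s := (Finset.univ : Finset (Fin m)))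
    (n := 4) (by simpa using hm)
  obtain ⟨i, hi, j, hj, hij⟩ := Finset.one_lt_card.1 (show 1 < TA.card by omega)
  obtain ⟨T, hT⟩ : ∃ T : Finset (Fin m ⊕ Fin m), T = TA.map Function.Embedding.inl := ⟨_, rfl⟩
  have hTc : T.card = 4 := by rw [hT, Finset.card_map, hTA]
  have hG1 : GG 2 m (2 * m - 3) := by
    have := GG_two (m - 2)
    rw [show m - 2 + 2 = m by omega] at this
    exact GG_mono this (by omega)
  obtain ⟨L0, a0, b0, c0⟩ := GG_four 0 T Finset.univ (by simp [hTc]) (by simp [hTc])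
  obtain ⟨LA, a1, b1, c1⟩ := h (Fin m) TA (by simp) (by omega)
  obtain ⟨LB, a2, b2, c2⟩ := hG1 (Fin m) {i, j} (by simp) (by rw [Finset.card_pair hij]; omega)
  have hw := w_sum T
  have hw0 := w_nonneg T 0
  have hw1 := w_nonneg T 1
  have hw2 := w_nonneg T 2
  have hw3 := w_nonneg T 3
  have hw4 := w_nonneg T 4
  have B0 := w_balance T 0
  have B1 := w_balance T 1
  have B2 := w_balance T 2
  have B3 := w_balance T 3
  rw [hTc] at hw B0 B1 B2 B3
  rw [Fintype.card_fin] at B0 B1 B2 B3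
  simp only [Finset.sum_range_succ, Finset.range_zero, Finset.sum_empty] at hw
  norm_num at B0 B1 B2 B3
  have hm' : (4 : ℝ) ≤ m := by exact_mod_cast hm
  obtain ⟨p1, p2, ⟨p1a, p1b⟩, ⟨p2a, p2b⟩, hp2, hp1⟩ := quad (w T 0 + w T 4) (w T 1 + w T 3) (w T 2)
    (by linarith) (by linarith) hw2 (by linarith) 
    (quad_disc m _ _ _ _ _ hm' (by linarith) (by linarith) (by linarith) (by linarith))
  refine GG_of_model (Fin m ⊕ Fin m) T (by simp) (by omega) ?_
  refine ⟨total T L0 [(Sum.inl i, Sum.inr i, p1), (Sum.inl j, Sum.inr j, p2)] LA LB, ?_, ?_, ?_⟩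
  · rw [total_length]
    simp only [List.length_cons, List.length_nil, Fintype.card_fin]
    omega
  · refine total_VL _ _ _ _ _ b0 ?_ b1 b2
    intro e he
    simp only [List.mem_cons, List.not_mem_nil, or_false] at he
    rcases he with rfl | rfl
    · exact ⟨by simp, p1a, p1b⟩
    · exact ⟨by simp, p2a, p2b⟩
  intro f hf
  obtain ⟨Ψ, hΨ1, hΨ2, hΨ3⟩ := double_main TA {i, j} T hT L0
    [(Sum.inl i, Sum.inr i, p1), (Sum.inl j, Sum.inr j, p2)]
    LA LB c0 c1 c2 (by
      intro e he
      simp only [List.mem_cons, List.not_mem_nil, or_false] at he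
      rcases he with rfl | rfl
      · exact ⟨i, hi, i, by simp, rfl, rfl⟩
      · exact ⟨j, hj, j, by simp, rfl, rfl⟩) f hf
  rw [hΨ2, hΨ3, avg_kk, hTc]
  have k0 : kk T 1 = 0 := by
    rw [hT]; exact kk_flipL TA [] (by simp) (by simp)
  have k1 : kk T (swap (Sum.inl i) (Sum.inr i) * 1) = 1 := by
    rw [hT]; exact kk_flipL TA [i] (by simp) (by simpa using hi)
  have k2 : kk T (swap (Sum.inl j) (Sum.inr j) * 1) = 1 := by
    rw [hT]; exact kk_flipL TA [j] (by simp) (by simpa using hj)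
  have k3 : kk T (swap (Sum.inl j) (Sum.inr j) * (swap (Sum.inl i) (Sum.inr i) * 1)) = 2 := by
    rw [hT]
    exact kk_flipL TA [j, i] (by simpa using hij.symm) (by simp [hi, hj])
  simp only [EE, k0, k1, k2, k3]
  have s1 : Ψ 4 = Ψ 0 := by have := hΨ1 4 (by omega); rwa [hTc] at this
  have s2 : Ψ 3 = Ψ 1 := by have := hΨ1 3 (by omega); rwa [hTc] at this
  simp only [Finset.sum_range_succ, Finset.range_zero, Finset.sum_empty, s1, s2]
  have hw0' : w T 0 = 1 - w T 1 - w T 2 - w T 3 - w T 4 := by linarith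
  have hw1' : w T 1 = p1 * (1 - p2) + (1 - p1) * p2 - w T 3 := by linarith
  rw [hw0', hw1', ← hp2]; ring

theorem bound3 (n : ℕ) : 3 ≤ n → ∃ ℓ : ℕ, GG 3 n ℓ ∧ (ℓ : ℝ) ≤ 2 * n + 5 * Real.logb 2 n + 3 := by
  induction n using Nat.strong_induction_on with
  | _ n ih =>
    intro hn
    by_cases hn6 : n < 6
    · refine ⟨3 * (n - 3) + 3, ?_, ?_⟩
      · have := GG_three (n - 3)
        rwa [show n - 3 + 3 = n by omega] at this
      · have h1 : (1 : ℝ) ≤ Real.logb 2 n := by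
          rw [Real.le_logb_iff_rpow_le (by norm_num) (by positivity)]
          norm_num
          exact_mod_cast (show 2 ≤ n by omega)
        have h2 : ((3 * (n - 3) + 3 : ℕ) : ℝ) ≤ 2 * n + 8 := by
          exact_mod_cast (show 3 * (n - 3) + 3 ≤ 2 * n + 8 by omega)
        linarith
    · obtain ⟨m, hm⟩ : ∃ m, m = n / 2 := ⟨_, rfl⟩
      obtain ⟨ℓ, hG, hℓ⟩ := ih m (by omega) (by omega)
      have hm0 : (0 : ℝ) < m := by exact_mod_cast (show 0 < m by omega)
      have hlog : Real.logb 2 m + 1 ≤ Real.logb 2 n := by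
        have e : Real.logb 2 m + 1 = Real.logb 2 (m * 2) := by
          rw [Real.logb_mul (by positivity) (by norm_num), Real.logb_self_eq_one (by norm_num)]
        rw [e]
        apply Real.logb_le_logb_of_le (by norm_num) (by positivity)
        exact_mod_cast (show m * 2 ≤ n by omega)
      have hD := double3 m ℓ (by omega) hG
      rcases Nat.even_or_odd' n with ⟨k, hk | hk⟩
      · have hnm : n = m + m := by omega
        refine ⟨ℓ + 2 * m + 3, hnm ▸ hD, ?_⟩
        have : (n : ℝ) = m + m := by exact_mod_cast hnm
        push_cast
        linarith
      · have hnm : n = m + m + 1 := by omega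
        refine ⟨ℓ + 2 * m + 3 + 3, ?_, ?_⟩
        · rw [hnm]
          exact GG_mono (GG_step hD) (by omega)
        have : (n : ℝ) = m + m + 1 := by exact_mod_cast hnm
        push_cast
        linarith

theorem bound4 (n : ℕ) : 4 ≤ n → ∃ ℓ : ℕ, GG 4 n ℓ ∧ (ℓ : ℝ) ≤ 3 * n + 8 * Real.logb 2 n + 6 := by
  induction n using Nat.strong_induction_on with
  | _ n ih =>
    intro hn
    by_cases hn6 : n < 8
    · refine ⟨4 * (n - 4) + 6, ?_, ?_⟩
      · have := GG_four (n - 4)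
        rwa [show n - 4 + 4 = n by omega] at this
      · have h1 : (1 : ℝ) ≤ Real.logb 2 n := by
          rw [Real.le_logb_iff_rpow_le (by norm_num) (by positivity)]
          norm_num
          exact_mod_cast (show 2 ≤ n by omega)
        have h2 : ((4 * (n - 4) + 6 : ℕ) : ℝ) ≤ 3 * n + 8 := by
          exact_mod_cast (show 4 * (n - 4) + 6 ≤ 3 * n + 8 by omega)
        linarith
    · obtain ⟨m, hm⟩ : ∃ m, m = n / 2 := ⟨_, rfl⟩
      obtain ⟨ℓ, hG, hℓ⟩ := ih m (by omega) (by omega)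
      have hm0 : (0 : ℝ) < m := by exact_mod_cast (show 0 < m by omega)
      have hlog : Real.logb 2 m + 1 ≤ Real.logb 2 n := by
        have e : Real.logb 2 m + 1 = Real.logb 2 (m * 2) := by
          rw [Real.logb_mul (by positivity) (by norm_num), Real.logb_self_eq_one (by norm_num)]
        rw [e]
        apply Real.logb_le_logb_of_le (by norm_num) (by positivity)
        exact_mod_cast (show m * 2 ≤ n by omega)
      have hD := double4 m ℓ (by omega) hG
      rcases Nat.even_or_odd' n with ⟨k, hk | hk⟩
      · have hnm : n = m + m := by omega
        refine ⟨ℓ + 3 * m + 5, hnm ▸ hD, ?_⟩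
        have : (n : ℝ) = m + m := by exact_mod_cast hnm
        push_cast
        linarith
      · have hnm : n = m + m + 1 := by omega
        refine ⟨ℓ + 3 * m + 5 + 4, ?_, ?_⟩
        · rw [hnm]
          exact GG_mono (GG_step hD) (by omega)
        have : (n : ℝ) = m + m + 1 := by exact_mod_cast hnm
        push_cast
        linarith


end LazyShuffle

theorem Ut_asymptotics :
    (∀ n : ℕ, 3 ≤ n → (Ut 3 n : ℝ) ≤ 2 * n + 5 * Real.logb 2 n + 3) ∧
    (∀ n : ℕ, 4 ≤ n → (Ut 4 n : ℝ) ≤ 3 * n + 8 * Real.logb 2 n + 6) := by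
  constructor
  · intro n hn
    obtain ⟨ℓ, h1, h2⟩ := LazyShuffle.bound3 n hn
    exact le_trans (by exact_mod_cast LazyShuffle.Ut_le_of_GG hn h1) h2
  · intro n hn
    obtain ⟨ℓ, h1, h2⟩ := LazyShuffle.bound4 n hn
    exact le_trans (by exact_mod_cast LazyShuffle.Ut_le_of_GG hn h1) h2
end

section
/- For all integers m, k ≥ 3, U_3(m·k) ≤ 2k + 3 + U_3(k) + k·U_3(m); in particular, for every integer k ≥ 3, U_3(3k) ≤ 5k + 3 + U_3(k). -/
open scoped BigOperators

noncomputable section SplitAux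

/-- Real valued indicator of a proposition. -/
def ind (p : Prop) : ℝ := by classical exact if p then 1 else 0

theorem ind_true {p : Prop} (h : p) : ind p = 1 := by simp [ind, h]
theorem ind_false {p : Prop} (h : ¬ p) : ind p = 0 := by simp [ind, h]
theorem ind_congr {p q : Prop} (h : p ↔ q) : ind p = ind q := by rw [propext h]
theorem ind_and (p q : Prop) : ind (p ∧ q) = ind p * ind q := by
  by_cases hp : p <;> by_cases hq : q <;> simp [ind, hp, hq]

theorem ind_forall {B : Type*} [Fintype B] (p : B → Prop) :
    ind (∀ b, p b) = ∏ b, ind (p b) := by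
  by_cases h : ∀ b, p b
  · rw [ind_true h]; symm; apply Finset.prod_eq_one; intro b _; exact ind_true (h b)
  · rw [ind_false h]; symm
    push Not at h
    obtain ⟨b, hb⟩ := h
    exact Finset.prod_eq_zero (Finset.mem_univ b) (ind_false hb)

variable {I J P Q A B : Type*} [DecidableEq P] [DecidableEq Q] [DecidableEq A] [DecidableEq B]

/-- Expected value of `F` at the placement obtained from `f` after the lazy transpositions. -/
def EV : List (P × P × ℝ) → ((I → P) → ℝ) → (I → P) → ℝ
  | [], F, f => F f
  | e :: L, F, f =>
      e.2.2 * EV L F (fun i => Equiv.swap e.1 e.2.1 (f i)) + (1 - e.2.2) * EV L F f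

/-- Transport of a lazy transposition along a map. -/
def mapE (φ : P → Q) (e : P × P × ℝ) : Q × Q × ℝ := (φ e.1, φ e.2.1, e.2.2)

theorem EV_append (L M : List (P × P × ℝ)) (F : (I → P) → ℝ) (f : I → P) :
    EV (L ++ M) F f = EV L (EV M F) f := by
  induction L generalizing f with
  | nil => rfl
  | cons e L ih => simp only [List.cons_append, EV, ih]

theorem EV_sum {X : Type*} (s : Finset X) (c : X → ℝ) (L : List (P × P × ℝ))
    (F : X → (I → P) → ℝ) (f : I → P) :
    EV L (fun u => ∑ x ∈ s, c x * F x u) f = ∑ x ∈ s, c x * EV L (F x) f := by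
  induction L generalizing f with
  | nil => rfl
  | cons e L ih =>
    simp only [EV, ih, Finset.mul_sum, ← Finset.sum_add_distrib]
    apply Finset.sum_congr rfl; intros; ring

theorem EV_const_mul (c : ℝ) (L : List (P × P × ℝ))
    (F : (I → P) → ℝ) (f : I → P) :
    EV L (fun u => c * F u) f = c * EV L F f := by
  induction L generalizing f with
  | nil => rfl
  | cons e L ih => simp only [EV, ih]; ring

theorem EV_const (c : ℝ) (L : List (P × P × ℝ)) (f : I → P) :
    EV L (fun _ => c) f = c := by
  induction L generalizing f with
  | nil => rfl
  | cons e L ih => simp only [EV, ih]; ring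

theorem EV_congr (L : List (P × P × ℝ)) (S : (I → P) → Prop)
    (hS : ∀ e ∈ L, ∀ u, S u → S (fun i => Equiv.swap e.1 e.2.1 (u i)))
    (F G : (I → P) → ℝ) (hFG : ∀ u, S u → F u = G u) (f : I → P) (hf : S f) :
    EV L F f = EV L G f := by
  induction L generalizing f with
  | nil => exact hFG f hf
  | cons e L ih =>
    have h' := ih (fun e he => hS e (List.mem_cons_of_mem _ he))
    simp only [EV]
    rw [h' _ hf, h' _ (hS e List.mem_cons_self f hf)]

theorem EV_map (φ : P → Q) (Φ : (I → P) → (J → Q))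
    (hΦ : ∀ a b f, Φ (fun i => Equiv.swap a b (f i)) =
      fun j => Equiv.swap (φ a) (φ b) (Φ f j))
    (L : List (P × P × ℝ)) (F : (J → Q) → ℝ) (f : I → P) :
    EV (L.map (mapE φ)) F (Φ f) = EV L (fun u => F (Φ u)) f := by
  induction L generalizing f with
  | nil => rfl
  | cons e L ih =>
    simp only [List.map_cons, EV, mapE]
    rw [← hΦ, ← ih, ← ih]

theorem EV_map_inj (φ : P → Q) (hφ : Function.Injective φ)
    (L : List (P × P × ℝ)) (F : (I → Q) → ℝ) (f : I → P) :
    EV (L.map (mapE φ)) F (fun i => φ (f i)) = EV L (fun u => F (fun i => φ (u i))) f := by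
  refine EV_map φ (fun f i => φ (f i)) ?_ L F f
  intro a b f; funext i
  exact (hφ.map_swap _ _ _)

theorem EV_reindex (s : J → I) (L : List (P × P × ℝ)) (F : (J → P) → ℝ) (f : I → P) :
    EV L F (fun j => f (s j)) = EV L (fun u => F (fun j => u (s j))) f := by
  induction L generalizing f with
  | nil => rfl
  | cons e L ih => simp only [EV]; rw [← ih, ← ih]

theorem EV_local (S : I → Prop) (v : I → P) (L : List (P × P × ℝ)) (f g : I → P)
    (hfg : ∀ i, S i → f i = g i) :
    EV L (fun u => ind (∀ i, S i → u i = v i)) f = EV L (fun u => ind (∀ i, S i → u i = v i)) g := by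
  induction L generalizing f g with
  | nil => exact ind_congr (forall_congr' fun i => forall_congr' fun hi => by rw [hfg i hi])
  | cons e L ih =>
    simp only [EV]
    rw [ih f g hfg, ih _ (fun i => Equiv.swap e.1 e.2.1 (g i)) (fun i hi => by rw [hfg i hi])]

theorem EV_prod [Fintype B] (M : List (B × (A × A × ℝ))) (h f : I → A × B) :
    EV (M.map (fun x => mapE (fun a => (a, x.1)) x.2)) (fun u => ind (u = h)) f =
      ind (∀ i, (f i).2 = (h i).2) *
      ∏ b, EV ((M.filter (fun x => x.1 = b)).map Prod.snd)
        (fun u => ind (∀ i, (f i).2 = b → u i = (h i).1)) (fun i => (f i).1) := by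
  induction M generalizing f with
  | nil =>
    simp only [List.map_nil, List.filter_nil, EV]
    rw [← ind_forall, ← ind_and]
    apply ind_congr
    constructor
    · rintro rfl; simp
    · rintro ⟨h1, h2⟩; funext i; exact Prod.ext (h2 _ i rfl) (h1 i)
  | cons x M ih =>
    obtain ⟨b0, a, a', p⟩ := x
    simp only [List.map_cons, EV]
    rw [ih, ih]
    simp only [mapE]
    have key2 : ∀ i, (Equiv.swap (a, b0) (a', b0) (f i)).2 = (f i).2 := by
      intro i
      simp only [Equiv.swap_apply_def]
      split_ifs with h1 h2
      · rw [h1]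
      · rw [h2]
      · rfl
    have key1 : ∀ i, (f i).2 = b0 →
        (Equiv.swap (a, b0) (a', b0) (f i)).1 = Equiv.swap a a' (f i).1 := by
      intro i hi
      simp only [Equiv.swap_apply_def, Prod.ext_iff, hi, and_true]
      split_ifs <;> rfl
    have key0 : ∀ i, (f i).2 ≠ b0 →
        (Equiv.swap (a, b0) (a', b0) (f i)).1 = (f i).1 := by
      intro i hi
      rw [Equiv.swap_apply_of_ne_of_ne] <;> (intro h; rw [h] at hi; exact hi rfl)
    simp only [key2]
    rw [← Finset.mul_prod_erase _ _ (Finset.mem_univ b0), ← Finset.mul_prod_erase Finset.univ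
      (fun b => EV ((M.filter (fun x => x.1 = b)).map Prod.snd)
        (fun u => ind (∀ i, (f i).2 = b → u i = (h i).1)) (fun i => (f i).1))
      (Finset.mem_univ b0), ← Finset.mul_prod_erase Finset.univ
      (fun b => EV ((((b0, a, a', p) :: M).filter (fun x => x.1 = b)).map Prod.snd)
        (fun u => ind (∀ i, (f i).2 = b → u i = (h i).1)) (fun i => (f i).1))
      (Finset.mem_univ b0)]
    have e1 : ∀ b ∈ Finset.univ.erase b0,
        EV ((M.filter (fun x => x.1 = b)).map Prod.snd)
        (fun u => ind (∀ i, (f i).2 = b → u i = (h i).1))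
          (fun i => (Equiv.swap (a, b0) (a', b0) (f i)).1) =
        EV ((M.filter (fun x => x.1 = b)).map Prod.snd)
        (fun u => ind (∀ i, (f i).2 = b → u i = (h i).1)) (fun i => (f i).1) := by
      intro b hb
      apply EV_local (fun i => (f i).2 = b)
      intro i hi
      apply key0
      rw [hi]; exact Finset.ne_of_mem_erase hb
    have e2 : ∀ b ∈ Finset.univ.erase b0,
        EV ((((b0, a, a', p) :: M).filter (fun x => x.1 = b)).map Prod.snd)
        (fun u => ind (∀ i, (f i).2 = b → u i = (h i).1)) (fun i => (f i).1) =
        EV ((M.filter (fun x => x.1 = b)).map Prod.snd)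
        (fun u => ind (∀ i, (f i).2 = b → u i = (h i).1)) (fun i => (f i).1) := by
      intro b hb
      have : ¬ b0 = b := (Finset.ne_of_mem_erase hb).symm
      simp [this]
    rw [Finset.prod_congr rfl e1, Finset.prod_congr rfl e2]
    have e3 : EV ((M.filter (fun x => x.1 = b0)).map Prod.snd)
        (fun u => ind (∀ i, (f i).2 = b0 → u i = (h i).1))
          (fun i => (Equiv.swap (a, b0) (a', b0) (f i)).1) =
        EV ((M.filter (fun x => x.1 = b0)).map Prod.snd)
        (fun u => ind (∀ i, (f i).2 = b0 → u i = (h i).1))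
          (fun i => Equiv.swap a a' (f i).1) :=
      EV_local (fun i => (f i).2 = b0) _ _ _ _ key1
    rw [e3]
    simp only [decide_true, List.filter_cons_of_pos, List.map_cons, EV]
    ring

theorem exists_perm {α : Type*} [Fintype α] [DecidableEq α] [Fintype J] (v w : J → α)
    (hv : Function.Injective v) (hw : Function.Injective w) :
    ∃ π : Equiv.Perm α, ∀ j, π (v j) = w j := by
  classical
  let e := (Equiv.ofInjective v hv).symm.trans (Equiv.ofInjective w hw)
  refine ⟨Equiv.extendSubtype e, fun j => ?_⟩
  rw [Equiv.extendSubtype_apply_of_mem e (v j) ⟨j, rfl⟩]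
  simp [e]

theorem placeSum_eq {n : ℕ} [Fintype I] (L : List (LazyT n)) (f s : I → Fin n) :
    (∑ σ : Equiv.Perm (Fin n), if ∀ i, σ (s i) = f i then permDist L σ else 0) =
      EV L (fun u => ind (u = f)) s := by
  induction L generalizing s with
  | nil =>
    simp only [permDist, EV]
    rw [Finset.sum_eq_single (1 : Equiv.Perm (Fin n))]
    · by_cases h : s = f
      · subst h; simp [ind]
      · have h' : ¬ ∀ i, s i = f i := fun h' => h (funext h')
        simp [ind, h, h']
    · intro b _ hb; simp [hb]
    · simp
  | cons e L ih =>
    simp only [EV]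
    rw [← ih, ← ih, ← Equiv.sum_comp (Equiv.mulRight (Equiv.swap e.1 e.2.1)) (fun σ : Equiv.Perm (Fin n) =>
      if ∀ i, σ (Equiv.swap e.1 e.2.1 (s i)) = f i then permDist L σ else 0),
      Finset.mul_sum, Finset.mul_sum, ← Finset.sum_add_distrib]
    apply Finset.sum_congr rfl
    intro σ _
    simp only [Equiv.coe_mulRight, Equiv.Perm.mul_apply, Equiv.swap_apply_self, permDist]
    split_ifs <;> simp

theorem EV_eq_sum {n : ℕ} [Fintype I] (L : List (LazyT n)) (f s : I → Fin n) :
    EV L (fun u => ind (u = f)) s =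
      ∑ σ : Equiv.Perm (Fin n), ind (∀ i, σ (s i) = f i) * permDist L σ := by
  rw [← placeSum_eq]
  apply Finset.sum_congr rfl
  intro σ _
  by_cases h : ∀ i, σ (s i) = f i
  · rw [if_pos h, ind_true h, one_mul]
  · rw [if_neg h, ind_false h, zero_mul]

theorem placeProb_eq {n t : ℕ} (ht : t ≤ n) (L : List (LazyT n)) (f : Fin t → Fin n) :
    placeProb ht L f = EV L (fun u => ind (u = f)) (Fin.castLE ht) := by
  rw [← placeSum_eq]
  unfold placeProb
  apply Finset.sum_congr rfl
  intro σ _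
  congr

theorem EV_inj_congr (L : List (P × P × ℝ)) (S : I → Prop)
    (F G : (I → P) → ℝ) (hFG : ∀ u : I → P, (∀ i j, S i → S j → u i = u j → i = j) → F u = G u)
    (f : I → P) (hf : ∀ i j, S i → S j → f i = f j → i = j) :
    EV L F f = EV L G f :=
  EV_congr L (fun u => ∀ i j, S i → S j → u i = u j → i = j)
    (fun e _ u hu i j hi hj h => hu i j hi hj ((Equiv.swap e.1 e.2.1).injective h)) F G hFG f hf

theorem sum_ind_emb [Fintype I] [Fintype P] (u : I → P) (hu : Function.Injective u)
    (F : (I → P) → ℝ) :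
    (∑ x : I ↪ P, F x * ind (u = x)) = F u := by
  classical
  rw [Finset.sum_eq_single (⟨u, hu⟩ : I ↪ P)]
  · simp [ind]
  · intro b _ hb
    rw [ind_false, mul_zero]
    intro h; apply hb; ext i; exact (congrFun h i).symm
  · simp

theorem EV_expand [Fintype I] [Fintype P] (L : List (P × P × ℝ)) (F : (I → P) → ℝ)
    (f : I → P) (hf : Function.Injective f) :
    EV L F f = ∑ x : I ↪ P, F x * EV L (fun u => ind (u = x)) f := by
  rw [← EV_sum]
  refine EV_inj_congr L (fun _ => True) _ _ ?_ f (fun i j _ _ h => hf h)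
  intro u hu
  exact (sum_ind_emb u (fun i j h => hu i j trivial trivial h) F).symm

theorem TShuffle_EV {n t : ℕ} {ht : t ≤ n} {L : List (LazyT n)} (hL : IsTShuffle ht L)
    (F : (Fin t → Fin n) → ℝ) :
    EV L F (Fin.castLE ht) =
      ∑ x : Fin t ↪ Fin n, F x * (((n - t).factorial : ℝ) / (n.factorial : ℝ)) := by
  rw [EV_expand L F _ (Fin.castLE_injective ht)]
  apply Finset.sum_congr rfl
  intro x _
  rw [← placeProb_eq, hL.2 x x.injective]

theorem marg0 {n t : ℕ} {ht : t ≤ n} {L : List (LazyT n)} (hL : IsTShuffle ht L) [Fintype J]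
    (s : J → Fin t) (hs : Function.Injective s) (v : J → Fin n) (hv : Function.Injective v) :
    EV L (fun u => ind (u = v)) (fun j => Fin.castLE ht (s j)) =
      1 / (n.descFactorial (Fintype.card J) : ℝ) := by
  classical
  have hconst : ∀ w : J ↪ Fin n, EV L (fun u => ind (u = w)) (fun j => Fin.castLE ht (s j)) =
      EV L (fun u => ind (u = v)) (fun j => Fin.castLE ht (s j)) := by
    intro w
    obtain ⟨π, hπ⟩ := exists_perm v w hv w.injective
    rw [EV_reindex s L _ (Fin.castLE ht), EV_reindex s L _ (Fin.castLE ht),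
      TShuffle_EV hL, TShuffle_EV hL]
    rw [← Equiv.sum_comp (Equiv.embeddingCongr (Equiv.refl (Fin t)) π)]
    apply Finset.sum_congr rfl
    intro x _
    congr 1
    apply ind_congr
    constructor
    · intro h; funext j; have := congrFun h j
      apply π.injective; rw [hπ]; simpa using this
    · intro h; funext j; have := congrFun h j
      rw [← hπ, ← this]; simp
  have hsum : ∑ w : J ↪ Fin n, EV L (fun u => ind (u = w)) (fun j => Fin.castLE ht (s j)) = 1 := by
    have := EV_expand L (fun _ => (1:ℝ)) (fun j => Fin.castLE ht (s j))
      ((Fin.castLE_injective ht).comp hs)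
    rw [EV_const] at this
    simpa using this.symm
  rw [Finset.sum_congr rfl (fun w _ => hconst w)] at hsum
  simp only [Finset.sum_const, Finset.card_univ, Fintype.card_embedding_eq, Fintype.card_fin,
    nsmul_eq_mul] at hsum
  exact eq_one_div_of_mul_eq_one_right hsum

theorem marg {n t : ℕ} {ht : t ≤ n} {L : List (LazyT n)} (hL : IsTShuffle ht L) [Fintype I]
    (f : I → Fin n) (S : I → Prop) [DecidablePred S] (hf : ∀ i, S i → (f i : ℕ) < t)
    (hinj : ∀ i j, S i → S j → f i = f j → i = j) (v : I → Fin n) :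
    EV L (fun u => ind (∀ i, S i → u i = v i)) f =
      ind (∀ i j, S i → S j → v i = v j → i = j) *
        (1 / (n.descFactorial (Finset.univ.filter S).card : ℝ)) := by
  by_cases hv : ∀ i j, S i → S j → v i = v j → i = j
  · rw [ind_true hv, one_mul]
    have h1 := EV_reindex (fun j : {i // S i} => (j : I)) L
      (fun u => ind (u = fun j : {i // S i} => v j)) f
    have h2 := marg0 hL (fun j : {i // S i} => ⟨(f j : ℕ), hf j j.2⟩)
      (fun a b h => Subtype.ext (hinj a b a.2 b.2 (by simpa [Fin.ext_iff] using h)))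
      (fun j : {i // S i} => v j) (fun a b h => Subtype.ext (hv a b a.2 b.2 h))
    rw [Fintype.card_subtype] at h2
    rw [← h2]
    refine Eq.trans ?_ h1.symm
    congr 1; funext u; apply ind_congr
    simp [funext_iff]
  · rw [ind_false hv, zero_mul]
    rw [EV_inj_congr L S _ (fun _ => 0) ?_ f hinj, EV_const]
    intro u hu
    apply ind_false
    intro h
    apply hv
    intro i j hi hj hij
    exact hu i j hi hj (by rw [h i hi, h j hj, hij])

theorem valid_map {n k : ℕ} (φ : Fin n → Fin k) (hφ : Function.Injective φ) (e : LazyT n)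
    (he : e.Valid) : LazyT.Valid (mapE φ e : LazyT k) :=
  ⟨fun h => he.1 (hφ h), he.2⟩

/-- Spreading a single counter starting at `0`. -/
def spread : (n : ℕ) → List (LazyT (n + 1))
  | 0 => []
  | n + 1 => (0, 1, ((n : ℝ) + 1) / ((n : ℝ) + 2)) :: (spread n).map (mapE Fin.succ)

theorem spread_length (n : ℕ) : (spread n).length = n := by
  induction n with
  | zero => rfl
  | succ n ih => simp [spread, ih]

theorem spread_valid (n : ℕ) : ∀ e ∈ spread n, e.Valid := by
  induction n with
  | zero => simp [spread]
  | succ n ih =>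
    intro e he
    simp only [spread, List.mem_cons, List.mem_map] at he
    rcases he with rfl | ⟨e', he', rfl⟩
    · refine ⟨by simp, ?_, ?_⟩
      · positivity
      · simp only
        rw [div_le_one (by positivity)]; linarith
    · exact valid_map _ (Fin.succ_injective _) _ (ih e' he')

theorem EV_fixed (L : List (P × P × ℝ)) (F : (I → P) → ℝ) (f : I → P)
    (h : ∀ e ∈ L, ∀ i, f i ≠ e.1 ∧ f i ≠ e.2.1) : EV L F f = F f := by
  induction L with
  | nil => rfl
  | cons e L ih =>
    have h1 : (fun i => Equiv.swap e.1 e.2.1 (f i)) = f := by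
      funext i
      have := h e List.mem_cons_self i
      exact Equiv.swap_apply_of_ne_of_ne this.1 this.2
    simp only [EV]
    rw [h1, ih (fun e he => h e (List.mem_cons_of_mem _ he))]
    ring

theorem spread_EV (n : ℕ) (v : Unit → Fin (n + 1)) :
    EV (spread n) (fun u => ind (u = v)) (fun _ : Unit => 0) = 1 / ((n : ℝ) + 1) := by
  induction n with
  | zero =>
    simp only [spread, EV]
    rw [ind_true (funext fun _ => Subsingleton.elim (α := Fin 1) _ _)]; simp
  | succ n ih =>
    simp only [spread, EV]
    have h1 : (fun i : Unit => Equiv.swap (0 : Fin (n + 1 + 1)) 1 0) = fun i => Fin.succ 0 := by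
      funext i; simp
    rw [h1, EV_map_inj Fin.succ (Fin.succ_injective _) (spread n) _ (fun _ : Unit => 0)]
    rw [EV_fixed (f := fun _ : Unit => (0 : Fin (n + 1 + 1)))]
    · obtain ⟨x, rfl⟩ : ∃ x, v = fun _ => x := ⟨v (), rfl⟩
      refine Fin.cases ?_ (fun y => ?_) x
      · have h2 : ∀ u : Unit → Fin (n + 1), ind ((fun i => (u i).succ) = fun _ => 0) = 0 := by
          intro u; apply ind_false; intro h; exact Fin.succ_ne_zero _ (congrFun h ())
        simp only [h2, EV_const]
        rw [ind_true trivial]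
        push_cast; field_simp; ring
      · have h2 : ∀ u : Unit → Fin (n + 1), ind ((fun i => (u i).succ) = fun _ => y.succ) =
            ind (u = fun _ => y) := by
          intro u; apply ind_congr
          simp [funext_iff]
        simp only [h2, ih]
        rw [ind_false (fun h => Fin.succ_ne_zero _ (congrFun h ()).symm)]
        push_cast; field_simp; ring
    · intro e he i
      simp only [List.mem_map] at he
      obtain ⟨e', he', rfl⟩ := he
      exact ⟨(Fin.succ_ne_zero _).symm, (Fin.succ_ne_zero _).symm⟩

theorem spread_shuffle (n : ℕ) : IsTShuffle (Nat.le_add_left 1 n) (spread n) := by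
  refine ⟨spread_valid n, fun f _ => ?_⟩
  rw [placeProb_eq]
  have h := spread_EV n (fun _ => f 0)
  have h2 := EV_reindex (fun _ : Unit => (0 : Fin 1)) (spread n)
    (fun u => ind (u = fun _ => f 0)) (Fin.castLE (Nat.le_add_left 1 n))
  have h3 : (fun _ : Unit => Fin.castLE (Nat.le_add_left 1 n) (0 : Fin 1)) = fun _ => 0 := by
    funext i; ext; simp
  rw [h3, h] at h2
  have h4 : ∀ u : Fin 1 → Fin (n + 1), ind (u = f) = ind ((fun _ : Unit => u 0) = fun _ => f 0) := by
    intro u; apply ind_congr; simp [funext_iff, Fin.forall_fin_one]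
  rw [funext h4, ← h2, Nat.factorial_succ]
  push_cast
  have : ((n.factorial : ℕ) : ℝ) ≠ 0 := by positivity
  field_simp

/-- A full shuffle on `n` points. -/
def full : (n : ℕ) → List (LazyT n)
  | 0 => []
  | n + 1 => (full n).map (mapE Fin.succ) ++ spread n

theorem full_shuffle (n : ℕ) : IsTShuffle le_rfl (full n) := by
  induction n with
  | zero =>
    refine ⟨by simp [full], fun f _ => ?_⟩
    rw [placeProb_eq]
    simp only [full, EV]
    rw [ind_true (Subsingleton.elim _ _)]; simp
  | succ n ih =>
    refine ⟨?_, fun h hh => ?_⟩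
    · intro e he
      simp only [full, List.mem_append, List.mem_map] at he
      rcases he with ⟨e', he', rfl⟩ | he
      · exact valid_map _ (Fin.succ_injective _) _ (ih.1 e' he')
      · exact spread_valid n e he
    · rw [placeProb_eq]
      simp only [full]
      rw [EV_append]
      let Φ : (Fin n → Fin n) → (Fin (n + 1) → Fin (n + 1)) :=
        fun u => Fin.cons 0 (fun i => (u i).succ)
      have hΦ : (Fin.castLE le_rfl : Fin (n + 1) → Fin (n + 1)) = Φ (Fin.castLE le_rfl) := by
        funext i
        refine Fin.cases ?_ (fun j => ?_) i
        · simp [Φ]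
        · simp [Φ]
      rw [hΦ, EV_map Fin.succ Φ]
      · rw [TShuffle_EV ih]
        simp only [EV_eq_sum]
        simp only [Nat.sub_self, Nat.factorial_zero, Nat.cast_one]
        rw [← Finset.sum_mul, Finset.sum_comm]
        have hin : ∀ σ : Equiv.Perm (Fin (n + 1)),
            (∑ x : Fin n ↪ Fin n, ind (∀ i, σ (Φ x i) = h i) * permDist (spread n) σ) =
            ind (∀ i : Unit, σ ((fun _ => 0) i) = (fun _ => h 0) i) * permDist (spread n) σ := by
          intro σ
          by_cases h0 : σ 0 = h 0
          · rw [← Finset.sum_mul]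
            congr 1
            rw [ind_true (p := ∀ i : Unit, _) (fun _ => h0)]
            have hne : ∀ i : Fin n, σ.symm (h i.succ) ≠ 0 := by
              intro i hi
              have : h i.succ = h 0 := by rw [← h0, ← hi]; simp
              exact Fin.succ_ne_zero _ (hh this)
            let y : Fin n ↪ Fin n := ⟨fun i => (σ.symm (h i.succ)).pred (hne i), by
              intro i j hij
              have := Fin.pred_inj.mp hij
              exact Fin.succ_injective _ (hh (σ.symm.injective this))⟩
            rw [Finset.sum_eq_single y]
            · apply ind_true
              intro i
              refine Fin.cases ?_ (fun j => ?_) i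
              · simpa [Φ] using h0
              · change σ (Fin.succ ((σ.symm (h j.succ)).pred (hne j))) = h j.succ
                simp
            · intro b _ hb
              apply ind_false
              intro hc
              apply hb
              ext i
              have := hc i.succ
              simp only [Φ, Fin.cons_succ] at this
              have h5 : (b i).succ = σ.symm (h i.succ) := by rw [← this]; simp
              change ((b i : Fin n) : ℕ) = (((σ.symm (h i.succ)).pred (hne i) : Fin n) : ℕ)
              congr 1
              apply Fin.succ_injective; rw [h5]; simp
            · simp
          · have h1 : ∀ x : Fin n → Fin n, ¬ ∀ i, σ (Φ x i) = h i := by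
              intro x hx
              exact h0 (by simpa [Φ] using hx 0)
            rw [ind_false (p := ∀ i : Unit, _) (fun hx => h0 (hx ())), zero_mul]
            apply Finset.sum_eq_zero
            intro x _
            rw [ind_false (h1 x), zero_mul]
        rw [Finset.sum_congr rfl (fun σ _ => hin σ), ← EV_eq_sum, spread_EV, Nat.factorial_succ]
        push_cast
        have : ((n.factorial : ℕ) : ℝ) ≠ 0 := by positivity
        field_simp
      · intro a b f
        funext i
        refine Fin.cases ?_ (fun j => ?_) i
        · simp only [Φ, Fin.cons_zero]
          rw [Equiv.swap_apply_of_ne_of_ne] <;> exact (Fin.succ_ne_zero _).symm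
        · simp only [Φ, Fin.cons_succ]
          exact (Fin.succ_injective _).map_swap _ _ _

theorem exists_shuffle (t n : ℕ) (ht : t ≤ n) : IsTShuffle ht (full n) := by
  refine ⟨(full_shuffle n).1, fun f hf => ?_⟩
  rw [placeProb_eq]
  have := marg0 (full_shuffle n) (Fin.castLE ht) (Fin.castLE_injective ht) f hf
  simp only [Fin.castLE_rfl, id] at this
  rw [this, Fintype.card_fin]
  have h := Nat.factorial_mul_descFactorial ht
  have h1 : ((n.factorial : ℕ) : ℝ) ≠ 0 := by positivity
  rw [← h] at h1 ⊢
  push_cast at h1 ⊢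
  have h2 := left_ne_zero_of_mul h1
  have h3 := right_ne_zero_of_mul h1
  field_simp

theorem Ut_spec (t n : ℕ) (ht : t ≤ n) :
    ∃ L : List (LazyT n), L.length = Ut t n ∧ IsTShuffle ht L := by
  have hne : { ℓ : ℕ | ∃ (ht : t ≤ n) (L : List (LazyT n)), L.length = ℓ ∧ IsTShuffle ht L }.Nonempty :=
    ⟨_, ht, full n, rfl, exists_shuffle t n ht⟩
  obtain ⟨_, L, h1, h2⟩ := Nat.sInf_mem hne
  exact ⟨L, h1, h2⟩

/-- The three step shuffle of three points. -/
def three : List (LazyT 3) := [(0, 1, 1 / 2), (1, 2, 2 / 3), (0, 1, 1 / 2)]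

theorem three_valid : ∀ e ∈ three, e.Valid := by
  intro e he
  simp only [three, List.mem_cons, List.not_mem_nil, or_false] at he
  rcases he with rfl | rfl | rfl <;> refine ⟨by decide, ?_, ?_⟩ <;> norm_num

theorem three_EV (F : (Fin 3 → Fin 3) → ℝ) :
    EV three F id = (F ![0,1,2] + F ![0,2,1] + F ![1,0,2] + F ![1,2,0] + F ![2,0,1]
      + F ![2,1,0]) / 6 := by
  have e1 : ∀ g g' : Fin 3 → Fin 3, g = g' → F g = F g' := fun g g' h => by rw [h]
  simp only [three, EV, id]
  rw [e1 (fun i => Equiv.swap 0 1 (Equiv.swap 1 2 (Equiv.swap 0 1 i))) ![2,1,0] (by decide),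
    e1 (fun i => (Equiv.swap 1 2 (Equiv.swap 0 1 i))) ![2,0,1] (by decide),
    e1 (fun i => (Equiv.swap 0 1 (Equiv.swap 0 1 i))) ![0,1,2] (by decide),
    e1 (fun i => (Equiv.swap 0 1 i)) ![1,0,2] (by decide),
    e1 (fun i => (Equiv.swap 0 1 (Equiv.swap 1 2 i))) ![1,2,0] (by decide),
    e1 (fun i => (Equiv.swap 1 2 i)) ![0,2,1] (by decide),
    e1 id ![0,1,2] (by decide)]
  ring

theorem three_shuffle : IsTShuffle (le_refl 3) three := by
  refine ⟨three_valid, fun f hf => ?_⟩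
  rw [placeProb_eq]
  have h0 : (Fin.castLE (le_refl 3) : Fin 3 → Fin 3) = id := by funext i; simp
  rw [h0, three_EV]
  have hc : ∀ f : Fin 3 → Fin 3, Function.Injective f → f = ![0,1,2] ∨ f = ![0,2,1] ∨
    f = ![1,0,2] ∨ f = ![1,2,0] ∨ f = ![2,0,1] ∨ f = ![2,1,0] := by decide
  rcases hc f hf with rfl | rfl | rfl | rfl | rfl | rfl <;>
    simp [ind, Nat.factorial]

theorem Ut33 : Ut 3 3 ≤ 3 := Nat.sInf_le ⟨le_rfl, three, rfl, three_shuffle⟩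

theorem d1 (n : ℕ) : (n.descFactorial 1 : ℝ) = n := by simp
theorem d2 (n : ℕ) (h : 3 ≤ n) : (n.descFactorial 2 : ℝ) = n * (n - 1) := by
  obtain ⟨N, rfl⟩ := Nat.exists_eq_add_of_le' h
  simp [Nat.descFactorial_succ]; ring
theorem d3 (n : ℕ) (h : 3 ≤ n) : (n.descFactorial 3 : ℝ) = n * (n - 1) * (n - 2) := by
  obtain ⟨N, rfl⟩ := Nat.exists_eq_add_of_le' h
  simp [Nat.descFactorial_succ]; ring

/-- Tagged concatenation of a family of lists. -/
def tagged {S : Type*} (c : S → B) (RL : S → List (A × A × ℝ)) (l : List S) :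
    List (B × (A × A × ℝ)) := l.flatMap (fun s => (RL s).map (fun e => (c s, e)))

theorem tagged_filter_nil {S : Type*} (c : S → B) (RL : S → List (A × A × ℝ)) (l : List S) (b : B)
    (hb : ∀ s ∈ l, c s ≠ b) : ((tagged c RL l).filter (fun x => x.1 = b)).map Prod.snd = [] := by
  simp only [List.map_eq_nil_iff, List.filter_eq_nil_iff, tagged, List.mem_flatMap, List.mem_map]
  rintro x ⟨s, hs, e, he, rfl⟩
  simpa using hb s hs

theorem tagged_filter {S : Type*} (c : S → B) (hc : Function.Injective c)
    (RL : S → List (A × A × ℝ)) (l : List S) (hl : l.Nodup) (s : S) (hs : s ∈ l) :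
    ((tagged c RL l).filter (fun x => x.1 = c s)).map Prod.snd = RL s := by
  induction l with
  | nil => simp at hs
  | cons t l ih =>
    have hcons : tagged c RL (t :: l) = (RL t).map (fun e => (c t, e)) ++ tagged c RL l := by
      simp [tagged]
    rw [hcons, List.filter_append, List.map_append]
    rw [List.nodup_cons] at hl
    by_cases hst : s = t
    · subst hst
      rw [tagged_filter_nil c RL l (c s) (fun s' hs' h => hl.1 (hc h ▸ hs'))]
      simp [List.filter_map, Function.comp_def]
    · rw [ih hl.2 (by simpa [hst] using hs)]
      have : ¬ c t = c s := fun h => hst (hc h).symm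
      simp [List.filter_map, Function.comp_def, this]

section rows
variable {K M : ℕ}

/-- Count based weight for row patterns. -/
def Yv (K : ℕ) (H : Fin 3 → Fin K) (r : Fin 3 → Fin 3) : ℝ :=
  ∏ s : Fin 3, (ind (∀ i j, r i = s → r j = s → H i = H j → i = j) *
    (1 / (K.descFactorial (Finset.univ.filter (fun i => r i = s)).card : ℝ)))

/-- The list lifted from a tagged list. -/
def lift2 (N : List (B × (A × A × ℝ))) : List ((A × B) × (A × B) × ℝ) :=
  N.map (fun x => mapE (fun a => (a, x.1)) x.2)

theorem rows_EV (hK : 3 ≤ K) (hM : 3 ≤ M) (t : Fin 3 → ℕ) (ht : ∀ s, t s ≤ K)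
    (RL : Fin 3 → List (LazyT K)) (hRL : ∀ s, IsTShuffle (ht s) (RL s))
    (x r : Fin 3 → Fin 3) (hx : ∀ i, (x i : ℕ) < t (r i))
    (hxr : ∀ i j, x i = x j → r i = r j → i = j) (H : Fin 3 → Fin K) :
    EV (lift2 (tagged (Fin.castLE hM) RL (List.finRange 3)))
      (fun u : Fin 3 → Fin K × Fin M => ind (∀ i, (u i).1 = H i))
      (fun i => (Fin.castLE hK (x i), Fin.castLE hM (r i))) = Yv K H r := by
  have h1 : EV (lift2 (tagged (Fin.castLE hM) RL (List.finRange 3)))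
      (fun u : Fin 3 → Fin K × Fin M => ind (∀ i, (u i).1 = H i))
      (fun i => (Fin.castLE hK (x i), Fin.castLE hM (r i))) =
      EV (lift2 (tagged (Fin.castLE hM) RL (List.finRange 3)))
      (fun u : Fin 3 → Fin K × Fin M => ind (u = fun i => (H i, Fin.castLE hM (r i))))
      (fun i => (Fin.castLE hK (x i), Fin.castLE hM (r i))) := by
    apply EV_congr _ (fun u => ∀ i, (u i).2 = Fin.castLE hM (r i))
    · intro e he u hu i
      simp only [lift2, List.mem_map] at he
      obtain ⟨y, hy, rfl⟩ := he
      simp only [mapE, Equiv.swap_apply_def]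
      rw [← hu i]
      split_ifs with h1 h2
      · rw [h1]
      · rw [h2]
      · rfl
    · intro u hu
      apply ind_congr
      constructor
      · intro h; funext i; exact Prod.ext (h i) (hu i)
      · rintro h i; rw [h]
    · intro i; rfl
  rw [h1, lift2, EV_prod]
  simp only
  rw [ind_true (by simp), one_mul, Yv]
  symm
  apply Fintype.prod_of_injective (Fin.castLE hM) (Fin.castLE_injective hM)
  · intro b hb
    rw [tagged_filter_nil _ _ _ _ (fun s _ h => hb ⟨s, h⟩)]
    simp only [EV]
    exact ind_true (fun i h => absurd ⟨r i, h⟩ hb)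
  · intro s
    rw [tagged_filter _ (Fin.castLE_injective hM) _ _ (List.nodup_finRange 3) s (by simp)]
    have := marg (hRL s) (fun i => Fin.castLE hK (x i)) (fun i => r i = s)
      (fun i hi => by subst hi; exact hx i)
      (fun i j hi hj h => hxr i j (Fin.castLE_injective hK h) (hi.trans hj.symm)) H
    rw [← this]
    simp only [Fin.castLE_inj]

/-- Weight of the group pattern. -/
def Wv (M : ℕ) (H : Fin 3 → Fin K) : ℝ :=
  ∏ g : Fin K, (1 / (M.descFactorial (Finset.univ.filter (fun i => H i = g)).card : ℝ))

/-- The list performing a shuffle in each group. -/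
def groupsL (K : ℕ) (L : List (LazyT M)) : List ((Fin K × Fin M) × (Fin K × Fin M) × ℝ) :=
  (lift2 (tagged (fun g : Fin K => g) (fun _ => L) (List.finRange K))).map (mapE Prod.swap)

theorem groups_EV (hM : 3 ≤ M) (L : List (LazyT M)) (hL : IsTShuffle hM L)
    (f h : Fin 3 → Fin K × Fin M) (hf : Function.Injective f) (hh : Function.Injective h)
    (hf3 : ∀ i, ((f i).2 : ℕ) < 3) :
    EV (groupsL K L) (fun u => ind (u = h)) f =
      Wv M (fun i => (h i).1) * ind (∀ i, (f i).1 = (h i).1) := by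
  have h0 := EV_map_inj (Prod.swap : Fin M × Fin K → Fin K × Fin M) Prod.swap_injective
    (lift2 (tagged (fun g : Fin K => g) (fun _ => L) (List.finRange K)))
    (fun u => ind (u = h)) (fun i => (f i).swap)
  simp only [Prod.swap_swap] at h0
  rw [groupsL, h0]
  have h1 : ∀ u : Fin 3 → Fin M × Fin K, ind ((fun i => (u i).swap) = h) =
      ind (u = fun i => (h i).swap) := by
    intro u; apply ind_congr
    constructor
    · rintro rfl; simp
    · rintro rfl; simp
  simp only [h1]
  rw [lift2, EV_prod]
  simp only [Prod.snd_swap, Prod.fst_swap]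
  by_cases hg : ∀ i, (f i).1 = (h i).1
  · rw [ind_true hg, one_mul, mul_one, Wv]
    apply Finset.prod_congr rfl
    intro g _
    rw [tagged_filter (fun g : Fin K => g) (fun _ _ h => h) _ _ (List.nodup_finRange K) g (by simp)]
    rw [marg hL (fun i => (f i).2) (fun i => (f i).1 = g) (fun i _ => hf3 i)
      (fun i j hi hj hij => hf (Prod.ext (hi.trans hj.symm) hij))]
    rw [ind_true, one_mul]
    · simp only [hg]
    · intro i j hi hj hij
      rw [hg] at hi hj
      exact hh (Prod.ext (hi.trans hj.symm) hij)
  · rw [ind_false hg, zero_mul, mul_zero]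

theorem Wv_inj (hM : 3 ≤ M) (H : Fin 3 → Fin K) (hH : Function.Injective H) :
    Wv M H = 1 / ((M : ℝ) * M * M) := by
  rw [Wv, ← Fintype.prod_of_injective H hH (fun _ => 1 / (M : ℝ))]
  · rw [Fin.prod_univ_three]; field_simp
  · intro g hg
    have : Finset.univ.filter (fun i => H i = g) = ∅ := by
      ext i; simp only [Finset.mem_filter, Finset.mem_univ, true_and, Finset.notMem_empty, iff_false]
      exact fun h => hg ⟨i, h⟩
    rw [this]; simp
  · intro i
    have : Finset.univ.filter (fun j => H j = H i) = {i} := by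
      ext j; simp [hH.eq_iff]
    rw [this]; simp

theorem Wv_pair (hM : 3 ≤ M) (H : Fin 3 → Fin K) (i j l : Fin 3) (hij : i ≠ j)
    (hall : ∀ x, x = i ∨ x = j ∨ x = l) (h1 : H i = H j) (h2 : H i ≠ H l) :
    Wv M H = 1 / ((M : ℝ) * (M - 1) * M) := by
  rw [Wv, Fintype.prod_eq_mul (H i) (H l) h2]
  · have e1 : Finset.univ.filter (fun x => H x = H i) = {i, j} := by
      ext x
      simp only [Finset.mem_filter, Finset.mem_univ, true_and, Finset.mem_insert,
        Finset.mem_singleton]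
      constructor
      · intro h
        rcases hall x with rfl | rfl | rfl
        · simp
        · simp
        · exact absurd h.symm h2
      · rintro (rfl | rfl)
        · rfl
        · exact h1.symm
    have e2 : Finset.univ.filter (fun x => H x = H l) = {l} := by
      ext x
      simp only [Finset.mem_filter, Finset.mem_univ, true_and, Finset.mem_singleton]
      constructor
      · intro h
        rcases hall x with rfl | rfl | rfl
        · exact absurd h h2
        · exact absurd (h1.trans h) h2
        · rfl
      · rintro rfl; rfl
    rw [e1, e2, Finset.card_pair hij, Finset.card_singleton, d2 M hM, d1]
    rw [one_div_mul_one_div]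
  · rintro g ⟨hg1, hg2⟩
    have : Finset.univ.filter (fun i => H i = g) = ∅ := by
      ext x; simp only [Finset.mem_filter, Finset.mem_univ, true_and, Finset.notMem_empty, iff_false]
      rintro rfl
      rcases hall x with rfl | rfl | rfl
      · exact hg1 rfl
      · exact hg1 h1.symm
      · exact hg2 rfl
    rw [this]; simp

theorem Wv_same (hM : 3 ≤ M) (H : Fin 3 → Fin K) (h : ∀ i, H i = H 0) :
    Wv M H = 1 / ((M : ℝ) * (M - 1) * (M - 2)) := by
  rw [Wv, Fintype.prod_eq_single (H 0)]
  · simp only [h]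
    simp only [Finset.filter_true, Finset.card_univ, Fintype.card_fin]
    rw [d3 M hM]
  · intro g hg
    have : ∀ i, ¬ H i = g := fun i hi => hg (by rw [← hi, h])
    simp [this]

/-- The closed form of the group distribution. -/
def PH (K : ℕ) (p q : ℝ) (H : Fin 3 → Fin K) : ℝ :=
  (1 - p) * (1 - q) / ((K : ℝ) * K * K) +
  (p * (1 - q) + (1 - p) * q) / 3 *
    ((ind (H 0 ≠ H 1) + ind (H 0 ≠ H 2) + ind (H 1 ≠ H 2)) / ((K : ℝ) * K * (K - 1))) +
  p * q * ind (H 0 ≠ H 1 ∧ H 0 ≠ H 2 ∧ H 1 ≠ H 2) / ((K : ℝ) * (K - 1) * (K - 2))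

/-- Initial mixture of row patterns. -/
def mixY (K : ℕ) (p q : ℝ) (H : Fin 3 → Fin K) (g : Fin 3 → Fin 3) : ℝ :=
  p * (q * Yv K H (fun i => ![0,0,0] (g i)) + (1 - q) * Yv K H (fun i => ![0,0,2] (g i))) +
  (1 - p) * (q * Yv K H (fun i => ![0,1,0] (g i)) + (1 - q) * Yv K H (fun i => ![0,1,2] (g i)))


theorem Yv_perm (H : Fin 3 → Fin K) (r : Fin 3 → Fin 3) (hr : Function.Injective r) :
    Yv K H r = 1 / ((K : ℝ) * K * K) := by
  have hc : ∀ s, (Finset.univ.filter (fun i => r i = s)).card = 1 := by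
    revert r; decide
  have hi : ∀ s, ind (∀ i j, r i = s → r j = s → H i = H j → i = j) = 1 :=
    fun s => ind_true (fun i j h1 h2 _ => hr (h1.trans h2.symm))
  simp only [Yv, hc, hi, d1, Fin.prod_univ_three]
  rw [one_mul, one_div_mul_one_div, one_div_mul_one_div]

theorem Yv_one (hK : 3 ≤ K) (H : Fin 3 → Fin K) (r : Fin 3 → Fin 3) (i j l : Fin 3) (hij : i < j)
    (hl : l ≠ i ∧ l ≠ j) (hr : r i = 0 ∧ r j = 0 ∧ r l ≠ 0) :
    Yv K H r = ind (H i ≠ H j) / ((K : ℝ) * K * (K - 1)) := by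
  have hall : ∀ x, x = i ∨ x = j ∨ x = l := by clear hr; revert i j l; decide
  have h0 : Finset.univ.filter (fun x => r x = 0) = {i, j} := by
    ext x
    rcases hall x with rfl | rfl | rfl <;> simp [hr, hl]
  have hr12 : r l = 1 ∨ r l = 2 := by
    have : ∀ y : Fin 3, y ≠ 0 → y = 1 ∨ y = 2 := by decide
    exact this _ hr.2.2
  have hc : ∀ s : Fin 3, s ≠ 0 → r l = s → Finset.univ.filter (fun x => r x = s) = {l} := by
    intro s hs hls
    ext x
    rcases hall x with rfl | rfl | rfl <;> simp [hr, hl, hs.symm, hls, hl.1.symm, hl.2.symm]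
  have hc' : ∀ s : Fin 3, s ≠ 0 → r l ≠ s → Finset.univ.filter (fun x => r x = s) = ∅ := by
    intro s hs hls
    ext x
    rcases hall x with rfl | rfl | rfl <;> simp [hr, hs.symm, hls]
  have hi : ∀ s, s ≠ 0 → ind (∀ i j, r i = s → r j = s → H i = H j → i = j) = 1 := by
    intro s hs
    apply ind_true
    intro a b ha hb _
    have : ∀ x, r x = s → x = l := by
      intro x hx
      rcases hall x with rfl | rfl | rfl
      · exact absurd (hx.symm.trans hr.1) hs
      · exact absurd (hx.symm.trans hr.2.1) hs
      · rfl
    rw [this a ha, this b hb]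
  have hi0 : ind (∀ i j, r i = 0 → r j = 0 → H i = H j → i = j) = ind (H i ≠ H j) := by
    apply ind_congr
    constructor
    · intro h hH; exact hij.ne (h i j hr.1 hr.2.1 hH)
    · intro h a b ha hb hab
      rcases hall a with rfl | rfl | rfl <;> rcases hall b with rfl | rfl | rfl <;>
        first | rfl | exact absurd hab h | exact absurd hab.symm h | exact absurd ha hr.2.2 |
          exact absurd hb hr.2.2
  rw [Yv, Fin.prod_univ_three, hi0, hi 1 (by decide), hi 2 (by decide), h0,
    Finset.card_pair hij.ne, d2 K hK]
  have hk : (3 : ℝ) ≤ K := by exact_mod_cast hK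
  have z1 : (K : ℝ) ≠ 0 := by linarith
  have z2 : (K : ℝ) - 1 ≠ 0 := by linarith
  rcases hr12 with h | h
  · rw [hc 1 (by decide) h, hc' 2 (by decide) (by rw [h]; decide)]
    simp only [Finset.card_singleton, Finset.card_empty, d1, Nat.descFactorial_zero]
    push_cast; field_simp
  · rw [hc 2 (by decide) h, hc' 1 (by decide) (by rw [h]; decide)]
    simp only [Finset.card_singleton, Finset.card_empty, d1, Nat.descFactorial_zero]
    push_cast; field_simp

theorem Yv_zero (hK : 3 ≤ K) (H : Fin 3 → Fin K) (r : Fin 3 → Fin 3) (hr : ∀ i, r i = 0) :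
    Yv K H r = ind (H 0 ≠ H 1 ∧ H 0 ≠ H 2 ∧ H 1 ≠ H 2) / ((K : ℝ) * (K - 1) * (K - 2)) := by
  obtain rfl : r = fun _ => 0 := funext hr
  have h0 : ind (∀ i j : Fin 3, (0 : Fin 3) = 0 → (0 : Fin 3) = 0 → H i = H j → i = j) =
      ind (H 0 ≠ H 1 ∧ H 0 ≠ H 2 ∧ H 1 ≠ H 2) := by
    apply ind_congr
    constructor
    · intro h
      refine ⟨fun e => ?_, fun e => ?_, fun e => ?_⟩ <;>
        exact absurd (h _ _ rfl rfl e) (by decide)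
    · rintro ⟨h1, h2, h3⟩ i j - - h
      fin_cases i <;> fin_cases j <;> first | rfl | exact absurd h ‹_› | exact absurd h.symm ‹_›
  have h1 : ∀ s : Fin 3, s ≠ 0 → ind (∀ i j : Fin 3, (0 : Fin 3) = s → (0 : Fin 3) = s →
      H i = H j → i = j) = 1 :=
    fun s hs => ind_true (fun i j h => absurd h.symm hs)
  rw [Yv, Fin.prod_univ_three, h0, h1 1 (by decide), h1 2 (by decide)]
  have c0 : (Finset.univ.filter (fun _ : Fin 3 => (0 : Fin 3) = 0)).card = 3 := by decide
  have c1 : (Finset.univ.filter (fun _ : Fin 3 => (0 : Fin 3) = 1)).card = 0 := by decide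
  have c2 : (Finset.univ.filter (fun _ : Fin 3 => (0 : Fin 3) = 2)).card = 0 := by decide
  rw [c0, c1, c2, d3 K hK]
  simp [div_eq_mul_inv]

theorem mixY_eq (hK : 3 ≤ K) (p q : ℝ) (H : Fin 3 → Fin K) (g : Fin 3 → Fin 3)
    (hg : Function.Injective g) (i j l i' j' l' : Fin 3) (hij : i < j) (hl : l ≠ i ∧ l ≠ j)
    (hij' : i' < j') (hl' : l' ≠ i' ∧ l' ≠ j') (h2 : g l = 2) (h1 : g l' = 1) :
    mixY K p q H g = (1 - p) * (1 - q) / ((K : ℝ) * K * K) +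
      p * (1 - q) * (ind (H i ≠ H j) / ((K : ℝ) * K * (K - 1))) +
      (1 - p) * q * (ind (H i' ≠ H j') / ((K : ℝ) * K * (K - 1))) +
      p * q * (ind (H 0 ≠ H 1 ∧ H 0 ≠ H 2 ∧ H 1 ≠ H 2) / ((K : ℝ) * (K - 1) * (K - 2))) := by
  have hz2 : ∀ y : Fin 3, y ≠ 2 → (![0,0,2] : Fin 3 → Fin 3) y = 0 := by decide
  have hz1 : ∀ y : Fin 3, y ≠ 1 → (![0,1,0] : Fin 3 → Fin 3) y = 0 := by decide
  have n2 : ∀ x, l ≠ x → g x ≠ 2 := fun x hx h => hx (hg (h2.trans h.symm))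
  have n1 : ∀ x, l' ≠ x → g x ≠ 1 := fun x hx h => hx (hg (h1.trans h.symm))
  rw [mixY, Yv_zero hK H (fun i => ![0,0,0] (g i)) (fun i => (by decide : ∀ y : Fin 3, (![0,0,0] : Fin 3 → Fin 3) y = 0) _),
    Yv_perm H (fun i => ![0,1,2] (g i))
      (fun a b h => hg ((by decide : Function.Injective (![0,1,2] : Fin 3 → Fin 3)) h)),
    Yv_one hK H (fun i => ![0,0,2] (g i)) i j l hij hl
      ⟨hz2 _ (n2 _ hl.1), hz2 _ (n2 _ hl.2), by simp only [h2]; decide⟩,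
    Yv_one hK H (fun i => ![0,1,0] (g i)) i' j' l' hij' hl'
      ⟨hz1 _ (n1 _ hl'.1), hz1 _ (n1 _ hl'.2), by simp only [h1]; decide⟩]
  ring

theorem mixY_sum (hK : 3 ≤ K) (p q : ℝ) (H : Fin 3 → Fin K) :
    (mixY K p q H ![0,1,2] + mixY K p q H ![0,2,1] + mixY K p q H ![1,0,2] +
      mixY K p q H ![1,2,0] + mixY K p q H ![2,0,1] + mixY K p q H ![2,1,0]) / 6 = PH K p q H := by
  rw [mixY_eq hK p q H ![0,1,2] (by decide) 0 1 2 0 2 1 (by decide) (by decide) (by decide)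
      (by decide) (by decide) (by decide),
    mixY_eq hK p q H ![0,2,1] (by decide) 0 2 1 0 1 2 (by decide) (by decide) (by decide)
      (by decide) (by decide) (by decide),
    mixY_eq hK p q H ![1,0,2] (by decide) 0 1 2 1 2 0 (by decide) (by decide) (by decide)
      (by decide) (by decide) (by decide),
    mixY_eq hK p q H ![1,2,0] (by decide) 0 2 1 1 2 0 (by decide) (by decide) (by decide)
      (by decide) (by decide) (by decide),
    mixY_eq hK p q H ![2,0,1] (by decide) 1 2 0 0 1 2 (by decide) (by decide) (by decide)
      (by decide) (by decide) (by decide),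
    mixY_eq hK p q H ![2,1,0] (by decide) 1 2 0 0 2 1 (by decide) (by decide) (by decide)
      (by decide) (by decide) (by decide), PH]
  ring

theorem exists_pq (k m : ℝ) (hk : 3 ≤ k) (hm : 3 ≤ m) : ∃ p q : ℝ, 0 ≤ p ∧ p ≤ 1 ∧ 0 ≤ q ∧ q ≤ 1 ∧
    p * q = (k - 1) * (k - 2) / ((m * k - 1) * (m * k - 2)) ∧
    (1 - p) * (1 - q) = k * k * (m - 1) * (m - 2) / ((m * k - 1) * (m * k - 2)) := by
  have hmk : 9 ≤ m * k := by nlinarith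
  have hD : 0 < (m * k - 1) * (m * k - 2) := by apply mul_pos <;> linarith
  obtain ⟨D, hDd⟩ : ∃ D, D = (m * k - 1) * (m * k - 2) := ⟨_, rfl⟩
  obtain ⟨a, ha⟩ : ∃ a, a = (k - 1) * (k - 2) / ((m * k - 1) * (m * k - 2)) := ⟨_, rfl⟩
  obtain ⟨c, hc⟩ : ∃ c, c = k * k * (m - 1) * (m - 2) / ((m * k - 1) * (m * k - 2)) := ⟨_, rfl⟩
  obtain ⟨b, hb⟩ : ∃ b, b = 3 * k * (m - 1) * (k - 1) / ((m * k - 1) * (m * k - 2)) := ⟨_, rfl⟩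
  have hsum : a + b + c = 1 := by
    rw [ha, hb, hc, ← add_div, ← add_div, div_eq_one_iff_eq hD.ne']; ring
  have hm1 : 0 ≤ m - 1 := by linarith
  have hm2 : 0 ≤ m - 2 := by linarith
  have hk1 : 0 ≤ k - 1 := by linarith
  have hk2 : 0 ≤ k - 2 := by linarith
  have hk0 : 0 ≤ k := by linarith
  have ha0 : 0 ≤ a := by rw [ha]; positivity
  have hb0 : 0 ≤ b := by rw [hb]; positivity
  have hc0 : 0 ≤ c := by rw [hc]; positivity
  have hdisc : 4 * a * c ≤ b * b := by
    have e1 : 4 * a * c = (k * k * (m - 1) * (k - 1)) * (4 * (k - 2) * (m - 2)) / (D * D) := by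
      rw [ha, hc, ← hDd]; field_simp
    have e2 : b * b = (k * k * (m - 1) * (k - 1)) * (9 * (m - 1) * (k - 1)) / (D * D) := by
      rw [hb, ← hDd]; field_simp; ring
    rw [e1, e2]
    have : 4 * (k - 2) * (m - 2) ≤ 9 * (m - 1) * (k - 1) := by nlinarith [mul_nonneg hk2 hm2]
    rw [← hDd] at hD
    gcongr
  rw [← ha, ← hc]
  obtain ⟨s, hs⟩ : ∃ s, s = Real.sqrt (b * b - 4 * a * c) := ⟨_, rfl⟩
  have hss : s * s = b * b - 4 * a * c := by rw [hs]; exact Real.mul_self_sqrt (by linarith)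
  have hs0 : 0 ≤ s := by rw [hs]; exact Real.sqrt_nonneg _
  have hsb : s ≤ b := by
    rw [hs]; apply Real.sqrt_le_iff.mpr ⟨hb0, _⟩
    nlinarith [mul_nonneg ha0 hc0]
  refine ⟨(2 * a + b + s) / 2, (2 * a + b - s) / 2, by linarith, by linarith, by linarith,
    by linarith, ?_, ?_⟩
  · have hb' : c = 1 - a - b := by linarith
    subst hb'
    nlinarith
  · have hb' : a = 1 - c - b := by linarith
    subst hb'
    nlinarith

theorem final_alg (hK : 3 ≤ K) (hM : 3 ≤ M) (p q : ℝ)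
    (hpq : p * q = ((K : ℝ) - 1) * (K - 2) / (((M : ℝ) * K - 1) * (M * K - 2)))
    (hpq' : (1 - p) * (1 - q) =
      (K : ℝ) * K * (M - 1) * (M - 2) / (((M : ℝ) * K - 1) * (M * K - 2))) (H : Fin 3 → Fin K) :
    Wv M H * PH K p q H = 1 / (((M : ℝ) * K) * (M * K - 1) * (M * K - 2)) := by
  have hk : (3 : ℝ) ≤ K := by exact_mod_cast hK
  have hm : (3 : ℝ) ≤ M := by exact_mod_cast hM
  have hmk : (9 : ℝ) ≤ M * K := by nlinarith
  have z1 : (K : ℝ) ≠ 0 := by linarith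
  have z2 : (K : ℝ) - 1 ≠ 0 := by linarith
  have z3 : (K : ℝ) - 2 ≠ 0 := by linarith
  have z4 : (M : ℝ) ≠ 0 := by linarith
  have z5 : (M : ℝ) - 1 ≠ 0 := by linarith
  have z6 : (M : ℝ) - 2 ≠ 0 := by linarith
  have z7 : (M : ℝ) * K - 1 ≠ 0 := by linarith
  have z8 : (M : ℝ) * K - 2 ≠ 0 := by linarith
  have hb : p * (1 - q) + (1 - p) * q =
      3 * ((K : ℝ) * (M - 1) * (K - 1) / (((M : ℝ) * K - 1) * (M * K - 2))) := by
    have : p * (1 - q) + (1 - p) * q = 1 - p * q - (1 - p) * (1 - q) := by ring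
    rw [this, hpq, hpq', sub_sub, ← add_div, ← mul_div_assoc, one_sub_div (mul_ne_zero z7 z8)]
    congr 1; ring
  rw [PH, hpq, hpq', hb]
  by_cases h01 : H 0 = H 1
  · by_cases h02 : H 0 = H 2
    · have h12 : H 1 = H 2 := h01.symm.trans h02
      rw [Wv_same hM H (by intro i; fin_cases i; exacts [rfl, h01.symm, h02.symm])]
      rw [ind_false (by simpa using h01), ind_false (by simpa using h02),
        ind_false (by simpa using h12), ind_false (fun h => h.1 h01)]
      field_simp; ring
    · have h12 : H 1 ≠ H 2 := fun h => h02 (h01.trans h)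
      rw [Wv_pair hM H 0 1 2 (by decide) (by decide) h01 h02]
      rw [ind_false (by simpa using h01), ind_true h02, ind_true h12, ind_false (fun h => h.1 h01)]
      field_simp; ring
  · by_cases h02 : H 0 = H 2
    · have h12 : H 1 ≠ H 2 := fun h => h01 (h02.trans h.symm)
      rw [Wv_pair hM H 0 2 1 (by decide) (by decide) h02 h01]
      rw [ind_true h01, ind_false (by simpa using h02), ind_true h12, ind_false (fun h => h.2.1 h02)]
      field_simp; ring
    · by_cases h12 : H 1 = H 2
      · rw [Wv_pair hM H 1 2 0 (by decide) (by decide) h12 (Ne.symm h01)]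
        rw [ind_true h01, ind_true h02, ind_false (by simpa using h12), ind_false (fun h => h.2.2 h12)]
        field_simp; ring
      · rw [Wv_inj hM H ?_]
        · rw [ind_true h01, ind_true h02, ind_true h12, ind_true ⟨h01, h02, h12⟩]
          field_simp; ring
        · intro i j h
          fin_cases i <;> fin_cases j <;> first | rfl | exact absurd h ‹_› | exact absurd h.symm ‹_›

/-- The three starting positions. -/
def startP (hK : 3 ≤ K) (hM : 3 ≤ M) (y : Fin 3) : Fin K × Fin M :=
  (Fin.castLE hK 0, Fin.castLE hM y)

/-- The two lazy transpositions creating the mixture. -/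
def midL (hK : 3 ≤ K) (hM : 3 ≤ M) (p q : ℝ) : List ((Fin K × Fin M) × (Fin K × Fin M) × ℝ) :=
  [((Fin.castLE hK 0, Fin.castLE hM 1), (Fin.castLE hK 1, Fin.castLE hM 0), p),
   ((Fin.castLE hK 0, Fin.castLE hM 2), (Fin.castLE hK 2, Fin.castLE hM 0), q)]

theorem startP_inj (hK : 3 ≤ K) (hM : 3 ≤ M) : Function.Injective (startP hK hM) := by
  intro a b h
  simpa [startP] using h

theorem swap_pos (hK : 3 ≤ K) (hM : 3 ≤ M) (a b c d x y : Fin 3) :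
    Equiv.swap (Fin.castLE hK a, Fin.castLE hM b) (Fin.castLE hK c, Fin.castLE hM d)
      (Fin.castLE hK x, Fin.castLE hM y) =
    (Fin.castLE hK (Equiv.swap (a, b) (c, d) (x, y)).1,
      Fin.castLE hM (Equiv.swap (a, b) (c, d) (x, y)).2) := by
  have hinj : Function.Injective (fun z : Fin 3 × Fin 3 => (Fin.castLE hK z.1, Fin.castLE hM z.2)) := by
    rintro ⟨a, b⟩ ⟨c, d⟩ h
    simpa using h
  exact (hinj.map_swap (a, b) (c, d) (x, y)).symm

theorem pre_EV (hK : 3 ≤ K) (hM : 3 ≤ M) (RL : Fin 3 → List (LazyT K))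
    (ht : ∀ s, (![3, 1, 1] : Fin 3 → ℕ) s ≤ K)
    (hRL : ∀ s, IsTShuffle (ht s) (RL s)) (p q : ℝ) (H : Fin 3 → Fin K) :
    EV (three.map (mapE (startP hK hM)) ++ (midL hK hM p q ++
        lift2 (tagged (Fin.castLE hM) RL (List.finRange 3))))
      (fun u => ind (∀ i, (u i).1 = H i)) (startP hK hM) = PH K p q H := by
  rw [EV_append]
  have h0 := EV_map_inj (startP hK hM) (startP_inj hK hM) three
    (EV (midL hK hM p q ++ lift2 (tagged (Fin.castLE hM) RL (List.finRange 3)))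
      (fun u : Fin 3 → Fin K × Fin M => ind (∀ i, (u i).1 = H i))) id
  refine Eq.trans h0 ?_
  rw [three_EV]
  have hY := rows_EV hK hM _ ht RL hRL
  have key : ∀ g : Fin 3 → Fin 3, Function.Injective g →
      EV (midL hK hM p q ++ lift2 (tagged (Fin.castLE hM) RL (List.finRange 3)))
      (fun u : Fin 3 → Fin K × Fin M => ind (∀ i, (u i).1 = H i)) (fun i => startP hK hM (g i)) =
      mixY K p q H g := by
    intro g hg
    rw [EV_append]
    simp only [midL, EV, startP, swap_pos]
    have c1 : ∀ y : Fin 3, Equiv.swap ((0 : Fin 3), (1 : Fin 3)) (1, 0) (0, y) =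
      ((![0,1,0] : Fin 3 → Fin 3) y, (![0,0,2] : Fin 3 → Fin 3) y) := by decide
    have c2 : ∀ y : Fin 3, Equiv.swap ((0 : Fin 3), (2 : Fin 3)) (2, 0) (0, y) =
      ((![0,0,2] : Fin 3 → Fin 3) y, (![0,1,0] : Fin 3 → Fin 3) y) := by decide
    have c3 : ∀ y : Fin 3, Equiv.swap ((0 : Fin 3), (2 : Fin 3)) (2, 0)
      ((![0,1,0] : Fin 3 → Fin 3) y, (![0,0,2] : Fin 3 → Fin 3) y) =
      ((![0,1,2] : Fin 3 → Fin 3) y, (![0,0,0] : Fin 3 → Fin 3) y) := by decide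
    have c4 : ∀ y : Fin 3, y = (![0,1,2] : Fin 3 → Fin 3) y := by decide
    simp only [c1, c2, c3]
    have lt : ∀ x r : Fin 3 → Fin 3, (∀ y, (x y : ℕ) < (![3, 1, 1] : Fin 3 → ℕ) (r y)) →
        (∀ y z, x y = x z → r y = r z → y = z) →
        EV (lift2 (tagged (Fin.castLE hM) RL (List.finRange 3)))
          (fun u : Fin 3 → Fin K × Fin M => ind (∀ i, (u i).1 = H i))
          (fun i => (Fin.castLE hK (x (g i)), Fin.castLE hM (r (g i)))) =
        Yv K H (fun i => r (g i)) := by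
      intro x r h1 h2
      exact hY (fun i => x (g i)) (fun i => r (g i)) (fun i => h1 _)
        (fun i j h3 h4 => hg (h2 _ _ h3 h4)) H
    have l1 := lt ![0,1,2] ![0,0,0] (by decide) (by decide)
    have l2 := lt ![0,1,0] ![0,0,2] (by decide) (by decide)
    have l3 := lt ![0,0,2] ![0,1,0] (by decide) (by decide)
    have l4 := lt (fun _ => 0) ![0,1,2] (by decide) (by decide)
    have l4' : EV (lift2 (tagged (Fin.castLE hM) RL (List.finRange 3)))
          (fun u : Fin 3 → Fin K × Fin M => ind (∀ i, (u i).1 = H i))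
          (fun i => (Fin.castLE hK 0, Fin.castLE hM (g i))) =
        Yv K H (fun i => ![0,1,2] (g i)) := by
      rw [← l4]
      congr 1
      funext i
      rw [← c4]
    rw [l1, l2, l3, l4', mixY]
  rw [key _ (by decide), key _ (by decide), key _ (by decide), key _ (by decide),
    key _ (by decide), key _ (by decide), mixY_sum hK]

/-- Validity for lazy transpositions on a general type. -/
def VE {P : Type*} (e : P × P × ℝ) : Prop := e.1 ≠ e.2.1 ∧ 0 ≤ e.2.2 ∧ e.2.2 ≤ 1

theorem VE_map {P Q : Type*} (φ : P → Q) (hφ : Function.Injective φ) (e : P × P × ℝ)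
    (he : VE e) : VE (mapE φ e) :=
  ⟨fun h => he.1 (hφ h), he.2⟩

theorem lift2_VE {S : Type*} (c : S → B) (RL : S → List (A × A × ℝ)) (l : List S)
    (h : ∀ s, ∀ e ∈ RL s, VE e) : ∀ e ∈ lift2 (tagged c RL l), VE e := by
  intro e he
  simp only [lift2, tagged, List.mem_map, List.mem_flatMap] at he
  obtain ⟨x, ⟨s, hs, e', he', rfl⟩, rfl⟩ := he
  exact VE_map _ (fun a b h => (Prod.ext_iff.mp h).1) _ (h s e' he')

theorem main_bound (k m : ℕ) (hK : 3 ≤ k) (hM : 3 ≤ m) :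
    Ut 3 (m * k) ≤ 2 * k + 3 + Ut 3 k + k * Ut 3 m := by
  obtain ⟨LK, hLK, sLK⟩ := Ut_spec 3 k hK
  obtain ⟨LM, hLM, sLM⟩ := Ut_spec 3 m hM
  obtain ⟨k', rfl⟩ := Nat.exists_eq_add_of_le' hK
  obtain ⟨p, q, hp0, hp1, hq0, hq1, hpq, hpq'⟩ := exists_pq ((k' + 3 : ℕ) : ℝ) (m : ℝ)
    (by exact_mod_cast hK) (by exact_mod_cast hM)
  let RL : Fin 3 → List (LazyT (k' + 3)) := ![LK, spread (k' + 2), spread (k' + 2)]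
  have ht : ∀ s, (![3, 1, 1] : Fin 3 → ℕ) s ≤ k' + 3 := by
    intro s; fin_cases s <;> simp
  have hRL : ∀ s, IsTShuffle (ht s) (RL s) := by
    intro s
    fin_cases s
    · exact sLK
    · exact spread_shuffle (k' + 2)
    · exact spread_shuffle (k' + 2)
  have hn : 3 ≤ m * (k' + 3) := by nlinarith
  let pre := three.map (mapE (startP hK hM)) ++ (midL hK hM p q ++
        lift2 (tagged (Fin.castLE hM) RL (List.finRange 3)))
  let T := pre ++ groupsL (k' + 3) LM
  -- validity
  have vT : ∀ e ∈ T, VE e := by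
    intro e he
    simp only [T, pre, List.mem_append] at he
    rcases he with (he | he | he) | he
    · obtain ⟨e', he', rfl⟩ := List.mem_map.mp he
      exact VE_map _ (startP_inj hK hM) _ (three_valid e' he')
    · simp only [midL, List.mem_cons, List.not_mem_nil, or_false] at he
      rcases he with rfl | rfl
      · exact ⟨by simp, hp0, hp1⟩
      · exact ⟨by simp, hq0, hq1⟩
    · exact lift2_VE _ _ _ (fun s => (hRL s).1) e he
    · obtain ⟨e', he', rfl⟩ := List.mem_map.mp he
      exact VE_map _ Prod.swap_injective _ (lift2_VE _ _ _ (fun s => sLM.1) e' he')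
  have lT : T.length = 2 * (k' + 3) + 3 + Ut 3 (k' + 3) + (k' + 3) * Ut 3 m := by
    have e1 : (groupsL (k' + 3) LM).length = (k' + 3) * Ut 3 m := by
      simp [groupsL, lift2, tagged, List.length_flatMap, hLM]
    have e2 : (lift2 (tagged (Fin.castLE hM) RL (List.finRange 3))).length
        = Ut 3 (k' + 3) + (k' + 2) + (k' + 2) := by
      have : List.finRange 3 = [0, 1, 2] := by decide
      simp [lift2, tagged, RL, hLK, spread_length, this, add_assoc]
    simp only [T, pre, List.length_append, e1, e2, List.length_map, midL, three,
      List.length_cons, List.length_nil]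
    ring
  -- distribution
  have dT : ∀ h : Fin 3 → Fin (k' + 3) × Fin m, Function.Injective h →
      EV T (fun u => ind (u = h)) (startP hK hM) =
        1 / (((m * (k' + 3) : ℕ)).descFactorial 3 : ℝ) := by
    intro h hh
    simp only [T]
    rw [EV_append]
    rw [EV_congr pre (fun u => Function.Injective u ∧ ∀ i, ((u i).2 : ℕ) < 3) ?_ _
      (fun u => Wv m (fun i => (h i).1) * ind (∀ i, (u i).1 = (h i).1)) ?_ _ ?_]
    · rw [EV_const_mul]
      simp only [pre]
      rw [pre_EV hK hM RL ht hRL, final_alg hK hM p q hpq hpq', d3 _ hn]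
      push_cast; rfl
    · rintro e he u ⟨hu1, hu2⟩
      refine ⟨fun i j hij => hu1 ((Equiv.swap e.1 e.2.1).injective hij), fun i => ?_⟩
      have he3 : (e.1.2 : ℕ) < 3 ∧ (e.2.1.2 : ℕ) < 3 := by
        simp only [pre, List.mem_append] at he
        rcases he with he | he | he
        · obtain ⟨e', he', rfl⟩ := List.mem_map.mp he
          exact ⟨e'.1.2, e'.2.1.2⟩
        · simp only [midL, List.mem_cons, List.not_mem_nil, or_false] at he
          rcases he with rfl | rfl <;> simp
        · simp only [lift2, tagged, List.mem_map, List.mem_flatMap] at he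
          obtain ⟨x, ⟨s, hs, e', he', rfl⟩, rfl⟩ := he
          exact ⟨s.2, s.2⟩
      simp only [Equiv.swap_apply_def]
      split_ifs
      · exact he3.2
      · exact he3.1
      · exact hu2 i
    · rintro u ⟨hu1, hu2⟩
      exact groups_EV hM LM sLM u h hu1 hh hu2
    · exact ⟨startP_inj hK hM, fun i => i.2⟩
  -- transport
  have hcard : Fintype.card (Fin (k' + 3) × Fin m) = Fintype.card (Fin (m * (k' + 3))) := by
    simp [mul_comm]
  let e0 := Fintype.equivOfCardEq hcard
  obtain ⟨π, hπ⟩ := exists_perm (fun i => e0 (startP hK hM i)) (Fin.castLE hn)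
    (e0.injective.comp (startP_inj hK hM)) (Fin.castLE_injective hn)
  let e := e0.trans π
  have he : (Fin.castLE hn : Fin 3 → _) = fun i => e (startP hK hM i) := by
    funext i; exact (hπ i).symm
  rw [← lT]
  apply Nat.sInf_le
  refine ⟨hn, T.map (mapE e), by simp, ?_, ?_⟩
  · intro x hx
    obtain ⟨x', hx', rfl⟩ := List.mem_map.mp hx
    exact VE_map _ e.injective _ (vT x' hx')
  · intro f hf
    rw [placeProb_eq, he, EV_map_inj e e.injective]
    have h1 : ∀ u : Fin 3 → Fin (k' + 3) × Fin m, ind ((fun i => e (u i)) = f) =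
        ind (u = fun i => e.symm (f i)) := by
      intro u; apply ind_congr
      constructor
      · rintro rfl; simp
      · rintro rfl; simp
    simp only [h1]
    rw [dT (fun i => e.symm (f i)) (e.symm.injective.comp hf)]
    have h := Nat.factorial_mul_descFactorial hn
    have h1 : (((m * (k' + 3)).factorial : ℕ) : ℝ) ≠ 0 := by positivity
    rw [← h] at h1 ⊢
    rw [Nat.cast_mul] at h1 ⊢
    have h2 := left_ne_zero_of_mul h1
    have h3 := right_ne_zero_of_mul h1
    field_simp
end rows
end SplitAux

theorem Ut_three_splitting :
    (∀ m k : ℕ, 3 ≤ m → 3 ≤ k → Ut 3 (m * k) ≤ 2 * k + 3 + Ut 3 k + k * Ut 3 m) ∧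
    (∀ k : ℕ, 3 ≤ k → Ut 3 (3 * k) ≤ 5 * k + 3 + Ut 3 k) := by
  refine ⟨fun m k hm hk => main_bound k m hk hm, fun k hk => ?_⟩
  have h1 := main_bound k 3 hk le_rfl
  have h2 := Nat.mul_le_mul_left k Ut33
  omega
end

section
/- For every integer k ≥ 4, U_4(3k) ≤ 4k + 8 + U_4(k) + U_2(k). -/
open scoped BigOperators

namespace LShuf

open Equiv

/-- Expected value of `Φ` at the random permutation produced by `L`. -/
noncomputable def Ex {X : Type*} [DecidableEq X] : List (X × X × ℝ) → (Perm X → ℝ) → ℝ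
  | [], Φ => Φ 1
  | e :: L, Φ => e.2.2 * Ex L (fun ρ => Φ (ρ * swap e.1 e.2.1)) + (1 - e.2.2) * Ex L Φ

/-- Average over a finite type. -/
noncomputable def av {ι : Type*} [Fintype ι] (f : ι → ℝ) : ℝ := (∑ i, f i) / Fintype.card ι

section av
variable {ι κ : Type*} [Fintype ι] [Fintype κ]

lemma av_const [Nonempty ι] (c : ℝ) : av (fun _ : ι => c) = c := by
  simp [av]

lemma av_equiv (e : ι ≃ κ) (f : κ → ℝ) : av (fun i => f (e i)) = av f := by
  simp [av, Equiv.sum_comp e f, Fintype.card_congr e]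

lemma av_comm (f : ι → κ → ℝ) : av (fun i => av (fun j => f i j)) = av (fun j => av (fun i => f i j)) := by
  simp only [av, ← Finset.sum_div]
  rw [Finset.sum_comm]; ring

lemma av_prod (f : ι × κ → ℝ) : av f = av (fun i => av (fun j => f (i, j))) := by
  simp only [av, ← Finset.sum_div, Fintype.sum_prod_type, Fintype.card_prod]
  push_cast
  rw [div_div, mul_comm]

end av

section Ex
variable {X Y : Type*} [DecidableEq X] [DecidableEq Y]

lemma Ex_append (L₁ L₂ : List (X × X × ℝ)) (Φ : Perm X → ℝ) :
    Ex (L₁ ++ L₂) Φ = Ex L₁ (fun ρ₁ => Ex L₂ (fun ρ₂ => Φ (ρ₂ * ρ₁))) := by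
  induction L₁ generalizing Φ with
  | nil => simp [Ex]
  | cons e L ih => simp only [List.cons_append, Ex, ih, mul_assoc]

lemma Ex_map (φ : Perm Y →* Perm X) (ι : Y → X)
    (h : ∀ a b, φ (swap a b) = swap (ι a) (ι b)) (L : List (Y × Y × ℝ)) (Φ : Perm X → ℝ) :
    Ex (L.map (fun e => (ι e.1, ι e.2.1, e.2.2))) Φ = Ex L (fun ρ => Φ (φ ρ)) := by
  induction L generalizing Φ with
  | nil => simp [Ex]
  | cons e L ih => simp only [List.map_cons, Ex, ih, map_mul, h]

lemma Ex_sum {ι : Type*} (s : Finset ι) (L : List (X × X × ℝ)) (f : ι → Perm X → ℝ) :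
    Ex L (fun ρ => ∑ i ∈ s, f i ρ) = ∑ i ∈ s, Ex L (f i) := by
  induction L generalizing f with
  | nil => simp [Ex]
  | cons e L ih => simp only [Ex, ih, Finset.mul_sum, Finset.sum_add_distrib]

lemma Ex_div (c : ℝ) (L : List (X × X × ℝ)) (f : Perm X → ℝ) :
    Ex L (fun ρ => f ρ / c) = Ex L f / c := by
  induction L generalizing f with
  | nil => simp [Ex]
  | cons e L ih => simp only [Ex, ih]; ring

lemma Ex_const (c : ℝ) (L : List (X × X × ℝ)) : Ex L (fun _ => c) = c := by
  induction L with
  | nil => simp [Ex]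
  | cons e L ih => simp only [Ex, ih]; ring

lemma Ex_av {ι : Type*} [Fintype ι] (L : List (X × X × ℝ)) (f : ι → Perm X → ℝ) :
    Ex L (fun ρ => av (fun i => f i ρ)) = av (fun i => Ex L (f i)) := by
  simp only [av, Ex_div, Ex_sum]

/-- The random permutation lies in any subgroup containing the swaps. -/
lemma Ex_congr (H : Subgroup (Perm X)) (L : List (X × X × ℝ))
    (hL : ∀ e ∈ L, swap e.1 e.2.1 ∈ H) (Φ Ψ : Perm X → ℝ) (h : ∀ ρ ∈ H, Φ ρ = Ψ ρ) :
    Ex L Φ = Ex L Ψ := by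
  induction L generalizing Φ Ψ with
  | nil => exact h 1 H.one_mem
  | cons e L ih =>
    simp only [Ex]
    rw [ih (fun e he => hL e (List.mem_cons_of_mem _ he)) Φ Ψ h,
      ih (fun e he => hL e (List.mem_cons_of_mem _ he)) _ (fun ρ => Ψ (ρ * swap e.1 e.2.1))
        (fun ρ hρ => h _ (H.mul_mem hρ (hL e List.mem_cons_self)))]

variable [Fintype X] [Fintype Y]

lemma av_Ex (L : List (X × X × ℝ)) (Φ : Perm X → ℝ) :
    av (fun σ => Ex L (fun ρ => Φ (ρ * σ))) = av Φ := by
  rw [← Ex_av]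
  have : ∀ ρ : Perm X, av (fun σ => Φ (ρ * σ)) = av Φ := fun ρ => av_equiv (Equiv.mulLeft ρ) Φ
  simp only [this, Ex_const]

/-- `L` is uniform as seen from the points of `S`. -/
def Un (S : Set X) (L : List (X × X × ℝ)) : Prop :=
  ∀ Φ : Perm X → ℝ, (∀ σ τ : Perm X, (∀ x ∈ S, σ x = τ x) → Φ σ = Φ τ) → Ex L Φ = av Φ

end Ex

lemma exists_ext {T X : Type*} [Finite X] [DecidableEq X] (f g : T → X)
    (hf : Function.Injective f) (hg : Function.Injective g) : ∃ σ : Perm X, ∀ i, σ (f i) = g i := by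
  classical
  have := Fintype.ofFinite X
  let e : {x // x ∈ Set.range f} ≃ {x // x ∈ Set.range g} :=
    (Equiv.ofInjective f hf).symm.trans (Equiv.ofInjective g hg)
  refine ⟨e.extendSubtype, fun i => ?_⟩
  rw [Equiv.extendSubtype_apply_of_mem e (f i) ⟨i, rfl⟩]
  have : (⟨f i, ⟨i, rfl⟩⟩ : {x // x ∈ Set.range f}) = Equiv.ofInjective f hf i := rfl
  rw [this]; simp [e]

section count
variable {T X : Type*} [Fintype T] [DecidableEq T] [Fintype X] [DecidableEq X]

lemma sum_fib (D : Perm X → ℝ) (f0 : T ↪ X) (F : (T → X) → ℝ) :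
    ∑ σ : Perm X, D σ * F (fun i => σ (f0 i)) =
      ∑ e : T ↪ X, F e * ∑ σ : Perm X, if ∀ i, σ (f0 i) = e i then D σ else 0 := by
  simp only [Finset.mul_sum]
  rw [Finset.sum_comm]
  refine Finset.sum_congr rfl fun σ _ => ?_
  rw [Finset.sum_eq_single (f0.trans σ.toEmbedding)]
  · have : (⇑(f0.trans σ.toEmbedding) : T → X) = fun i => σ (f0 i) := rfl
    simp [this, mul_comm]
  · intro e _ he
    rw [if_neg, mul_zero]
    intro h; apply he; ext i; simp [h]
  · simp

lemma card_ext (f0 e : T ↪ X) :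
    (∑ σ : Perm X, if ∀ i, σ (f0 i) = e i then (1 : ℝ) else 0) * Fintype.card (T ↪ X)
      = Fintype.card (Perm X) := by
  have key : ∀ e' : T ↪ X, (∑ σ : Perm X, if ∀ i, σ (f0 i) = e' i then (1 : ℝ) else 0) =
      ∑ σ : Perm X, if ∀ i, σ (f0 i) = e i then (1 : ℝ) else 0 := by
    intro e'
    obtain ⟨τ, hτ⟩ := exists_ext e' e e'.injective e.injective
    conv_rhs => rw [← Equiv.sum_comp (Equiv.mulLeft τ)]
    refine Finset.sum_congr rfl fun σ _ => ?_
    congr 1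
    simp only [Equiv.coe_mulLeft, Perm.mul_apply, ← hτ, eq_iff_iff, EmbeddingLike.apply_eq_iff_eq]
  have := sum_fib (X := X) (fun _ => 1) f0 (fun _ => (1 : ℝ))
  simp only [key, one_mul, Finset.sum_const, Finset.card_univ, nsmul_eq_mul, mul_one] at this
  rw [this]; ring

lemma av_perm (f0 : T ↪ X) (F : (T → X) → ℝ) :
    av (fun σ : Perm X => F (fun i => σ (f0 i))) = av (fun e : T ↪ X => F e) := by
  have h1 := sum_fib (X := X) (fun _ => 1) f0 F
  have hE : (Fintype.card (T ↪ X) : ℝ) ≠ 0 := by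
    have : Nonempty (T ↪ X) := ⟨f0⟩
    exact_mod_cast Fintype.card_ne_zero
  have hP : (Fintype.card (Perm X) : ℝ) ≠ 0 := by exact_mod_cast Fintype.card_ne_zero
  simp only [one_mul] at h1
  simp only [av]
  rw [h1]
  have : ∀ e : T ↪ X, (∑ σ : Perm X, if ∀ i, σ (f0 i) = e i then (1 : ℝ) else 0) =
      Fintype.card (Perm X) / Fintype.card (T ↪ X) := by
    intro e; rw [eq_div_iff hE]; exact card_ext f0 e
  simp only [this]
  rw [← Finset.sum_mul]
  field_simp
end count

lemma Ex_eq {n : ℕ} (L : List (LazyT n)) (Φ : Perm (Fin n) → ℝ) :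
    Ex L Φ = ∑ σ, permDist L σ * Φ σ := by
  induction L generalizing Φ with
  | nil => simp [Ex, permDist]
  | cons e L ih =>
    simp only [Ex, permDist, ih, add_mul, Finset.sum_add_distrib]
    congr 1
    · rw [Finset.mul_sum, ← Equiv.sum_comp (Equiv.mulRight (swap e.1 e.2.1))]
      refine Finset.sum_congr rfl fun σ _ => ?_
      simp [mul_assoc]
    · rw [Finset.mul_sum]; simp [mul_assoc]

/-- The set of the first `t` positions. -/
def low (n t : ℕ) : Set (Fin n) := {x | (x : ℕ) < t}

lemma dep_low {n t : ℕ} (ht : t ≤ n) (Φ : Perm (Fin n) → ℝ)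
    (h : ∀ σ τ : Perm (Fin n), (∀ x ∈ low n t, σ x = τ x) → Φ σ = Φ τ) :
    ∃ F : (Fin t → Fin n) → ℝ, ∀ σ, Φ σ = F (fun i => σ (Fin.castLEEmb ht i)) := by
  classical
  refine ⟨fun f => if hf : ∃ σ : Perm (Fin n), ∀ i, σ (Fin.castLEEmb ht i) = f i then
    Φ hf.choose else 0, fun σ => ?_⟩
  have hex : ∃ τ : Perm (Fin n), ∀ i, τ (Fin.castLEEmb ht i) = σ (Fin.castLEEmb ht i) :=
    ⟨σ, fun _ => rfl⟩
  simp only [dif_pos hex]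
  apply h
  intro x hx
  have := hex.choose_spec ⟨x, hx⟩
  exact this.symm

lemma fact_ratio {n t : ℕ} (ht : t ≤ n) :
    ((n - t).factorial : ℝ) / (n.factorial : ℝ) = 1 / (Fintype.card (Fin t ↪ Fin n) : ℝ) := by
  rw [Fintype.card_embedding_eq, Fintype.card_fin, Fintype.card_fin]
  have h1 := Nat.factorial_mul_descFactorial ht
  have h2 : ((n - t).factorial : ℝ) ≠ 0 := by exact_mod_cast Nat.factorial_ne_zero _
  have h3 : (n.factorial : ℝ) ≠ 0 := by exact_mod_cast Nat.factorial_ne_zero _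
  have h4 : (n.descFactorial t : ℝ) ≠ 0 := by
    intro h0
    apply h3; rw [← h1]; push_cast; rw [h0, mul_zero]
  rw [div_eq_div_iff h3 h4, ← h1]; push_cast; ring

lemma un_of_tshuffle {n t : ℕ} (ht : t ≤ n) (L : List (LazyT n)) (h : IsTShuffle ht L) :
    Un (low n t) L := by
  intro Φ hΦ
  obtain ⟨F, hF⟩ := dep_low ht Φ hΦ
  have : av Φ = av (fun e : Fin t ↪ Fin n => F e) := by
    rw [← av_perm (Fin.castLEEmb ht) F]; congr 1; funext σ; exact hF σ
  rw [this, Ex_eq]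
  simp only [hF]
  rw [sum_fib]
  simp only [av]
  rw [Finset.sum_div]
  refine Finset.sum_congr rfl fun e _ => ?_
  have h2 := h.2 e e.injective
  rw [fact_ratio ht, placeProb] at h2
  rw [← mul_one_div, ← h2]
  congr 1
  refine Finset.sum_congr rfl fun σ _ => ?_
  simp only [Fin.castLEEmb_apply]

lemma tshuffle_of_un {n t : ℕ} (ht : t ≤ n) (L : List (LazyT n)) (hv : ∀ e ∈ L, e.Valid)
    (h : Un (low n t) L) : IsTShuffle ht L := by
  refine ⟨hv, fun f hf => ?_⟩
  have h1 := h (fun σ => if ∀ i, σ (Fin.castLE ht i) = f i then (1 : ℝ) else 0) (by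
    intro σ τ hst
    have : ∀ i, σ (Fin.castLE ht i) = τ (Fin.castLE ht i) := fun i => hst _ i.2
    simp only [this])
  rw [fact_ratio ht, placeProb]
  have h2 := card_ext (Fin.castLEEmb ht) ⟨f, hf⟩
  have hP : (Fintype.card (Perm (Fin n)) : ℝ) ≠ 0 := by exact_mod_cast Fintype.card_ne_zero
  have hE : (Fintype.card (Fin t ↪ Fin n) : ℝ) ≠ 0 := by
    have : Nonempty (Fin t ↪ Fin n) := ⟨Fin.castLEEmb ht⟩
    exact_mod_cast Fintype.card_ne_zero
  rw [Ex_eq] at h1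
  simp only [mul_ite, mul_one, mul_zero] at h1
  rw [h1, av, div_eq_div_iff hP hE, one_mul, ← h2]
  congr 1
  refine Finset.sum_congr rfl fun σ _ => ?_
  simp only [Fin.castLEEmb_apply, Function.Embedding.coeFn_mk]


section build
variable {X Y : Type*} [DecidableEq X] [DecidableEq Y]

/-- Validity over a general type. -/
def Vl (e : X × X × ℝ) : Prop := e.1 ≠ e.2.1 ∧ 0 ≤ e.2.2 ∧ e.2.2 ≤ 1

/-- Star list spreading the counter at `a` over `a` and the points of `l`. -/
noncomputable def star (a : X) : List X → List (X × X × ℝ)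
  | [] => []
  | i :: l => (a, i, 1 / ((l.length : ℝ) + 2)) :: star a l

lemma star_length (a : X) (l : List X) : (star a l).length = l.length := by
  induction l with
  | nil => rfl
  | cons i l ih => simp [star, ih]

lemma star_valid (a : X) (l : List X) (h : a ∉ l) : ∀ e ∈ star a l, Vl e := by
  induction l with
  | nil => simp [star]
  | cons i l ih =>
    intro e he
    simp only [star, List.mem_cons] at he
    simp only [List.mem_cons, not_or] at h
    rcases he with rfl | he
    · refine ⟨h.1, by positivity, ?_⟩
      simp only
      rw [div_le_one (by positivity)]
      have : (0 : ℝ) ≤ l.length := by positivity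
      linarith
    · exact ih h.2 e he

lemma star_fix (a : X) (l : List X) (i : X) (hi : i ∉ l) (hia : i ≠ a) (g : X → ℝ) :
    Ex (star a l) (fun ρ => g (ρ i)) = g i := by
  induction l with
  | nil => simp [star, Ex]
  | cons j l ih =>
    simp only [List.mem_cons, not_or] at hi
    simp only [star, Ex, Perm.mul_apply, swap_apply_of_ne_of_ne hia hi.1, ih hi.2]
    ring

lemma star_spread (a : X) (l : List X) (h : a ∉ l) (hl : l.Nodup) (g : X → ℝ) :
    Ex (star a l) (fun ρ => g (ρ a)) = (g a + (l.map g).sum) / (l.length + 1) := by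
  induction l with
  | nil => simp [star, Ex]
  | cons j l ih =>
    simp only [List.mem_cons, not_or] at h
    rw [List.nodup_cons] at hl
    simp only [star, Ex, Perm.mul_apply, swap_apply_left, ih h.2 hl.2,
      star_fix a l j hl.1 (Ne.symm h.1)]
    have : (l.length : ℝ) + 1 ≠ 0 := by positivity
    have : (l.length : ℝ) + 2 ≠ 0 := by positivity
    have : (l.length : ℝ) + 1 + 1 ≠ 0 := by positivity
    simp only [List.map_cons, List.sum_cons, List.length_cons]
    push_cast
    field_simp
    ring

/-- Push a list along an embedding. -/
def push (ι : Y ↪ X) (L : List (Y × Y × ℝ)) : List (X × X × ℝ) :=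
  L.map (fun e => (ι e.1, ι e.2.1, e.2.2))

lemma push_length (ι : Y ↪ X) (L : List (Y × Y × ℝ)) : (push ι L).length = L.length := by
  simp [push]

lemma push_valid (ι : Y ↪ X) (L : List (Y × Y × ℝ)) (h : ∀ e ∈ L, Vl e) :
    ∀ e ∈ push ι L, Vl e := by
  intro e he
  simp only [push, List.mem_map] at he
  obtain ⟨e', he', rfl⟩ := he
  obtain ⟨h1, h2⟩ := h e' he'
  exact ⟨fun hh => h1 (ι.injective hh), h2⟩

lemma via_swap (ι : Y ↪ X) (a b : Y) :
    Perm.viaEmbeddingHom ι (swap a b) = swap (ι a) (ι b) := by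
  ext x
  rw [Perm.viaEmbeddingHom_apply]
  by_cases hx : x ∈ Set.range ι
  · obtain ⟨y, rfl⟩ := hx
    rw [Perm.viaEmbedding_apply, ι.injective.map_swap]
  · rw [Perm.viaEmbedding_apply_of_notMem _ _ _ hx, swap_apply_of_ne_of_ne]
    · rintro rfl; exact hx ⟨_, rfl⟩
    · rintro rfl; exact hx ⟨_, rfl⟩

lemma Ex_push (ι : Y ↪ X) (L : List (Y × Y × ℝ)) (Φ : Perm X → ℝ) :
    Ex (push ι L) Φ = Ex L (fun ρ => Φ (ρ.viaEmbedding ι)) :=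
  Ex_map (Perm.viaEmbeddingHom ι) ι (via_swap ι) L Φ

end build

/-- The star list on `Fin (n+1)`. -/
noncomputable def starF (n : ℕ) : List (LazyT (n + 1)) :=
  star (0 : Fin (n + 1)) ((List.finRange n).map Fin.succ)

lemma starF_length (n : ℕ) : (starF n).length = n := by simp [starF, star_length]

lemma starF_valid (n : ℕ) : ∀ e ∈ starF n, Vl e :=
  star_valid _ _ (by simp [Fin.succ_ne_zero])

lemma starF_un (n : ℕ) : Un ({0} : Set (Fin (n + 1))) (starF n) := by
  intro Φ hΦ
  let f0 : Fin 1 ↪ Fin (n + 1) := ⟨fun _ => 0, fun a b _ => Subsingleton.elim a b⟩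
  let g : Fin (n + 1) → ℝ := fun x => Φ (swap 0 x)
  have hg : ∀ σ, Φ σ = g (σ 0) := fun σ => hΦ _ _ (by simp)
  simp only [funext hg]
  rw [starF, star_spread _ _ (by simp [Fin.succ_ne_zero])
    ((List.nodup_finRange n).map (Fin.succ_injective n))]
  have h1 : av (fun σ : Perm (Fin (n + 1)) => g (σ 0)) =
      av (fun e : Fin 1 ↪ Fin (n + 1) => g (e 0)) := av_perm f0 (fun f => g (f 0))
  have h2 : av (fun e : Fin 1 ↪ Fin (n + 1) => g (e 0)) = av g :=
    av_equiv (Equiv.uniqueEmbeddingEquivResult (α := Fin 1) (β := Fin (n + 1))) g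
  rw [h1, h2, av, Fin.sum_univ_succ]
  simp only [List.map_map, List.length_map, List.length_finRange, Fintype.card_fin]
  push_cast
  congr 2

/-- Full shuffle list. -/
noncomputable def full : (n : ℕ) → List (LazyT n)
  | 0 => []
  | n + 1 => push (Fin.succEmb n) (full n) ++ starF n

lemma full_length (n : ℕ) : (full n).length = n.choose 2 := by
  induction n with
  | zero => rfl
  | succ n ih =>
    rw [full, List.length_append, push_length, ih, starF_length, Nat.choose_succ_succ' n 1,
      Nat.choose_one_right, add_comm]

lemma full_valid (n : ℕ) : ∀ e ∈ full n, Vl e := by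
  induction n with
  | zero => simp [full]
  | succ n ih =>
    intro e he
    rw [full, List.mem_append] at he
    rcases he with he | he
    · exact push_valid _ _ ih e he
    · exact starF_valid n e he

lemma full_un (n : ℕ) : ∀ Φ, Ex (full n) Φ = av Φ := by
  induction n with
  | zero =>
    intro Φ
    have : ∀ σ, Φ σ = Φ 1 := fun σ => by congr 1; exact Subsingleton.elim _ _
    rw [full, funext this, av_const]; rfl
  | succ n ih =>
    intro Φ
    rw [full, Ex_append, Ex_push, ih, ← Ex_av, starF_un n]
    · rw [av_comm]
      have : ∀ τ : Perm (Fin (n + 1)), av (fun σ => Φ (σ * τ)) = av Φ :=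
        fun τ => av_equiv (Equiv.mulRight τ) Φ
      simp only [this, av_const]
    · intro σ τ h
      have h0 : σ 0 = τ 0 := h 0 rfl
      -- σ = τ * (τ⁻¹ σ) with τ⁻¹ σ fixing 0
      have hfix : (τ⁻¹ * σ) 0 = 0 := by simp [h0]
      obtain ⟨κ, hκ⟩ : ∃ κ : Perm (Fin n), κ.viaEmbedding (Fin.succEmb n) = τ⁻¹ * σ := by
        obtain ⟨κ, hκ⟩ : ∃ κ : Perm (Fin n), ∀ i, (κ i).succ = (τ⁻¹ * σ) i.succ := by
          obtain ⟨⟨p, e⟩, he⟩ := Equiv.Perm.decomposeFin.symm.surjective (τ⁻¹ * σ)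
          rw [← he] at hfix ⊢
          rw [Equiv.Perm.decomposeFin_symm_apply_zero] at hfix
          subst hfix
          exact ⟨e, fun i => by simp⟩
        refine ⟨κ, Equiv.ext fun x => ?_⟩
        refine Fin.cases ?_ (fun i => ?_) x
        · rw [Perm.viaEmbedding_apply_of_notMem, hfix]
          rintro ⟨y, hy⟩; exact Fin.succ_ne_zero y hy
        · rw [← hκ]; exact Perm.viaEmbedding_apply κ (Fin.succEmb n) i
      conv_rhs => rw [← av_equiv (Equiv.mulLeft κ)]
      congr 1; funext ρ
      congr 1
      have : (κ * ρ).viaEmbedding (Fin.succEmb n) =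
          κ.viaEmbedding (Fin.succEmb n) * ρ.viaEmbedding (Fin.succEmb n) :=
        map_mul (Perm.viaEmbeddingHom (Fin.succEmb n)) κ ρ
      simp only [Equiv.coe_mulLeft, this, hκ]
      group

lemma exists_tshuffle {t n : ℕ} (ht : t ≤ n) :
    ∃ L : List (LazyT n), L.length = Ut t n ∧ IsTShuffle ht L := by
  have hne : { ℓ : ℕ | ∃ (ht : t ≤ n) (L : List (LazyT n)),
      L.length = ℓ ∧ IsTShuffle ht L }.Nonempty :=
    ⟨_, ht, full n, rfl, tshuffle_of_un ht _ (full_valid n) (fun Φ _ => full_un n Φ)⟩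
  obtain ⟨_, L, h1, h2⟩ := Nat.sInf_mem hne
  exact ⟨L, h1, h2⟩


section grid
variable {k : ℕ}

/-- The grid of three rows and `k` columns. -/
abbrev Gr (k : ℕ) := Fin 3 × Fin k

/-- Embedding of a row. -/
def rowE (j : Fin 3) : Fin k ↪ Gr k := ⟨fun x => (j, x), fun a b h => by simpa using h⟩

/-- Embedding of a column. -/
def colE (c : Fin k) : Fin 3 ↪ Gr k := ⟨fun x => (x, c), fun a b h => by simpa using h⟩

lemma via_row (j : Fin 3) (α : Perm (Fin k)) (i : Fin 3) (x : Fin k) :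
    α.viaEmbedding (rowE j) (i, x) = if i = j then (i, α x) else (i, x) := by
  split_ifs with h
  · subst h; exact Perm.viaEmbedding_apply α (rowE i) x
  · apply Perm.viaEmbedding_apply_of_notMem
    rintro ⟨y, hy⟩
    apply h
    exact (congrArg Prod.fst hy).symm

lemma via_col (c : Fin k) (π : Perm (Fin 3)) (i : Fin 3) (x : Fin k) :
    π.viaEmbedding (colE c) (i, x) = if x = c then (π i, x) else (i, x) := by
  split_ifs with h
  · subst h; exact Perm.viaEmbedding_apply π (colE x) i
  · apply Perm.viaEmbedding_apply_of_notMem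
    rintro ⟨y, hy⟩
    apply h
    exact (congrArg Prod.snd hy).symm

/-- Shuffle the columns in the list. -/
noncomputable def cols : List (Fin k) → List (Gr k × Gr k × ℝ)
  | [] => []
  | c :: l => push (colE c) (full 3) ++ cols l

lemma cols_length (l : List (Fin k)) : (cols l).length = 3 * l.length := by
  induction l with
  | nil => rfl
  | cons c l ih =>
    rw [cols, List.length_append, push_length, full_length, ih, List.length_cons]
    simp [Nat.choose]; ring

lemma cols_valid (l : List (Fin k)) : ∀ e ∈ cols l, Vl e := by
  induction l with
  | nil => simp [cols]
  | cons c l ih =>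
    intro e he
    rw [cols, List.mem_append] at he
    rcases he with he | he
    · exact push_valid _ _ (full_valid 3) e he
    · exact ih e he

/-- Apply `π` to the row index in the columns of `l`. -/
def colK (l : List (Fin k)) (π : Perm (Fin 3)) : Perm (Gr k) where
  toFun p := (if p.2 ∈ l then π p.1 else p.1, p.2)
  invFun p := (if p.2 ∈ l then π.symm p.1 else p.1, p.2)
  left_inv p := by
    obtain ⟨i, x⟩ := p
    by_cases h : x ∈ l <;> simp [h]
  right_inv p := by
    obtain ⟨i, x⟩ := p
    by_cases h : x ∈ l <;> simp [h]

lemma cols_inv (l : List (Fin k)) (hl : l.Nodup) (π : Perm (Fin 3)) (Φ : Perm (Gr k) → ℝ) :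
    Ex (cols l) (fun ρ => Φ (ρ * colK l π)) = Ex (cols l) Φ := by
  induction l generalizing Φ with
  | nil =>
    have : colK ([] : List (Fin k)) π = 1 := by ext p <;> simp [colK]
    simp [this]
  | cons c l ih =>
    rw [List.nodup_cons] at hl
    simp only [cols, Ex_append, Ex_push, full_un]
    rw [← av_equiv (Equiv.mulRight π) (fun i : Perm (Fin 3) =>
      Ex (cols l) fun ρ₂ => Φ (ρ₂ * i.viaEmbedding (colE c)))]
    congr 1; funext σ
    have key : σ.viaEmbedding (colE c) * colK (c :: l) π =
        colK l π * (σ * π).viaEmbedding (colE c) := by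
      refine Equiv.ext fun p => ?_
      obtain ⟨i, x⟩ := p
      rw [Perm.mul_apply, Perm.mul_apply, via_col]
      by_cases hx : x = c
      · subst hx
        simp [colK, via_col, hl.1]
      · simp [colK, via_col, hx]
    simp only [mul_assoc, key, Equiv.coe_mulRight]
    rw [← ih hl.2 (fun ρ => Φ (ρ * (σ * π).viaEmbedding (colE c)))]
    simp only [mul_assoc]

/-- Row-wise permutation. -/
def Rw (a : Fin 3 → Perm (Fin k)) : Perm (Gr k) := Equiv.prodShear (Equiv.refl _) a

@[simp] lemma Rw_apply (a : Fin 3 → Perm (Fin k)) (p : Gr k) : Rw a p = (p.1, a p.1 p.2) := rfl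

/-- Global row permutation. -/
def Gl (π : Perm (Fin 3)) : Perm (Gr k) := Equiv.prodCongr π (Equiv.refl _)

@[simp] lemma Gl_apply (π : Perm (Fin 3)) (p : Gr k) : Gl π p = (π p.1, p.2) := rfl

/-- All columns shuffled. -/
noncomputable def allcols (k : ℕ) : List (Gr k × Gr k × ℝ) := cols (List.finRange k)

lemma allcols_inv (π : Perm (Fin 3)) (Φ : Perm (Gr k) → ℝ) :
    Ex (allcols k) (fun ρ => Φ (ρ * Gl π)) = Ex (allcols k) Φ := by
  have : Gl π = colK (List.finRange k) π := by
    refine Equiv.ext fun p => ?_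
    simp [colK]
  rw [this]
  exact cols_inv _ (List.nodup_finRange k) π Φ

/-- Shuffle the rows by the given lists. -/
def rowsL (LA LB LC : List (LazyT k)) : List (Gr k × Gr k × ℝ) :=
  push (rowE 0) LA ++ (push (rowE 1) LB ++ push (rowE 2) LC)

/-- Equivalence of triples with functions. -/
def tripE (M : Type*) : M × M × M ≃ (Fin 3 → M) where
  toFun p := ![p.1, p.2.1, p.2.2]
  invFun a := (a 0, a 1, a 2)
  left_inv p := by simp
  right_inv a := by funext i; fin_cases i <;> rfl

/-- The counters are in the first positions of their rows. -/
def Nice (f : Fin 4 → Gr k) : Prop := ∀ i, (f i).2.val < (![4, 2, 1] : Fin 3 → ℕ) (f i).1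

lemma rows_av (LA LB LC : List (LazyT k)) (hA : Un (low k 4) LA) (hB : Un (low k 2) LB)
    (hC : Un (low k 1) LC) (F : (Fin 4 → Gr k) → ℝ) (f : Fin 4 → Gr k) (hf : Nice f) :
    Ex (rowsL LA LB LC) (fun ρ => F (fun i => ρ (f i))) =
      av (fun a : Fin 3 → Perm (Fin k) => F (fun i => Rw a (f i))) := by
  have key : ∀ α β γ : Perm (Fin k),
      γ.viaEmbedding (rowE 2) * β.viaEmbedding (rowE 1) * α.viaEmbedding (rowE 0) =
        Rw ![α, β, γ] := by
    intro α β γ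
    refine Equiv.ext fun p => ?_
    obtain ⟨i, x⟩ := p
    fin_cases i <;> simp [via_row]
  have cong : ∀ a b : Fin 3 → Perm (Fin k),
      (∀ j, ∀ x ∈ low k ((![4, 2, 1] : Fin 3 → ℕ) j), a j x = b j x) →
      F (fun i => Rw a (f i)) = F (fun i => Rw b (f i)) := by
    intro a b h
    congr 1; funext i
    simp only [Rw_apply]
    rw [h _ _ (hf i)]
  simp only [rowsL, Ex_append, Ex_push, key]
  rw [← av_equiv (tripE _), av_prod]
  simp only [av_prod, tripE, Equiv.coe_fn_mk]
  have h1 : ∀ α β, Ex LC (fun γ => F (fun i => Rw ![α, β, γ] (f i))) =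
      av (fun γ => F (fun i => Rw ![α, β, γ] (f i))) := by
    intro α β
    apply hC
    intro σ τ h
    apply cong
    intro j x hx
    fin_cases j
    · rfl
    · rfl
    · exact h x hx
  simp only [h1]
  have h2 : ∀ α, Ex LB (fun β => av (fun γ => F (fun i => Rw ![α, β, γ] (f i)))) =
      av (fun β => av (fun γ => F (fun i => Rw ![α, β, γ] (f i)))) := by
    intro α
    apply hB
    intro σ τ h
    congr 1; funext γ
    apply cong
    intro j x hx
    fin_cases j
    · rfl
    · exact h x hx
    · rfl
  simp only [h2]
  apply hA
  intro σ τ h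
  congr 1; funext β
  congr 1; funext γ
  apply cong
  intro j x hx
  fin_cases j
  · exact h x hx
  · rfl
  · rfl

/-- Symmetrised value. -/
noncomputable def Q (G : (Fin 4 → Gr k) → ℝ) (f : Fin 4 → Gr k) : ℝ :=
  av (fun τ : Perm (Fin 4) => av (fun a : Fin 3 → Perm (Fin k) => G (fun i => Rw a (f (τ i)))))

lemma Q_right (G : (Fin 4 → Gr k) → ℝ) (f : Fin 4 → Gr k) (τ : Perm (Fin 4)) :
    Q G (fun i => f (τ i)) = Q G f :=
  av_equiv (Equiv.mulLeft τ)
    (fun τ => av (fun a : Fin 3 → Perm (Fin k) => G (fun i => Rw a (f (τ i)))))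

lemma Q_row (G : (Fin 4 → Gr k) → ℝ) (f : Fin 4 → Gr k) (b : Fin 3 → Perm (Fin k)) :
    Q G (fun i => Rw b (f i)) = Q G f := by
  unfold Q
  congr 1; funext τ
  exact av_equiv (Equiv.mulRight b)
    (fun a : Fin 3 → Perm (Fin k) => G (fun i => Rw a (f (τ i))))

lemma Q_gl (G : (Fin 4 → Gr k) → ℝ) (hG : ∀ π f, G (fun i => Gl π (f i)) = G f)
    (f : Fin 4 → Gr k) (π : Perm (Fin 3)) :
    Q G (fun i => Gl π (f i)) = Q G f := by
  unfold Q
  congr 1; funext τ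
  rw [← av_equiv (Equiv.arrowCongr π (Equiv.refl (Perm (Fin k))))]
  congr 1; funext a
  rw [← hG π (fun i => Rw a (f (τ i)))]
  congr 1; funext i
  simp

lemma Q_type (G : (Fin 4 → Gr k) → ℝ) (hG : ∀ π f, G (fun i => Gl π (f i)) = G f)
    (f g : Fin 4 → Gr k) (hf : Function.Injective f) (hg : Function.Injective g)
    (π : Perm (Fin 3)) (τ : Perm (Fin 4)) (h : ∀ i, (g i).1 = π (f (τ i)).1) :
    Q G g = Q G f := by
  rw [← Q_right G f τ, ← Q_gl G hG (fun i => f (τ i)) π]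
  have hb : ∀ j : Fin 3, ∃ b : Perm (Fin k), ∀ i : {i // (g i).1 = j},
      b (f (τ i)).2 = (g i).2 := by
    intro j
    apply exists_ext (fun i : {i // (g i).1 = j} => (f (τ i)).2) (fun i => (g i).2)
    · rintro ⟨i, hi⟩ ⟨i', hi'⟩ hh
      simp only at hh
      rw [h] at hi hi'
      have := hf (Prod.ext (π.injective (hi.trans hi'.symm)) hh)
      exact Subtype.ext (τ.injective this)
    · rintro ⟨i, hi⟩ ⟨i', hi'⟩ hh
      exact Subtype.ext (hg (Prod.ext (hi.trans hi'.symm) hh))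
  choose b hb using hb
  rw [← Q_row G (fun i => Gl π (f (τ i))) b]
  congr 1; funext i
  refine Prod.ext (h i) ?_
  simp only [Rw_apply, Gl_apply]
  rw [← h i]
  exact (hb _ ⟨i, rfl⟩).symm

lemma card_rowfib (r : Fin 4 → Fin 3) :
    (Finset.univ.filter (fun e : Fin 4 ↪ Gr k => (fun i => (e i).1) = r)).card =
      ∏ j, k.descFactorial (Finset.univ.filter (fun i => r i = j)).card := by
  have e : {e : Fin 4 ↪ Gr k // (fun i => (e i).1) = r} ≃ (∀ j : Fin 3, {i // r i = j} ↪ Fin k) :=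
    { toFun := fun e j => ⟨fun i => (e.1 i).2, by
        rintro ⟨i, hi⟩ ⟨i', hi'⟩ hh
        have h1 : (e.1 i).1 = j := (congrFun e.2 i).trans hi
        have h2 : (e.1 i').1 = j := (congrFun e.2 i').trans hi'
        exact Subtype.ext (e.1.injective (Prod.ext (h1.trans h2.symm) hh))⟩
      invFun := fun b => ⟨⟨fun i => (r i, b (r i) ⟨i, rfl⟩), by
        intro i i' hh
        have h1 : r i = r i' := congrArg Prod.fst hh
        have h2 : b (r i) ⟨i, rfl⟩ = b (r i') ⟨i', rfl⟩ := congrArg Prod.snd hh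
        have h3 : b (r i') ⟨i', rfl⟩ = b (r i) ⟨i', h1.symm⟩ := by
          have : ∀ j (hj : r i' = j), b (r i') ⟨i', rfl⟩ = b j ⟨i', hj⟩ := by
            rintro j rfl; rfl
          exact this _ h1.symm
        exact congrArg Subtype.val ((b (r i)).injective (h2.trans h3))⟩, rfl⟩
      left_inv := by
        rintro ⟨e, rfl⟩
        rfl
      right_inv := by
        intro b
        funext j
        ext ⟨i, hi⟩
        subst hi
        rfl }
  rw [← Fintype.card_subtype, Fintype.card_congr e, Fintype.card_pi]
  refine Finset.prod_congr rfl fun j _ => ?_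
  rw [Fintype.card_embedding_eq, Fintype.card_fin, Fintype.card_subtype]

end grid


lemma quad_split (v q : ℝ) (hv : 0 ≤ v) (hv1 : v ≤ 1) (hq : 0 ≤ q)
    (h : v / (7 / 5) + 2 * q ≤ 21 / 40) :
    ∃ x y : ℝ, 0 ≤ x ∧ x ≤ 1 ∧ 0 ≤ y ∧ y ≤ 1 ∧ x * y = v ∧ (1 - x) * (1 - y) = q := by
  set a := Real.sqrt v with ha
  set b := Real.sqrt q with hb
  have ha2 : a ^ 2 = v := Real.sq_sqrt hv
  have hb2 : b ^ 2 = q := Real.sq_sqrt hq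
  have ha0 : 0 ≤ a := Real.sqrt_nonneg _
  have hb0 : 0 ≤ b := Real.sqrt_nonneg _
  have hab : a + b ≤ 1 := by
    nlinarith [sq_nonneg (a - 7 / 10), sq_nonneg (b - 1 / 4)]
  have hs : 2 * a ≤ 1 + v - q := by nlinarith
  have hd : 0 ≤ (1 + v - q) ^ 2 - 4 * v := by nlinarith
  set d := Real.sqrt ((1 + v - q) ^ 2 - 4 * v) with hdd
  have hd2 : d ^ 2 = (1 + v - q) ^ 2 - 4 * v := Real.sq_sqrt hd
  have hd0 : 0 ≤ d := Real.sqrt_nonneg _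
  have hd3 : d ≤ 1 + v - q := by
    apply le_of_sq_le_sq _ (by linarith)
    rw [hd2]; linarith
  have hd4 : d ≤ 1 - v + q := by
    apply le_of_sq_le_sq _ (by linarith)
    rw [hd2]; nlinarith
  refine ⟨(1 + v - q - d) / 2, (1 + v - q + d) / 2, ?_, ?_, ?_, ?_, ?_, ?_⟩
  · linarith
  · linarith
  · linarith
  · linarith
  · nlinarith
  · nlinarith

lemma params (n : ℕ) : ∃ x y z : ℝ, 0 ≤ x ∧ x ≤ 1 ∧ 0 ≤ y ∧ y ≤ 1 ∧ 0 ≤ z ∧ z ≤ 1 ∧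
    3 * (3 * (n + 4 : ℝ) - 1) * (3 * (n + 4 : ℝ) - 2) * ((1 - x) * (1 - y) * (1 - z)) =
      ((n : ℝ) + 2) * (n + 1) ∧
    (3 * (n + 4 : ℝ) - 1) * (3 * (n + 4 : ℝ) - 2) * (x * y * (1 - z)) =
      2 * (n + 4) * (n + 3) ∧
    (3 * (n + 4 : ℝ) - 1) * (3 * (n + 4 : ℝ) - 2) * (z * (1 - (1 - x) * (1 - y))) =
      4 * (n + 4) ^ 2 := by
  have hn : (0 : ℝ) ≤ n := by positivity
  generalize (n : ℝ) = u at hn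
  set m := (3 * (u + 4) - 1) * (3 * (u + 4) - 2) with hm
  have hm' : m = 9 * u ^ 2 + 63 * u + 110 := by rw [hm]; ring
  have hm0 : 0 < m := by rw [hm']; positivity
  set P4 := (u + 2) * (u + 1) / (3 * m) with hP4
  set P22 := 2 * (u + 4) * (u + 3) / m with hP22
  set P211 := 4 * (u + 4) ^ 2 / m with hP211
  set S := 1 + P4 - P211 with hS
  have hP4' : 3 * m * P4 = (u + 2) * (u + 1) := by rw [hP4]; field_simp
  have hP22' : m * P22 = 2 * (u + 4) * (u + 3) := by rw [hP22]; field_simp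
  have hP211' : m * P211 = 4 * (u + 4) ^ 2 := by rw [hP211]; field_simp
  have hS' : 3 * m * S = 4 * (2 * u + 7) * (2 * u + 5) := by
    have : 3 * m * S = 3 * m + 3 * m * P4 - 3 * (m * P211) := by rw [hS]; ring
    rw [this, hP4', hP211', hm']; ring
  have hP4n : 0 ≤ P4 := by rw [hP4]; positivity
  have hP22n : 0 ≤ P22 := by rw [hP22]; positivity
  have hSpos : 0 < S := by
    have : 0 < 3 * m * S := by rw [hS']; positivity
    exact pos_of_mul_pos_right this (by positivity)
  have hS1 : S ≤ 1 := by
    have : 3 * m * S ≤ 3 * m * 1 := by rw [hS', hm']; nlinarith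
    exact le_of_mul_le_mul_left this (by positivity)
  have hlow : P4 ≤ 5 / 36 * S ^ 2 := by
    have : (3 * m) ^ 2 * P4 ≤ (3 * m) ^ 2 * (5 / 36 * S ^ 2) := by
      have e1 : (3 * m) ^ 2 * P4 = 3 * m * ((u + 2) * (u + 1)) := by rw [← hP4']; ring
      have e2 : (3 * m) ^ 2 * (5 / 36 * S ^ 2) = 5 / 36 * (4 * (2 * u + 7) * (2 * u + 5)) ^ 2 := by
        rw [← hS']; ring
      rw [e1, e2, hm', ← sub_nonneg]
      ring_nf
      positivity
    exact le_of_mul_le_mul_left this (by positivity)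
  have hlin : 6 / 5 * (P22 / (7 / 5) + 2 * P4) ≤ 21 / 40 * S := by
    have : (3 * m) * (6 / 5 * (P22 / (7 / 5) + 2 * P4)) ≤ (3 * m) * (21 / 40 * S) := by
      have e1 : (3 * m) * (6 / 5 * (P22 / (7 / 5) + 2 * P4)) =
          6 / 5 * (3 * (m * P22) / (7 / 5) + 2 * (3 * m * P4)) := by ring
      have e2 : (3 * m) * (21 / 40 * S) = 21 / 40 * (3 * m * S) := by ring
      rw [e1, e2, hP22', hP4', hS', ← sub_nonneg]
      ring_nf
      positivity
    exact le_of_mul_le_mul_left this (by positivity)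
  -- solve for `r = 1 - z`
  have hD : 0 ≤ S ^ 2 - 4 * P4 := by nlinarith [sq_nonneg S]
  set d := Real.sqrt (S ^ 2 - 4 * P4) with hd
  have hd2 : d ^ 2 = S ^ 2 - 4 * P4 := Real.sq_sqrt hD
  have hd0 : 0 ≤ d := Real.sqrt_nonneg _
  have hdS : d ≤ S := by
    apply le_of_sq_le_sq _ hSpos.le
    rw [hd2]; linarith
  have hdl : 2 / 3 * S ≤ d := by
    apply le_of_sq_le_sq _ hd0
    rw [hd2]; nlinarith
  set r := (S + d) / 2 with hr
  set q := (S - d) / 2 with hq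
  have hr0 : 5 / 6 * S ≤ r := by rw [hr]; linarith
  have hrpos : 0 < r := by linarith
  have hr1 : r ≤ 1 := by rw [hr]; linarith
  have hqr : q * r = P4 := by rw [hq, hr]; nlinarith
  have hqr2 : q + r = S := by rw [hq, hr]; ring
  have hq0 : 0 ≤ q := by rw [hq]; linarith
  set v := P22 / r with hv
  have hvr : v * r = P22 := by rw [hv]; field_simp
  have hv0 : 0 ≤ v := by rw [hv]; positivity
  have hcomb : v / (7 / 5) + 2 * q ≤ 21 / 40 := by
    have : r * (v / (7 / 5) + 2 * q) ≤ r * (21 / 40) := by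
      have e1 : r * (v / (7 / 5) + 2 * q) = P22 / (7 / 5) + 2 * P4 := by
        rw [← hvr, ← hqr]; ring
      rw [e1]; linarith
    exact le_of_mul_le_mul_left this hrpos
  obtain ⟨x, y, hx0, hx1, hy0, hy1, hxy, hxyq⟩ := quad_split v q hv0 (by linarith) hq0 hcomb
  refine ⟨x, y, 1 - r, hx0, hx1, hy0, hy1, by linarith, by linarith, ?_, ?_, ?_⟩
  · rw [hxyq, ← hP4', ← hqr, hm]; ring
  · rw [hxy, ← hP22', ← hvr]; ring
  · rw [hxyq, ← hP211']
    have : P211 = (1 - r) * (1 - q) := by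
      have : P211 = 1 + P4 - S := by rw [hS]; ring
      rw [this, ← hqr, ← hqr2]; ring
    rw [this]

/-- Representatives of the types. -/
def rep : Fin 4 → Fin 4 → Fin 3 := ![![0, 0, 0, 0], ![0, 0, 0, 1], ![0, 0, 1, 1], ![0, 0, 1, 2]]

/-- Number of counters in row `j`. -/
def cnt (r : Fin 4 → Fin 3) (j : Fin 3) : ℕ := (Finset.univ.filter (fun i => r i = j)).card

/-- Type of a row assignment. -/
def ty (r : Fin 4 → Fin 3) : Fin 4 :=
  let m := max (cnt r 0) (max (cnt r 1) (cnt r 2))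
  if m = 4 then 0 else if m = 3 then 1
    else if cnt r 0 = 1 ∨ cnt r 1 = 1 ∨ cnt r 2 = 1 then 3 else 2

set_option maxRecDepth 100000 in
lemma ty_cards : ∀ t : Fin 4, (Finset.univ.filter (fun r => ty r = t)).card =
    (![3, 24, 18, 36] : Fin 4 → ℕ) t := by decide +kernel

set_option maxRecDepth 100000 in
lemma ty_cnt : ∀ r : Fin 4 → Fin 3, ∃ π : Perm (Fin 3),
    ∀ j, cnt r j = cnt (rep (ty r)) (π j) := by decide +kernel

lemma ty_class (r : Fin 4 → Fin 3) : ∃ π : Perm (Fin 3), ∃ τ : Perm (Fin 4),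
    ∀ i, r i = π (rep (ty r) (τ i)) := by
  obtain ⟨π, hπ⟩ := ty_cnt r
  have he : ∀ j, Nonempty ({i // π (r i) = j} ≃ {i // rep (ty r) i = j}) := by
    intro j
    rw [← Fintype.card_eq, Fintype.card_subtype, Fintype.card_subtype]
    have h := hπ (π.symm j)
    rw [Equiv.apply_symm_apply] at h
    simp only [cnt, Equiv.eq_symm_apply] at h
    exact h
  refine ⟨π.symm, Equiv.ofFiberEquiv (fun j => (he j).some), fun i => ?_⟩
  rw [Equiv.ofFiberEquiv_map (g := rep (ty r)), Equiv.symm_apply_apply]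

lemma sum_ty (D : ℕ → ℕ) (h : Fin 4 → ℝ) :
    ∑ r : Fin 4 → Fin 3, ((∏ j, D (cnt r j) : ℕ) : ℝ) * h (ty r) =
      3 * (D 4 * D 0 * D 0) * h 0 + 24 * (D 3 * D 1 * D 0) * h 1 +
      18 * (D 2 * D 2 * D 0) * h 2 + 36 * (D 2 * D 1 * D 1) * h 3 := by
  have h1 : ∀ r, (∏ j, D (cnt r j)) = ∏ j, D (cnt (rep (ty r)) j) := by
    intro r
    obtain ⟨π, hπ⟩ := ty_cnt r
    simp only [hπ]
    exact Equiv.prod_comp π (fun j => D (cnt (rep (ty r)) j))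
  rw [Finset.sum_congr rfl (fun r _ => by rw [h1 r])]
  rw [← Finset.sum_fiberwise (s := Finset.univ) (g := ty)]
  have h2 : ∀ t : Fin 4, ∑ r ∈ Finset.univ.filter (fun r => ty r = t),
      ((∏ j, D (cnt (rep (ty r)) j) : ℕ) : ℝ) * h (ty r) =
      ((![3, 24, 18, 36] : Fin 4 → ℕ) t : ℝ) * (((∏ j, D (cnt (rep t) j) : ℕ) : ℝ) * h t) := by
    intro t
    rw [← ty_cards t, ← nsmul_eq_mul, ← Finset.sum_const]
    refine Finset.sum_congr rfl fun r hr => ?_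
    rw [(Finset.mem_filter.1 hr).2]
  simp only [h2]
  have c : ∀ t j, cnt (rep t) j = (![![4, 0, 0], ![3, 1, 0], ![2, 2, 0], ![2, 1, 1]] :
      Fin 4 → Fin 3 → ℕ) t j := by decide
  simp only [c, Fin.sum_univ_four, Fin.prod_univ_three]
  simp
  ring


section main
variable {n : ℕ}

/-- Column `i` for `i < 4`. -/
def cc (i : Fin 4) : Fin (n + 4) := Fin.castLE (by omega) i

lemma cc_inj {i j : Fin 4} : (cc i : Fin (n + 4)) = cc j ↔ i = j :=
  (Fin.castLE_injective _).eq_iff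

/-- Initial placement. -/
def f0 : Fin 4 ↪ Gr (n + 4) := ⟨fun i => (0, cc i), fun a b h => by
  simpa [cc_inj] using h⟩

lemma f0_apply (i : Fin 4) : f0 (n := n) i = (0, cc i) := rfl

/-- The three splitting lazy transpositions. -/
def init3 (x y z : ℝ) : List (Gr (n + 4) × Gr (n + 4) × ℝ) :=
  [((0, cc 0), (1, cc 0), x), ((0, cc 1), (1, cc 1), y), ((0, cc 2), (2, cc 0), z)]

/-- The full list on the grid. -/
noncomputable def grand (LA LB LC : List (LazyT (n + 4))) (x y z : ℝ) :
    List (Gr (n + 4) × Gr (n + 4) × ℝ) :=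
  push f0 (full 4) ++ (init3 x y z ++ (rowsL LA LB LC ++ allcols (n + 4)))

/-- Explicit placement after splitting. -/
def pl (a b c : Prop) [Decidable a] [Decidable b] [Decidable c] : Fin 4 → Gr (n + 4) :=
  ![if a then (1, cc 0) else (0, cc 0), if b then (1, cc 1) else (0, cc 1),
    if c then (2, cc 0) else (0, cc 2), (0, cc 3)]

lemma init3_eval (x y z : ℝ) (W : (Fin 4 → Gr (n + 4)) → ℝ) :
    Ex (init3 x y z) (fun ρ => W (fun i => ρ (f0 i))) =
      (1 - x) * ((1 - y) * ((1 - z) * W (pl False False False) + z * W (pl False False True)) +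
        y * ((1 - z) * W (pl False True False) + z * W (pl False True True))) +
      x * ((1 - y) * ((1 - z) * W (pl True False False) + z * W (pl True False True)) +
        y * ((1 - z) * W (pl True True False) + z * W (pl True True True))) := by
  simp only [init3, Ex]
  have e : ∀ (ρ : Perm (Gr (n + 4))) (w : Fin 4 → Gr (n + 4)), (∀ i, ρ (f0 i) = w i) →
      (fun i => ρ (f0 i)) = w := fun ρ w h => funext h
  rw [e _ (pl True True True) ?_, e _ (pl True True False) ?_, e _ (pl True False True) ?_,
    e _ (pl True False False) ?_, e _ (pl False True True) ?_, e _ (pl False True False) ?_,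
    e _ (pl False False True) ?_, e _ (pl False False False) ?_]
  · ring
  all_goals
    intro i
    fin_cases i <;> simp [f0_apply, pl, swap_apply_def, cc_inj]

lemma pl_nice (a b c : Prop) [Decidable a] [Decidable b] [Decidable c] :
    Nice (pl (n := n) a b c) := by
  intro i
  by_cases ha : a <;> by_cases hb : b <;> by_cases hc : c <;>
  fin_cases i <;> simp [pl, cc, ha, hb, hc]

lemma pl_inj (a b c : Prop) [Decidable a] [Decidable b] [Decidable c] :
    Function.Injective (pl (n := n) a b c) := by
  intro i j
  by_cases ha : a <;> by_cases hb : b <;> by_cases hc : c <;>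
  fin_cases i <;> fin_cases j <;> simp [pl, cc_inj, ha, hb, hc]

/-- Canonical placement with given rows. -/
def can (r : Fin 4 → Fin 3) : Fin 4 → Gr (n + 4) := fun i => (r i, cc i)

lemma can_inj (r : Fin 4 → Fin 3) : Function.Injective (can (n := n) r) := by
  intro i j h
  exact cc_inj.1 (congrArg Prod.snd h)

lemma Q_ty (G : (Fin 4 → Gr (n + 4)) → ℝ) (hG : ∀ π f, G (fun i => Gl π (f i)) = G f)
    (f : Fin 4 → Gr (n + 4)) (hf : Function.Injective f) :
    Q G f = Q G (can (rep (ty (fun i => (f i).1)))) := by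
  obtain ⟨π, τ, h⟩ := ty_class (fun i => (f i).1)
  exact Q_type G hG _ f (can_inj _) hf π τ h

lemma Q_pl (G : (Fin 4 → Gr (n + 4)) → ℝ) (hG : ∀ π f, G (fun i => Gl π (f i)) = G f)
    (a b c : Prop) [Decidable a] [Decidable b] [Decidable c] :
    Q G (pl a b c) = Q G (can (rep (ty ![if a then 1 else 0, if b then 1 else 0,
      if c then 2 else 0, 0]))) := by
  rw [Q_ty G hG _ (pl_inj a b c)]
  congr 4
  funext i
  by_cases ha : a <;> by_cases hb : b <;> by_cases hc : c <;>
  fin_cases i <;> simp [pl, ha, hb, hc]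

lemma av_Q (G : (Fin 4 → Gr (n + 4)) → ℝ) :
    av (fun e : Fin 4 ↪ Gr (n + 4) => Q G e) = av (fun e : Fin 4 ↪ Gr (n + 4) => G e) := by
  unfold Q
  rw [av_comm]
  have : ∀ (τ : Perm (Fin 4)), av (fun e : Fin 4 ↪ Gr (n + 4) =>
      av (fun a : Fin 3 → Perm (Fin (n + 4)) => G (fun i => Rw a (e (τ i))))) =
      av (fun e : Fin 4 ↪ Gr (n + 4) => G e) := by
    intro τ
    rw [av_comm]
    have : ∀ a : Fin 3 → Perm (Fin (n + 4)),
        av (fun e : Fin 4 ↪ Gr (n + 4) => G (fun i => Rw a (e (τ i)))) =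
        av (fun e : Fin 4 ↪ Gr (n + 4) => G e) := by
      intro a
      exact av_equiv (Equiv.embeddingCongr τ.symm (Rw a)) (fun e : Fin 4 ↪ Gr (n + 4) => G e)
    simp only [this, av_const]
  simp only [this, av_const]

lemma av_types (G : (Fin 4 → Gr (n + 4)) → ℝ) (hG : ∀ π f, G (fun i => Gl π (f i)) = G f) :
    av (fun e : Fin 4 ↪ Gr (n + 4) => G e) =
      (∑ r : Fin 4 → Fin 3, ((∏ j, (n + 4).descFactorial (cnt r j) : ℕ) : ℝ) *
        Q G (can (rep (ty r)))) / ((3 * (n + 4)).descFactorial 4 : ℕ) := by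
  rw [← av_Q, av, Fintype.card_embedding_eq, Fintype.card_prod, Fintype.card_fin,
    Fintype.card_fin, Fintype.card_fin]
  congr 1
  rw [← Finset.sum_fiberwise (s := Finset.univ)
    (g := fun e : Fin 4 ↪ Gr (n + 4) => (fun i => (e i).1))]
  refine Finset.sum_congr rfl fun r _ => ?_
  have := card_rowfib (k := n + 4) r
  simp only [cnt]
  rw [← this, ← nsmul_eq_mul, ← Finset.sum_const]
  refine Finset.sum_congr rfl fun e he => ?_
  rw [Q_ty G hG e e.injective, (Finset.mem_filter.1 he).2]

lemma grand_un (LA LB LC : List (LazyT (n + 4))) (hA : Un (low (n + 4) 4) LA)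
    (hB : Un (low (n + 4) 2) LB) (hC : Un (low (n + 4) 1) LC) (x y z : ℝ)
    (h1 : 3 * (3 * (n + 4 : ℝ) - 1) * (3 * (n + 4 : ℝ) - 2) * ((1 - x) * (1 - y) * (1 - z)) =
      ((n : ℝ) + 2) * (n + 1))
    (h2 : (3 * (n + 4 : ℝ) - 1) * (3 * (n + 4 : ℝ) - 2) * (x * y * (1 - z)) =
      2 * (n + 4) * (n + 3))
    (h3 : (3 * (n + 4 : ℝ) - 1) * (3 * (n + 4 : ℝ) - 2) * (z * (1 - (1 - x) * (1 - y))) =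
      4 * (n + 4) ^ 2) (F : (Fin 4 → Gr (n + 4)) → ℝ) :
    Ex (grand LA LB LC x y z) (fun ρ => F (fun i => ρ (f0 i))) =
      av (fun σ : Perm (Gr (n + 4)) => F (fun i => σ (f0 i))) := by
  set G : (Fin 4 → Gr (n + 4)) → ℝ := fun f => Ex (allcols (n + 4)) (fun ρ => F (fun i => ρ (f i)))
    with hGdef
  have hG : ∀ π f, G (fun i => Gl π (f i)) = G f := fun π f =>
    allcols_inv π (fun ρ => F (fun i => ρ (f i)))
  have hR : av (fun σ : Perm (Gr (n + 4)) => F (fun i => σ (f0 i))) =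
      av (fun e : Fin 4 ↪ Gr (n + 4) => G e) := by
    rw [← av_perm f0 G, ← av_Ex (allcols (n + 4))]
    rfl
  have hL : Ex (grand LA LB LC x y z) (fun ρ => F (fun i => ρ (f0 i))) =
      Ex (init3 x y z) (fun ρ => (fun f => av (fun τ : Perm (Fin 4) =>
        Ex (rowsL LA LB LC) (fun ρ' => G (fun i => ρ' (f (τ i)))))) (fun i => ρ (f0 i))) := by
    simp only [grand, Ex_append, Ex_push, full_un]
    rw [Ex_av]
    congr 1; funext τ
    congr 1; funext ρ
    congr 1; funext ρ'
    simp only [hGdef, Perm.mul_apply, Perm.viaEmbedding_apply]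
  have hN : ∀ f : Fin 4 → Gr (n + 4), Nice f → av (fun τ : Perm (Fin 4) =>
        Ex (rowsL LA LB LC) (fun ρ' => G (fun i => ρ' (f (τ i))))) = Q G f := by
    intro f hf
    unfold Q
    congr 1; funext τ
    exact rows_av LA LB LC hA hB hC G (fun i => f (τ i)) (fun i => hf (τ i))
  have hL2 := hL.trans (init3_eval x y z (fun f => av (fun τ : Perm (Fin 4) =>
        Ex (rowsL LA LB LC) (fun ρ' => G (fun i => ρ' (f (τ i)))))))
  rw [hL2, hR]
  simp only [hN _ (pl_nice _ _ _), Q_pl G hG]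
  rw [av_types G hG, sum_ty (n + 4).descFactorial (fun t => Q G (can (rep t)))]
  have t0 : ty ![0, 0, 0, 0] = 0 := by decide
  have t1 : ty ![0, 0, 2, 0] = 1 := by decide
  have t2 : ty ![0, 1, 0, 0] = 1 := by decide
  have t3 : ty ![1, 0, 0, 0] = 1 := by decide
  have t4 : ty ![1, 1, 0, 0] = 2 := by decide
  have t5 : ty ![1, 1, 2, 0] = 3 := by decide
  have t6 : ty ![1, 0, 2, 0] = 3 := by decide
  have t7 : ty ![0, 1, 2, 0] = 3 := by decide
  simp only [if_true, if_false, t0, t1, t2, t3, t4, t5, t6, t7]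
  generalize Q G (can (rep 0)) = a0
  generalize Q G (can (rep 1)) = a1
  generalize Q G (can (rep 2)) = a2
  generalize Q G (can (rep 3)) = a3
  have d0 : (n + 4).descFactorial 0 = 1 := rfl
  have d1 : (n + 4).descFactorial 1 = n + 4 := by simp
  have d2 : (n + 4).descFactorial 2 = (n + 3) * (n + 4) := by simp [Nat.descFactorial]
  have d3 : (n + 4).descFactorial 3 = (n + 2) * ((n + 3) * (n + 4)) := by simp [Nat.descFactorial]
  have d4 : (n + 4).descFactorial 4 = (n + 1) * ((n + 2) * ((n + 3) * (n + 4))) := by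
    simp [Nat.descFactorial]
  have d5 : (3 * (n + 4)).descFactorial 4 =
      (3 * n + 9) * ((3 * n + 10) * ((3 * n + 11) * (3 * n + 12))) := by
    rw [show 3 * (n + 4) = 3 * n + 12 by ring]
    simp [Nat.descFactorial]
  rw [d0, d1, d2, d3, d4, d5]
  push_cast
  have hn : (0 : ℝ) ≤ n := by positivity
  generalize (n : ℝ) = u at *
  rw [eq_div_iff (by positivity)]
  set A := (1 - x) * (1 - y) * (1 - z) with hA'
  set B := x * y * (1 - z) with hB'
  set C := z * (1 - (1 - x) * (1 - y)) with hC'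
  have key : (1 - x) * ((1 - y) * ((1 - z) * a0 + z * a1) + y * ((1 - z) * a1 + z * a3)) +
      x * ((1 - y) * ((1 - z) * a1 + z * a3) + y * ((1 - z) * a2 + z * a3)) =
      A * (a0 - a1) + B * (a2 - a1) + C * (a3 - a1) + a1 := by
    rw [hA', hB', hC']; ring
  rw [key]
  linear_combination (3 * (u + 3) * (u + 4) * (a0 - a1)) * h1 +
    (9 * (u + 3) * (u + 4) * (a2 - a1)) * h2 + (9 * (u + 3) * (u + 4) * (a3 - a1)) * h3

lemma init3_valid (x y z : ℝ) (hx0 : 0 ≤ x) (hx1 : x ≤ 1) (hy0 : 0 ≤ y) (hy1 : y ≤ 1)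
    (hz0 : 0 ≤ z) (hz1 : z ≤ 1) : ∀ e ∈ init3 (n := n) x y z, Vl e := by
  intro e he
  simp only [init3, List.mem_cons, List.not_mem_nil, or_false] at he
  rcases he with rfl | rfl | rfl
  · exact ⟨by simp, hx0, hx1⟩
  · exact ⟨by simp, hy0, hy1⟩
  · exact ⟨by simp, hz0, hz1⟩

end main

end LShuf

open LShuf

theorem Ut_four_three_groups (k : ℕ) (hk : 4 ≤ k) :
    Ut 4 (3 * k) ≤ 4 * k + 8 + Ut 4 k + Ut 2 k := by
  obtain ⟨n, rfl⟩ : ∃ n, k = n + 4 := ⟨k - 4, by omega⟩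
  obtain ⟨LA, hAl, hAs⟩ := exists_tshuffle (t := 4) (n := n + 4) hk
  obtain ⟨LB, hBl, hBs⟩ := exists_tshuffle (t := 2) (n := n + 4) (by omega)
  have hC : Un (low (n + 4) 1) (starF (n + 3)) := by
    have h : low (n + 4) 1 = {(0 : Fin (n + 4))} := by
      ext x
      rw [Set.mem_singleton_iff, Fin.ext_iff]
      change x.val < 1 ↔ x.val = 0
      exact Nat.lt_one_iff
    rw [h]; exact starF_un (n + 3)
  obtain ⟨x, y, z, hx0, hx1, hy0, hy1, hz0, hz1, h1, h2, h3⟩ := params n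
  let e : Gr (n + 4) ≃ Fin (3 * (n + 4)) := finProdFinEquiv
  let g := grand LA LB (starF (n + 3)) x y z
  have hgv : ∀ e ∈ g, Vl e := by
    intro e he
    simp only [g, grand, rowsL, allcols, List.mem_append] at he
    rcases he with he | he | (he | he | he) | he
    · exact push_valid _ _ (full_valid 4) e he
    · exact init3_valid x y z hx0 hx1 hy0 hy1 hz0 hz1 e he
    · exact push_valid _ _ hAs.1 e he
    · exact push_valid _ _ hBs.1 e he
    · exact push_valid _ _ (starF_valid (n + 3)) e he
    · exact cols_valid _ e he
  have ht : 4 ≤ 3 * (n + 4) := by omega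
  have hlen : (push e.toEmbedding g).length =
      4 * (n + 4) + 8 + Ut 4 (n + 4) + Ut 2 (n + 4) := by
    have c4 : Nat.choose 4 2 = 6 := rfl
    simp only [g, grand, rowsL, allcols, push_length, List.length_append, cols_length,
      full_length, starF_length, init3, List.length_cons, List.length_nil,
      List.length_finRange, hAl, hBl, c4]
    omega
  rw [← hlen]
  refine Nat.sInf_le ⟨ht, _, rfl, tshuffle_of_un ht _ (push_valid _ _ hgv) ?_⟩
  intro Φ hΦ
  obtain ⟨F, hF⟩ := dep_low ht Φ hΦ
  have hpt : ∀ i : Fin 4, Fin.castLEEmb ht i = e (f0 i) := by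
    intro i
    apply Fin.ext
    simp [e, f0_apply, cc]
  have hm := Ex_map (e.permCongrHom.toMonoidHom) e (fun a b => by
    refine Equiv.ext fun p => ?_
    simp [Equiv.permCongr_apply, Equiv.swap_apply_def, Equiv.symm_apply_eq]
    split_ifs <;> simp) g Φ
  have hm' : Ex (push e.toEmbedding g) Φ = Ex g (fun ρ => Φ (e.permCongr ρ)) := hm
  have hv : ∀ ρ, Φ (e.permCongr ρ) = (fun f : Fin 4 → Gr (n + 4) => F (fun i => e (f i)))
      (fun i => ρ (f0 i)) := by
    intro ρ
    rw [hF]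
    simp only [hpt, Equiv.permCongr_apply, Equiv.symm_apply_apply]
  rw [hm', ← av_equiv e.permCongr Φ]
  simp only [hv]
  exact grand_un LA LB (starF (n + 3)) (un_of_tshuffle _ _ hAs) (un_of_tshuffle _ _ hBs) hC
    x y z h1 h2 h3 (fun f : Fin 4 → Gr (n + 4) => F (fun i => e (f i)))
end
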